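/- Let f : ℝ^{2n} → ℝ (n ≥ 1) be a smooth function with f(0) = 0 having a non-degenerate local minimum at the origin (∇f(0) = 0 and d²f(0) positive definite). Then there is ε₀ > 0 such that for every ε ∈ (0, ε₀) the level set {f = ε} carries at least n geometrically distinct periodic orbits of the Hamiltonian flow of f: there exist n nonconstant periodic curves γ₁,…,γₙ : ℝ → ℝ^{2n} with γ_j'(t) = i∇f(γ_j(t)), f(γ_j(t)) = ε for all t, and pairwise distinct images γ_j(ℝ). (Weinstein–Moser theorem, as stated in the paper.) -/

import Mathlib

open scoped RealInnerProductSpace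

open MeasureTheory Set in
/-- A small compactly supported `C¹` perturbation of the identity preserves the volume of a ball
containing the support of the perturbation. -/
theorem setIntegral_det_id_add_smul_fderiv {X : Type*} [NormedAddCommGroup X] [NormedSpace ℝ X]
    [FiniteDimensional ℝ X] [MeasurableSpace X] [BorelSpace X] (μ : Measure X)
    [μ.IsAddHaarMeasure] {Φ : X → X} (hΦ : ContDiff ℝ 1 Φ) (hc : HasCompactSupport Φ) :
    ∃ R : ℝ, tsupport Φ ⊆ Metric.closedBall 0 R ∧ ∃ t₀ > (0 : ℝ), ∀ t ∈ Ioo (0 : ℝ) t₀,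
      ∫ x in Metric.closedBall 0 R, (ContinuousLinearMap.id ℝ X + t • fderiv ℝ Φ x).det ∂μ
        = μ.real (Metric.closedBall 0 R) := by
  obtain ⟨R, hR⟩ := hc.isCompact.isBounded.subset_closedBall (0 : X)
  obtain ⟨K, hK⟩ := hΦ.lipschitzWith_of_hasCompactSupport hc one_ne_zero
  have hcont : Continuous fun A : X →L[ℝ] X => (ContinuousLinearMap.id ℝ X + A).det :=
    ContinuousLinearMap.continuous_det.comp (by fun_prop)
  obtain ⟨ε, hε, hεdet⟩ : ∃ ε > 0, ∀ A : X →L[ℝ] X, ‖A‖ < ε →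
      0 < (ContinuousLinearMap.id ℝ X + A).det := by
    have h := hcont.tendsto (0 : X →L[ℝ] X)
    have h1 : (ContinuousLinearMap.id ℝ X + (0 : X →L[ℝ] X)).det = 1 := by
      simp [ContinuousLinearMap.det]
    rw [h1] at h
    obtain ⟨ε, hε, h⟩ := Metric.eventually_nhds_iff.1 (h.eventually (lt_mem_nhds zero_lt_one))
    exact ⟨ε, hε, fun A hA => h (by simpa using hA)⟩
  refine ⟨R, hR, min (ε / (K + 1)) (1 / (K + 1)), by positivity, fun t ht => ?_⟩
  obtain ⟨ht0, ht1⟩ := ht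
  have hK1 : (0 : ℝ) < K + 1 := by positivity
  have htε : t * (K + 1) < ε := (lt_div_iff₀ hK1).1 (ht1.trans_le (min_le_left _ _))
  have ht1 : t * (K + 1) < 1 := (lt_div_iff₀ hK1).1 (ht1.trans_le (min_le_right _ _))
  set f : X → X := fun x => x + t • Φ x with hf
  have hder : ∀ x, HasFDerivAt f (ContinuousLinearMap.id ℝ X + t • fderiv ℝ Φ x) x := fun x =>
    (hasFDerivAt_id x).add
      (((hΦ.differentiable one_ne_zero) x).hasFDerivAt.const_smul t)
  have happ : ApproximatesLinearOn f ((ContinuousLinearEquiv.refl ℝ X : X ≃L[ℝ] X) : X →L[ℝ] X)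
      univ (Real.toNNReal t * K) := by
    intro x _ y _
    have : f x - f y - (x - y) = t • (Φ x - Φ y) := by
      simp only [hf, smul_sub]; abel
    simp only [ContinuousLinearEquiv.coe_refl, ContinuousLinearMap.id_apply, this, norm_smul,
      Real.norm_eq_abs, abs_of_pos ht0]
    have := hK.dist_le_mul x y
    rw [dist_eq_norm, dist_eq_norm] at this
    rw [NNReal.coe_mul, Real.coe_toNNReal t ht0.le, mul_assoc]
    exact mul_le_mul_of_nonneg_left this ht0.le
  have hsmall : Subsingleton X ∨ Real.toNNReal t * K <
      ‖((ContinuousLinearEquiv.refl ℝ X).symm : X →L[ℝ] X)‖₊⁻¹ := by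
    rcases subsingleton_or_nontrivial X with h | h
    · exact Or.inl h
    · right
      have : ‖((ContinuousLinearEquiv.refl ℝ X).symm : X →L[ℝ] X)‖₊ = 1 := by
        simp
      rw [this, inv_one, ← NNReal.coe_lt_coe, NNReal.coe_mul, Real.coe_toNNReal t ht0.le,
        NNReal.coe_one]
      nlinarith
  have hsurj := happ.surjective hsmall
  have hinj : Function.Injective f := fun x y hxy => happ.injOn hsmall (mem_univ x) (mem_univ y) hxy
  have hfix : ∀ x, x ∉ Metric.closedBall (0 : X) R → f x = x := fun x hx => by
    have : Φ x = 0 := image_eq_zero_of_notMem_tsupport fun h => hx (hR h)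
    simp [hf, this]
  have himage : f '' Metric.closedBall 0 R = Metric.closedBall 0 R := by
    have h1 : f '' (Metric.closedBall 0 R)ᶜ = (Metric.closedBall 0 R)ᶜ := by
      conv_rhs => rw [← image_id (Metric.closedBall (0 : X) R)ᶜ]
      exact image_congr fun x hx => hfix x hx
    have h2 := image_compl_eq (s := Metric.closedBall (0 : X) R) ⟨hinj, hsurj⟩
    rw [h1] at h2
    exact (compl_injective h2).symm
  have hcov := integral_image_eq_integral_abs_det_fderiv_smul μ
    (Metric.isClosed_closedBall (x := (0 : X)) (ε := R)).measurableSet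
    (fun x _ => (hder x).hasFDerivWithinAt) hinj.injOn (fun _ => (1 : ℝ))
  rw [himage] at hcov
  simp only [smul_eq_mul, mul_one, integral_const, MeasurableSet.univ, measureReal_restrict_apply,
    univ_inter] at hcov
  rw [hcov]
  refine integral_congr_ae (Filter.Eventually.of_forall fun x => ?_)
  refine (abs_of_pos (hεdet _ ?_)).symm
  rw [norm_smul, Real.norm_eq_abs, abs_of_pos ht0]
  have : ‖fderiv ℝ Φ x‖ ≤ K := norm_fderiv_le_of_lipschitz ℝ hK
  nlinarith [norm_nonneg (fderiv ℝ Φ x)]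

open MeasureTheory Set in
/-- The Jacobian determinant of a compactly supported `C¹` self-map has zero integral. -/
theorem integral_det_fderiv_eq_zero {X : Type*} [NormedAddCommGroup X] [NormedSpace ℝ X]
    [FiniteDimensional ℝ X] [Nontrivial X] [MeasurableSpace X] [BorelSpace X] (μ : Measure X)
    [μ.IsAddHaarMeasure] {Φ : X → X} (hΦ : ContDiff ℝ 1 Φ) (hc : HasCompactSupport Φ) :
    ∫ x, (fderiv ℝ Φ x).det ∂μ = 0 := by
  obtain ⟨R, hR, t₀, ht₀, h⟩ := setIntegral_det_id_add_smul_fderiv μ hΦ hc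
  have hN : 0 < Module.finrank ℝ X := Module.finrank_pos
  set N := Module.finrank ℝ X with hNdef
  have houtside : ∀ x, x ∉ Metric.closedBall (0 : X) R → (fderiv ℝ Φ x).det = 0 := fun x hx => by
    have : fderiv ℝ Φ x = 0 :=
      image_eq_zero_of_notMem_tsupport fun h' => hx (hR (tsupport_fderiv_subset ℝ h'))
    rw [this, ContinuousLinearMap.det, ContinuousLinearMap.toLinearMap_zero, LinearMap.det_zero,
      zero_pow hN.ne']
  rw [← setIntegral_eq_integral_of_forall_compl_eq_zero houtside]
  let v : ℕ → ℝ := fun i => (1 / t₀ + 1) + i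
  have hv : ∀ i, 0 < v i := fun i => by positivity
  have hvinj : InjOn v (Finset.range (N + 1)) := fun i _ j _ hij => by
    simpa [v] using hij
  have hvt : ∀ i, (v i)⁻¹ ∈ Ioo (0 : ℝ) t₀ := fun i => by
    refine ⟨inv_pos.2 (hv i), (inv_lt_comm₀ (hv i) ht₀).2 ?_⟩
    have : (0 : ℝ) ≤ i := Nat.cast_nonneg i
    simp only [v, one_div]; linarith
  have hfint : ∀ i, ∫ x in Metric.closedBall 0 R,
      (v i • ContinuousLinearMap.id ℝ X + fderiv ℝ Φ x).det ∂μ =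
        v i ^ N * μ.real (Metric.closedBall 0 R) := fun i => by
    rw [← h _ (hvt i), ← integral_const_mul]
    refine integral_congr_ae (Filter.Eventually.of_forall fun x => ?_)
    have : v i • ContinuousLinearMap.id ℝ X + fderiv ℝ Φ x =
        v i • (ContinuousLinearMap.id ℝ X + (v i)⁻¹ • fderiv ℝ Φ x) := by
      rw [smul_add, smul_smul, mul_inv_cancel₀ (hv i).ne', one_smul]
    simp only [this, ContinuousLinearMap.det, ContinuousLinearMap.toLinearMap_smul,
      LinearMap.det_smul, hNdef]
  have hinterp : ∀ p : Polynomial ℝ, p.natDegree ≤ N →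
      p.eval 0 = ∑ i ∈ Finset.range (N + 1),
        p.eval (v i) * (Lagrange.basis (Finset.range (N + 1)) v i).eval 0 := fun p hp => by
    have hdeg : p.degree < (Finset.range (N + 1)).card := by
      rw [Finset.card_range]
      exact (Polynomial.degree_le_natDegree).trans_lt (by exact_mod_cast Nat.lt_succ_of_le hp)
    conv_lhs => rw [Lagrange.eq_interpolate hvinj hdeg, Lagrange.interpolate_apply]
    simp [Polynomial.eval_finsetSum]
  have hdet : ∀ x, (fderiv ℝ Φ x).det = ∑ i ∈ Finset.range (N + 1),
      (v i • ContinuousLinearMap.id ℝ X + fderiv ℝ Φ x).det *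
        (Lagrange.basis (Finset.range (N + 1)) v i).eval 0 := fun x => by
    have := hinterp (LinearMap.charpoly (-(fderiv ℝ Φ x : X →ₗ[ℝ] X)))
      (LinearMap.charpoly_natDegree _).le
    simp only [LinearMap.eval_charpoly] at this
    simpa [ContinuousLinearMap.det, Algebra.algebraMap_eq_smul_one, Module.End.one_eq_id] using this
  have hcontΦ : Continuous (fderiv ℝ Φ) := hΦ.continuous_fderiv one_ne_zero
  simp_rw [hdet]
  rw [integral_finsetSum]
  · simp_rw [integral_mul_const, hfint]
    have := hinterp (Polynomial.X ^ N) (by simp)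
    simp only [Polynomial.eval_pow, Polynomial.eval_X, zero_pow hN.ne'] at this
    have h' : ∑ i ∈ Finset.range (N + 1), v i ^ N * μ.real (Metric.closedBall 0 R) *
        (Lagrange.basis (Finset.range (N + 1)) v i).eval 0 =
        μ.real (Metric.closedBall 0 R) * ∑ i ∈ Finset.range (N + 1), v i ^ N *
        (Lagrange.basis (Finset.range (N + 1)) v i).eval 0 := by
      rw [Finset.mul_sum]; exact Finset.sum_congr rfl fun i _ => by ring
    rw [h', ← this, mul_zero]
  · intro i _
    refine ContinuousOn.integrableOn_compact (isCompact_closedBall 0 R) (Continuous.continuousOn ?_)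
    exact (ContinuousLinearMap.continuous_det.comp (by fun_prop)).mul continuous_const

/-- Cramer's rule, paired with a vector. -/
theorem Matrix.det_mul_dotProduct_eq_sum {σ : Type*} [Fintype σ] [DecidableEq σ]
    (A : Matrix σ σ ℝ) (ξ v : σ → ℝ) :
    A.det * (ξ ⬝ᵥ v) = ∑ p, (A p ⬝ᵥ v) * (A.updateRow p ξ).det := by
  have h := A.transpose.mulVec_cramer ξ
  have h2 : (A.transpose.mulVec (A.transpose.cramer ξ)) ⬝ᵥ v = A.det * (ξ ⬝ᵥ v) := by
    rw [h, Matrix.det_transpose, smul_dotProduct, smul_eq_mul]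
  rw [← h2, dotProduct]
  simp only [Matrix.mulVec, dotProduct, Matrix.transpose_apply, Matrix.cramer_transpose_apply,
    Finset.sum_mul]
  rw [Finset.sum_comm]
  exact Finset.sum_congr rfl fun p _ => Finset.sum_congr rfl fun i _ => by ring

/-- The matrix whose rows are the pairs of vectors `x (j i)`, `y (j i)`. -/
def pairMatrix {ι μ : Type*} (x y : μ → (ι × Fin 2) → ℝ) (j : ι → μ) :
    Matrix (ι × Fin 2) (ι × Fin 2) ℝ :=
  Matrix.of fun p => if p.2 = 0 then x (j p.1) else y (j p.1)

/-- If `∑ₗ (xₗ(v) yₗ - yₗ(v) xₗ) = 0` for some `v ≠ 0`, then the sum of all the determinants with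
rows `x (j i)`, `y (j i)` vanishes: the top power of `∑ₗ xₗ ∧ yₗ` is zero. -/
theorem sum_det_pairMatrix_eq_zero {ι μ : Type*} [Fintype ι] [DecidableEq ι] [Fintype μ]
    [DecidableEq μ] (x y : μ → (ι × Fin 2) → ℝ) {v : (ι × Fin 2) → ℝ} (hv : v ≠ 0)
    (h : ∑ l, ((x l ⬝ᵥ v) • y l - (y l ⬝ᵥ v) • x l) = 0) :
    ∑ j : ι → μ, (pairMatrix x y j).det = 0 := by
  have hvv : v ⬝ᵥ v ≠ 0 := fun h => hv (dotProduct_self_eq_zero.1 h)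
  refine (mul_eq_zero.1 ?_).resolve_right hvv
  rw [Finset.sum_mul]
  simp_rw [Matrix.det_mul_dotProduct_eq_sum, Fintype.sum_prod_type]
  rw [Finset.sum_comm]
  refine Finset.sum_eq_zero fun i _ => ?_
  set T : (ι → μ) → (ι × Fin 2 → ℝ) → ℝ := fun j c =>
    (((pairMatrix x y j).updateRow (i, 0) v).updateRow (i, 1) c).det with hT
  have hterm : ∀ j : ι → μ, (∑ k : Fin 2, (pairMatrix x y j (i, k) ⬝ᵥ v) *
      ((pairMatrix x y j).updateRow (i, k) v).det) =
        T j ((x (j i) ⬝ᵥ v) • y (j i) - (y (j i) ⬝ᵥ v) • x (j i)) := by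
    intro j
    have hne : ((i, 0) : ι × Fin 2) ≠ (i, 1) := by simp
    have h0 : ((pairMatrix x y j).updateRow (i, 0) v).det = T j (y (j i)) := by
      simp only [hT]
      congr 1
      ext p q
      by_cases hp : p = (i, 1)
      · subst hp; simp [pairMatrix, Matrix.updateRow_apply]
      · simp [Matrix.updateRow_apply, hp]
    have h1 : ((pairMatrix x y j).updateRow (i, 1) v).det = - T j (x (j i)) := by
      simp only [hT]
      refine Eq.trans ?_ (AlternatingMap.map_swap
        (Matrix.detRowAlternating (n := ι × Fin 2) (R := ℝ)) _ hne)
      change _ = Matrix.det _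
      congr 1
      ext p q
      change _ = ((pairMatrix x y j).updateRow (i, 0) v).updateRow (i, 1) (x (j i))
        (Equiv.swap ((i, 0) : ι × Fin 2) (i, 1) p) q
      by_cases hp : p = (i, 0)
      · subst hp; simp [pairMatrix, Matrix.updateRow_apply]
      · by_cases hp' : p = (i, 1)
        · subst hp'; simp [Matrix.updateRow_apply]
        · simp [Matrix.updateRow_apply, hp, hp', Equiv.swap_apply_of_ne_of_ne hp hp']
    rw [Fin.sum_univ_two, h0, h1]
    have e1 : pairMatrix x y j (i, 0) = x (j i) := by ext; simp [pairMatrix]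
    have e2 : pairMatrix x y j (i, 1) = y (j i) := by ext; simp [pairMatrix]
    rw [e1, e2]
    simp only [hT, sub_eq_add_neg, ← neg_smul, Matrix.det_updateRow_add, Matrix.det_updateRow_smul]
    ring
  simp_rw [hterm]
  rw [← (Equiv.funSplitAt i μ).symm.sum_comp, Fintype.sum_prod_type, Finset.sum_comm]
  refine Finset.sum_eq_zero fun j' _ => ?_
  by_cases hμ : Nonempty μ
  swap
  · simp only [not_nonempty_iff] at hμ; simp
  obtain ⟨l₀⟩ := hμ
  have hT' : ∀ l c, T ((Equiv.funSplitAt i μ).symm (l, j')) c =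
      T ((Equiv.funSplitAt i μ).symm (l₀, j')) c := by
    intro l c
    simp only [hT]
    congr 1
    ext p q
    by_cases hp : p.1 = i
    · obtain ⟨p1, p2⟩ := p
      simp only at hp
      subst hp
      fin_cases p2 <;> simp [Matrix.updateRow_apply]
    · have e1 : p ≠ (i, 0) := fun h => hp (by simp [h])
      have e2 : p ≠ (i, 1) := fun h => hp (by simp [h])
      simp [Matrix.updateRow_apply, e1, e2, pairMatrix, hp]
  simp_rw [hT']
  have hsi : ∀ l, (Equiv.funSplitAt i μ).symm (l, j') i = l := fun l => by simp
  simp_rw [hsi]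
  have := (Matrix.detRowAlternating (n := ι × Fin 2) (R := ℝ)).map_update_sum
    Finset.univ ((i, 1) : ι × Fin 2)
    (fun l => (x l ⬝ᵥ v) • y l - (y l ⬝ᵥ v) • x l)
    ((pairMatrix x y ((Equiv.funSplitAt i μ).symm (l₀, j'))).updateRow (i, 0) v)
  rw [h] at this
  simp only [hT]
  refine Eq.trans this.symm ?_
  exact AlternatingMap.map_update_zero _ _ _

/-- The sum of the Jacobian determinants of `n`-tuples of components of a real linear map into
`ℂᵐ` vanishes if the pulled back symplectic form is degenerate. -/
theorem sum_det_pi_eq_zero {ι μ : Type*} [Fintype ι] [DecidableEq ι] [Fintype μ]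
    [DecidableEq μ] (L : μ → (ι → ℂ) →ₗ[ℝ] ℂ) {v : ι → ℂ} (hv : v ≠ 0)
    (h : ∀ u, ∑ l, ((L l v).re * (L l u).im - (L l v).im * (L l u).re) = 0) :
    ∑ j : ι → μ, LinearMap.det (LinearMap.pi fun i => L (j i)) = 0 := by
  let b : Module.Basis (ι × Fin 2) ℝ (ι → ℂ) :=
    (Pi.basis fun _ : ι => Complex.basisOneI).reindex (Equiv.sigmaEquivProd ι (Fin 2))
  let x : μ → (ι × Fin 2) → ℝ := fun l s => (L l (b s)).re
  let y : μ → (ι × Fin 2) → ℝ := fun l s => (L l (b s)).im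
  have hsum : ∀ l u, L l u = ∑ s, b.repr u s • L l (b s) := fun l u => by
    conv_lhs => rw [← b.sum_repr u, map_sum]
    simp only [map_smul]
  have hx : ∀ l u, x l ⬝ᵥ (b.repr u : ι × Fin 2 → ℝ) = (L l u).re := fun l u => by
    rw [hsum]; simp [x, dotProduct, mul_comm]
  have hy : ∀ l u, y l ⬝ᵥ (b.repr u : ι × Fin 2 → ℝ) = (L l u).im := fun l u => by
    rw [hsum]; simp [y, dotProduct, mul_comm]
  have key := sum_det_pairMatrix_eq_zero x y (v := (b.repr v : ι × Fin 2 → ℝ))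
    (fun h0 => hv (b.repr.map_eq_zero_iff.1 (DFunLike.coe_injective h0))) (by
      ext s
      have := h (b s)
      simp only [Finset.sum_apply, Pi.sub_apply, Pi.smul_apply, smul_eq_mul, Pi.zero_apply, hx, hy]
      exact this)
  rw [← key]
  refine Finset.sum_congr rfl fun j _ => ?_
  rw [← LinearMap.det_toMatrix b]
  congr 1
  ext ⟨i, k⟩ s
  rw [LinearMap.toMatrix_apply]
  fin_cases k <;> simp [b, pairMatrix, x, y]

/-- The diagonal phase rotation with frequencies `ω` at time `t`. -/
noncomputable def phase {ι : Type*} (ω : ι → ℝ) (t : ℝ) (u : ι → ℂ) : ι → ℂ :=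
  fun j => Complex.exp ((ω j * t : ℝ) * Complex.I) * u j

theorem phase_apply {ι : Type*} (ω : ι → ℝ) (t : ℝ) (u : ι → ℂ) (j : ι) :
    phase ω t u j = Complex.exp ((ω j * t : ℝ) * Complex.I) * u j := rfl

theorem norm_phase_apply {ι : Type*} (ω : ι → ℝ) (t : ℝ) (u : ι → ℂ) (j : ι) :
    ‖phase ω t u j‖ = ‖u j‖ := by
  rw [phase_apply, norm_mul, Complex.norm_exp_ofReal_mul_I, one_mul]

theorem phase_sub {ι : Type*} (ω : ι → ℝ) (t : ℝ) (u v : ι → ℂ) :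
    phase ω t (u - v) = phase ω t u - phase ω t v := by
  ext j; simp [phase_apply, mul_sub]

theorem measurePreserving_phase {ι : Type*} [Fintype ι] (ω : ι → ℝ) (t : ℝ) :
    MeasureTheory.MeasurePreserving (phase ω t) := by
  have h : ∀ j, MeasureTheory.MeasurePreserving
      (fun z : ℂ => Complex.exp ((ω j * t : ℝ) * Complex.I) * z) := fun j => by
    have := (rotation ⟨Complex.exp ((ω j * t : ℝ) * Complex.I), by
      exact mem_sphere_zero_iff_norm.2 (Complex.norm_exp_ofReal_mul_I _)⟩).measurePreserving
    exact this
  exact MeasureTheory.volume_preserving_pi h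

open MeasureTheory in
/-- A continuous equivariant map can be approximated on compact sets by smooth equivariant maps. -/
theorem exists_contDiff_phase_equivariant_approx {ι κ : Type*} [Fintype ι] [Fintype κ]
    (ω : ι → ℝ) (w : κ → ℝ) {g : (ι → ℂ) → κ → ℂ} (hg : Continuous g)
    (heq : ∀ t u, g (phase ω t u) = phase w t (g u)) {A : Set (ι → ℂ)} (hA : IsCompact A)
    {ε : ℝ} (hε : 0 < ε) :
    ∃ K : (ι → ℂ) → κ → ℂ, ContDiff ℝ 1 K ∧ (∀ t u, K (phase ω t u) = phase w t (K u)) ∧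
      ∀ x ∈ A, ‖K x - g x‖ ≤ ε := by
  obtain ⟨δ, hδ, hgδ⟩ : ∃ δ > 0, ∀ x ∈ A, ∀ y, dist x y < δ → dist (g x) (g y) < ε := by
    have := hA.uniformContinuousAt_of_continuousAt g (fun a _ => hg.continuousAt)
      (Metric.dist_mem_uniformity hε)
    obtain ⟨δ, hδ, h⟩ := Metric.mem_uniformity_dist.1 this
    exact ⟨δ, hδ, fun x hx y hxy => h hxy hx⟩
  let φ : (ι → ℂ) → ℝ := fun u => Real.smoothTransition (1 - (4 / δ ^ 2) * ∑ j, ‖u j‖ ^ 2)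
  have hφ0 : ∀ u, 0 ≤ φ u := fun u => Real.smoothTransition.nonneg _
  have hφinv : ∀ t u, φ (phase ω t u) = φ u := fun t u => by simp only [φ, norm_phase_apply]
  have hφsmooth : ContDiff ℝ 1 φ := by
    refine Real.smoothTransition.contDiff.comp (contDiff_const.sub (contDiff_const.mul
      (ContDiff.sum (s := Finset.univ) (f := fun j (u : ι → ℂ) => ‖u j‖ ^ 2) fun j _ => ?_)))
    exact (contDiff_apply ℝ ℂ j).norm_sq ℝ
  have hφsupp : ∀ u, φ u ≠ 0 → ‖u‖ < δ := by
    intro u hu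
    rw [pi_norm_lt_iff hδ]
    intro j
    by_contra! hj
    refine hu (Real.smoothTransition.zero_of_nonpos ?_)
    have h1 : ‖u j‖ ^ 2 ≤ ∑ j, ‖u j‖ ^ 2 :=
      Finset.single_le_sum (f := fun j => ‖u j‖ ^ 2) (fun i _ => by positivity) (Finset.mem_univ j)
    have h2 : δ ^ 2 ≤ ‖u j‖ ^ 2 := by gcongr
    have h3 : 4 / δ ^ 2 * δ ^ 2 = 4 := by field_simp
    have h4 : 4 / δ ^ 2 * δ ^ 2 ≤ 4 / δ ^ 2 * ∑ j, ‖u j‖ ^ 2 := by gcongr; exact h2.trans h1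
    linarith
  have hφc : HasCompactSupport φ := by
    refine HasCompactSupport.intro (isCompact_closedBall (0 : ι → ℂ) δ) fun x hx => ?_
    by_contra h
    exact hx (by simpa using (hφsupp x h).le)
  have hφcont : Continuous φ := hφsmooth.continuous
  have hφint : Integrable φ := hφcont.integrable_of_hasCompactSupport hφc
  have hpos : 0 < ∫ u, φ u := by
    refine (hφcont.integral_pos_of_hasCompactSupport_nonneg_nonzero hφc hφ0 (x := 0) ?_)
    simp [φ, Real.smoothTransition.one_of_one_le]
  let K : (ι → ℂ) → κ → ℂ := fun x => (∫ u, φ u)⁻¹ • ∫ t, φ t • g (x - t)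
  have hfint : ∀ x, Integrable fun t => φ t • g (x - t) := fun x =>
    (hφcont.smul (hg.comp (continuous_const.sub continuous_id))).integrable_of_hasCompactSupport
      (hφc.smul_right (f' := fun t => g (x - t)))
  refine ⟨K, ?_, ?_, ?_⟩
  · refine ContDiff.smul (f := fun _ => (∫ u, φ u)⁻¹) contDiff_const ?_
    exact hφc.contDiff_convolution_left (ContinuousLinearMap.lsmul ℝ ℝ) hφsmooth
      hg.locallyIntegrable
  · intro t u
    have h1 : ∫ s, φ s • g (phase ω t u - s) = ∫ s, φ s • phase w t (g (u - s)) := by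
      rw [← (measurePreserving_phase ω t).map_eq, integral_map
        (measurePreserving_phase ω t).measurable.aemeasurable]
      · rw [(measurePreserving_phase ω t).map_eq]
        simp only [hφinv, ← phase_sub, heq]
      · exact (hφcont.smul (hg.comp (continuous_const.sub continuous_id))).aestronglyMeasurable
    have h2 : Integrable fun s => φ s • phase w t (g (u - s)) := by
      refine (hφcont.smul ?_).integrable_of_hasCompactSupport
        (hφc.smul_right (f' := fun s => phase w t (g (u - s))))
      exact continuous_pi fun l => continuous_const.mul
        ((continuous_apply l).comp (hg.comp (continuous_const.sub continuous_id)))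
    ext l
    simp only [K]
    rw [h1, phase_apply, Pi.smul_apply, Pi.smul_apply,
      eval_integral fun l => h2.eval l, eval_integral fun l => (hfint u).eval l,
      mul_smul_comm, ← integral_const_mul]
    refine congrArg _ (integral_congr_ae (Filter.Eventually.of_forall fun s => ?_))
    simp only [Pi.smul_apply, phase_apply, mul_smul_comm]
  · intro x hx
    have h1 : K x - g x = (∫ u, φ u)⁻¹ • ∫ t, φ t • (g (x - t) - g x) := by
      simp only [K, smul_sub]
      rw [integral_sub (hfint x) (hφint.smul_const _), integral_smul_const, smul_sub, smul_smul,
        inv_mul_cancel₀ hpos.ne', one_smul]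
    rw [h1, norm_smul, norm_inv, Real.norm_of_nonneg hpos.le, inv_mul_le_iff₀ hpos,
      ← integral_mul_const]
    refine norm_integral_le_of_norm_le (hφint.mul_const _) (Filter.Eventually.of_forall fun t => ?_)
    rw [norm_smul, Real.norm_of_nonneg (hφ0 t)]
    by_cases ht : φ t = 0
    · simp [ht]
    · have := hgδ x hx (x - t) (by simpa using hφsupp t ht)
      rw [dist_comm, dist_eq_norm] at this
      exact mul_le_mul_of_nonneg_left this.le (hφ0 t)

/-- The sum of the determinants of the maps obtained from a real linear map into `ℂᵐ` by choosing
an `n`-tuple of components. -/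
noncomputable def sumDet {ι μ : Type*} [Fintype ι] [Fintype μ] [DecidableEq ι]
    (L : (ι → ℂ) →L[ℝ] μ → ℂ) : ℝ :=
  ∑ j : ι → μ, ((ContinuousLinearMap.pi fun i => ContinuousLinearMap.proj (j i)).comp L).det

theorem continuous_sumDet {ι μ : Type*} [Fintype ι] [Fintype μ] [DecidableEq ι] :
    Continuous (sumDet : ((ι → ℂ) →L[ℝ] μ → ℂ) → ℝ) :=
  continuous_finsetSum _ fun _ _ => ContinuousLinearMap.continuous_det.comp (by fun_prop)

theorem sumDet_zero {ι μ : Type*} [Fintype ι] [Nonempty ι] [DecidableEq ι] [Fintype μ] :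
    sumDet (0 : (ι → ℂ) →L[ℝ] μ → ℂ) = 0 := by
  refine Finset.sum_eq_zero fun j _ => ?_
  rw [ContinuousLinearMap.comp_zero, ContinuousLinearMap.det, ContinuousLinearMap.toLinearMap_zero,
    LinearMap.det_zero, zero_pow Module.finrank_pos.ne']

open MeasureTheory in
theorem integral_sumDet_fderiv {ι μ : Type*} [Fintype ι] [Nonempty ι] [DecidableEq ι] [Fintype μ]
    {G : (ι → ℂ) → μ → ℂ} (hG : ContDiff ℝ 1 G) (hc : HasCompactSupport G) :
    ∫ x, sumDet (fderiv ℝ G x) = 0 := by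
  have h0 : Continuous (fderiv ℝ G) := hG.continuous_fderiv one_ne_zero
  simp only [sumDet]
  rw [integral_finsetSum]
  · refine Finset.sum_eq_zero fun j _ => ?_
    let P : (μ → ℂ) →L[ℝ] ι → ℂ := ContinuousLinearMap.pi fun i => ContinuousLinearMap.proj (j i)
    rw [← integral_det_fderiv_eq_zero volume (P.contDiff.comp hG)
      (hc.comp_left (g := P) P.map_zero)]
    congr 1
    ext x
    rw [fderiv_comp x P.differentiableAt (hG.differentiable one_ne_zero x), P.fderiv]
  · intro j _
    refine Continuous.integrable_of_hasCompactSupport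
      (ContinuousLinearMap.continuous_det.comp (by fun_prop)) ?_
    refine (hc.fderiv ℝ).comp_left (g := fun L : (ι → ℂ) →L[ℝ] μ → ℂ =>
      ((ContinuousLinearMap.pi fun i => ContinuousLinearMap.proj (j i)).comp L).det) ?_
    rw [ContinuousLinearMap.comp_zero, ContinuousLinearMap.det,
      ContinuousLinearMap.toLinearMap_zero, LinearMap.det_zero, zero_pow Module.finrank_pos.ne']

theorem sumDet_eq_zero_of_degenerate {ι μ : Type*} [Fintype ι] [DecidableEq ι] [Fintype μ]
    (L : (ι → ℂ) →L[ℝ] μ → ℂ) {v : ι → ℂ} (hv : v ≠ 0)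
    (h : ∀ u, ∑ l, ((L v l).re * (L u l).im - (L v l).im * (L u l).re) = 0) :
    sumDet L = 0 := by
  classical
  exact sum_det_pi_eq_zero (fun l => (LinearMap.proj l).comp (L : (ι → ℂ) →ₗ[ℝ] μ → ℂ)) hv h

theorem sumDet_eq_zero_of_card_lt {ι κ : Type*} [Fintype ι] [DecidableEq ι] [Fintype κ]
    (h : Fintype.card κ < Fintype.card ι) (L : (ι → ℂ) →L[ℝ] ι ⊕ κ → ℂ)
    (hL : ∀ u i, L u (Sum.inl i) = 0) : sumDet L = 0 := by
  refine Finset.sum_eq_zero fun j _ => ?_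
  let M : (ι → ℂ) →ₗ[ℝ] κ → ℂ := 
    (LinearMap.funLeft ℝ ℂ Sum.inr).comp (L : (ι → ℂ) →ₗ[ℝ] ι ⊕ κ → ℂ)
  have hker : LinearMap.ker M ≠ ⊥ := LinearMap.ker_ne_bot_of_finrank_lt (by
    simp only [Module.finrank_pi_fintype, Complex.finrank_real_complex, Finset.sum_const,
      Finset.card_univ, smul_eq_mul]
    omega)
  obtain ⟨u, hu, hu0⟩ := (Submodule.ne_bot_iff _).1 hker
  have hLu : L u = 0 := by
    ext l
    rcases l with i | k
    · exact hL u i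
    · exact congrFun (LinearMap.mem_ker.1 hu) k
  by_contra hdet
  have hinj := (LinearMap.equivOfDetNeZero _ hdet).injective
  exact hu0 (hinj (by simp [LinearMap.equivOfDetNeZero, hLu]))

theorem LinearMap.det_smul_id_add_smulRight {X : Type*} [AddCommGroup X] [Module ℝ X]
    [FiniteDimensional ℝ X] {s : ℝ} (hs : s ≠ 0) (c : X →ₗ[ℝ] ℝ) (u : X) :
    LinearMap.det (s • LinearMap.id + c.smulRight u) =
      s ^ Module.finrank ℝ X * (1 + s⁻¹ * c u) := by
  have : s • LinearMap.id + c.smulRight u = s • LinearMap.transvection (s⁻¹ • c) u := by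
    ext x
    simp [LinearMap.transvection, smul_smul, hs]
  rw [this, LinearMap.det_smul, LinearMap.transvection.det]
  simp

theorem det_le_sumDet {ι κ : Type*} [Fintype ι] [DecidableEq ι] [Fintype κ]
    (L : (ι → ℂ) →L[ℝ] ι ⊕ κ → ℂ) (T : (ι → ℂ) →L[ℝ] ι → ℂ)
    (hl : ∀ u i, L u (Sum.inl i) = T u i) (hr : ∀ u k, L u (Sum.inr k) = 0) (hT : 0 ≤ T.det) :
    T.det ≤ sumDet L := by
  let P : (ι → ι ⊕ κ) → (ι → ℂ) →ₗ[ℂ] ι → ℂ := fun j =>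
    LinearMap.pi fun i => Sum.elim (fun i' => LinearMap.proj i') (fun _ => 0) (j i)
  have hP : ∀ j, ((ContinuousLinearMap.pi fun i => ContinuousLinearMap.proj (j i)).comp L).det =
      Complex.normSq (LinearMap.det (P j)) * T.det := fun j => by
    have h1 : LinearMap.det ((P j).restrictScalars ℝ) = Complex.normSq (LinearMap.det (P j)) := by
      rw [LinearMap.det_restrictScalars, Algebra.norm_complex_apply]
    rw [← h1, ContinuousLinearMap.det, ContinuousLinearMap.det, ← LinearMap.det_comp]
    congr 1
    refine LinearMap.ext fun u => funext fun i => ?_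
    rcases h : j i with i' | k <;> simp [P, h, hl, hr]
  have hterm : ∀ j : ι → ι ⊕ κ, 0 ≤
      ((ContinuousLinearMap.pi fun i => ContinuousLinearMap.proj (j i)).comp L).det :=
        fun j => by rw [hP]; exact mul_nonneg (Complex.normSq_nonneg _) hT
  refine le_trans (le_of_eq ?_) <| (Finset.single_le_sum (fun j _ => hterm j)
    (Finset.mem_univ (Sum.inl : ι → ι ⊕ κ)))
  rw [hP]
  have : P Sum.inl = LinearMap.id := by ext; simp [P]
  rw [this, LinearMap.det_id]
  simp

/-- The weighted square norm `∑ⱼ ωⱼ |uⱼ|²`. -/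
noncomputable def weightedSq {ι : Type*} [Fintype ι] (ω : ι → ℝ) (u : ι → ℂ) : ℝ :=
  ∑ j, ω j * ‖u j‖ ^ 2

theorem contDiff_weightedSq {ι : Type*} [Fintype ι] (ω : ι → ℝ) {n : WithTop ℕ∞} :
    ContDiff ℝ n (weightedSq ω) :=
  ContDiff.sum (f := fun j (u : ι → ℂ) => ω j * ‖u j‖ ^ 2) fun j _ =>
    contDiff_const.mul ((contDiff_apply ℝ ℂ j).norm_sq ℝ)

theorem hasFDerivAt_weightedSq {ι : Type*} [Fintype ι] (ω : ι → ℝ) (u : ι → ℂ) :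
    HasFDerivAt (weightedSq ω)
      (∑ j, ω j • (2 • (innerSL ℝ (u j)).comp (ContinuousLinearMap.proj j))) u :=
  HasFDerivAt.fun_sum fun j _ => ((hasFDerivAt_apply j u).norm_sq).const_mul (ω j)

theorem weightedSq_phase {ι : Type*} [Fintype ι] (ω ω' : ι → ℝ) (t : ℝ) (u : ι → ℂ) :
    weightedSq ω (phase ω' t u) = weightedSq ω u := by
  simp only [weightedSq, norm_phase_apply]

theorem weightedSq_nonneg {ι : Type*} [Fintype ι] {ω : ι → ℝ} (hω : ∀ j, 0 < ω j) (u : ι → ℂ) :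
    0 ≤ weightedSq ω u :=
  Finset.sum_nonneg fun j _ => mul_nonneg (hω j).le (by positivity)

theorem weightedSq_smul {ι : Type*} [Fintype ι] (ω : ι → ℝ) (c : ℝ) (u : ι → ℂ) :
    weightedSq ω (c • u) = c ^ 2 * weightedSq ω u := by
  simp only [weightedSq, Pi.smul_apply, norm_smul, mul_pow, Finset.mul_sum, Real.norm_eq_abs,
    sq_abs]
  exact Finset.sum_congr rfl fun j _ => by ring

theorem weightedSq_eq_zero {ι : Type*} [Fintype ι] {ω : ι → ℝ} (hω : ∀ j, 0 < ω j) {u : ι → ℂ} :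
    weightedSq ω u = 0 ↔ u = 0 := by
  rw [weightedSq, Finset.sum_eq_zero_iff_of_nonneg fun j _ => mul_nonneg (hω j).le (by positivity)]
  constructor
  · intro h
    ext j
    simpa [(hω j).ne'] using h j (Finset.mem_univ j)
  · rintro rfl; simp

theorem isCompact_weightedSq_le {ι : Type*} [Fintype ι] {ω : ι → ℝ} (hω : ∀ j, 0 < ω j) (r : ℝ) :
    IsCompact {u : ι → ℂ | weightedSq ω u ≤ r} := by
  refine Metric.isCompact_of_isClosed_isBounded
    (isClosed_le (contDiff_weightedSq ω (n := 0)).continuous continuous_const) ?_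
  refine (Metric.isBounded_iff_subset_closedBall 0).2 ⟨∑ j, √(r / ω j), fun u hu => ?_⟩
  rw [mem_closedBall_zero_iff, pi_norm_le_iff_of_nonneg
    (Finset.sum_nonneg fun j _ => by positivity)]
  intro j
  refine le_trans (Real.le_sqrt_of_sq_le ?_)
    (Finset.single_le_sum (f := fun j => √(r / ω j)) (fun j _ => by positivity) (Finset.mem_univ j))
  rw [le_div_iff₀ (hω j), mul_comm]
  exact (Finset.single_le_sum (f := fun j => ω j * ‖u j‖ ^ 2)
    (fun j _ => mul_nonneg (hω j).le (by positivity)) (Finset.mem_univ j)).trans hu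

/-- The Jacobian of a radial rescaling. -/
theorem det_fderiv_radial {ι : Type*} [Fintype ι] (ω : ι → ℝ) {S : ℝ → ℝ} {s' : ℝ} {u : ι → ℂ}
    (hS : HasDerivAt S s' (weightedSq ω u)) (h0 : S (weightedSq ω u) ≠ 0) :
    ∃ T : (ι → ℂ) →L[ℝ] ι → ℂ, HasFDerivAt (fun u : ι → ℂ => S (weightedSq ω u) • u) T u ∧
      T.det = S (weightedSq ω u) ^ Module.finrank ℝ (ι → ℂ) *
        (1 + (S (weightedSq ω u))⁻¹ * (2 * s' * weightedSq ω u)) := by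
  have h := (hS.comp_hasFDerivAt u (hasFDerivAt_weightedSq ω u)).smul (hasFDerivAt_id u)
  refine ⟨_, h, ?_⟩
  refine (LinearMap.det_smul_id_add_smulRight h0
    ((s' • (∑ j, ω j • (2 • (innerSL ℝ (u j)).comp (ContinuousLinearMap.proj j))) :
      (ι → ℂ) →L[ℝ] ℝ) : (ι → ℂ) →ₗ[ℝ] ℝ) u).trans ?_
  congr 3
  simp only [weightedSq, ContinuousLinearMap.coe_coe, smul_apply,
    sum_apply, ContinuousLinearMap.comp_apply, ContinuousLinearMap.proj_apply,
    innerSL_apply_apply, real_inner_self_eq_norm_sq, Finset.mul_sum, smul_eq_mul]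
  exact Finset.sum_congr rfl fun j _ => by simp; ring

theorem hasDerivAt_phase_apply {κ : Type*} (w : κ → ℝ) (z : κ → ℂ) (l : κ) :
    HasDerivAt (fun t => phase w t z l) (w l * Complex.I * z l) 0 := by
  have h1 : HasDerivAt (fun t : ℝ => ((w l * t : ℝ) : ℂ) * Complex.I) (w l * Complex.I) 0 := by
    have := ((hasDerivAt_id (0 : ℝ)).const_mul (w l)).ofReal_comp.mul_const Complex.I
    simpa using this
  have := (h1.cexp).mul_const (z l)
  simpa [phase] using this

/-- An equivariant map has degenerate Jacobian wherever its moment map is locally constant. -/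
theorem sumDet_fderiv_eq_zero_of_moment {ι μ : Type*} [Fintype ι] [DecidableEq ι] [Fintype μ]
    {ω : ι → ℝ} (hω : ∀ j, 0 < ω j) {w : μ → ℝ} {G : (ι → ℂ) → μ → ℂ} {u : ι → ℂ} (hu : u ≠ 0)
    (hG : DifferentiableAt ℝ G u) (heq : ∀ t, G (phase ω t u) = phase w t (G u))
    (hm : ∀ᶠ y in nhds u, weightedSq w (G y) = weightedSq w (G u)) :
    sumDet (fderiv ℝ G u) = 0 := by
  set v : ι → ℂ := fun j => ω j * Complex.I * u j with hv
  have hv0 : v ≠ 0 := fun h => hu (by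
    ext j
    have := congrFun h j
    simpa [hv, (hω j).ne'] using this)
  have hDv : fderiv ℝ G u v = fun l => w l * Complex.I * G u l := by
    have h1 : HasDerivAt (fun t => phase ω t u) v 0 := hasDerivAt_pi.2 fun j =>
      hasDerivAt_phase_apply ω u j
    have h0 : phase ω 0 u = u := by ext j; simp [phase]
    have hG' : HasFDerivAt G (fderiv ℝ G u) (phase ω 0 u) := by rw [h0]; exact hG.hasFDerivAt
    have h2 := hG'.comp_hasDerivAt (0 : ℝ) h1
    have h3 : HasDerivAt (fun t => phase w t (G u)) (fun l => w l * Complex.I * G u l) 0 :=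
      hasDerivAt_pi.2 fun l => hasDerivAt_phase_apply w (G u) l
    rw [show (G ∘ fun t => phase ω t u) = fun t => phase w t (G u) from funext heq] at h2
    exact h2.unique h3
  have hmom : ∀ h, ∑ l, w l * (2 * ⟪G u l, fderiv ℝ G u h l⟫) = 0 := by
    intro h
    have h1 := (hasFDerivAt_weightedSq w (G u)).comp u hG.hasFDerivAt
    have h2 : HasFDerivAt (weightedSq w ∘ G) (0 : (ι → ℂ) →L[ℝ] ℝ) u :=
      (hasFDerivAt_const (weightedSq w (G u)) u).congr_of_eventuallyEq hm
    have := DFunLike.congr_fun (h1.unique h2) h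
    simpa [mul_add] using this
  refine sumDet_eq_zero_of_degenerate _ hv0 fun h => ?_
  have := hmom h
  have h2 : ∑ l, w l * ⟪G u l, fderiv ℝ G u h l⟫ = 0 := by
    have h3 : ∑ l, w l * (2 * ⟪G u l, fderiv ℝ G u h l⟫) =
        2 * ∑ l, w l * ⟪G u l, fderiv ℝ G u h l⟫ := by
      rw [Finset.mul_sum]; exact Finset.sum_congr rfl fun l _ => by ring
    linarith
  rw [hDv, ← neg_eq_zero, ← Finset.sum_neg_distrib, ← h2]
  refine Finset.sum_congr rfl fun l _ => ?_
  simp [Complex.inner]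
  ring

open Real in
/-- A Borsuk–Ulam theorem for linear flows: an equivariant continuous map to a space of smaller
dimension has a zero. -/
theorem exists_ne_zero_eq_zero_of_equivariant {ι κ : Type*} [Fintype ι] [Fintype κ]
    (hcard : Fintype.card κ < Fintype.card ι) {ω : ι → ℝ} (hω : ∀ j, 0 < ω j) {w : κ → ℝ}
    (hw : ∀ l, 0 < w l) {F : (ι → ℂ) → κ → ℂ} (hF : ContinuousOn F {0}ᶜ)
    (heq : ∀ t u, F (phase ω t u) = phase w t (F u)) : ∃ u ≠ 0, F u = 0 := by
  classical
  by_contra! hne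
  have : Nonempty ι := Fintype.card_pos_iff.1 (by omega)
  set q : (ι → ℂ) → ℝ := weightedSq ω with hq
  have hqc : Continuous q := (contDiff_weightedSq ω (n := 0)).continuous
  have hq0 : ∀ u, 0 < q u → u ≠ 0 := fun u hu h => by
    rw [h, hq, (weightedSq_eq_zero hω).2 rfl] at hu; exact lt_irrefl _ hu
  -- extend `F` continuously by cutting it off near the origin
  let g : (ι → ℂ) → κ → ℂ := fun u => smoothTransition (4 * q u - 1) • F u
  have hg : Continuous g := by
    refine continuous_iff_continuousAt.2 fun u => ?_
    by_cases hu : u = 0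
    · have : g =ᶠ[nhds u] fun _ => 0 := by
        have h1 : q u < 1 / 4 := by rw [hu, hq, (weightedSq_eq_zero hω).2 rfl]; norm_num
        filter_upwards [hqc.continuousAt.eventually (gt_mem_nhds h1)] with y hy
        simp only [g]
        rw [smoothTransition.zero_of_nonpos (by linarith), zero_smul]
      exact continuousAt_const.congr this.symm
    · exact (smoothTransition.continuous.comp (by fun_prop)).continuousAt.smul
        (hF.continuousAt (isOpen_compl_singleton.mem_nhds hu))
  have hgeq : ∀ t u, g (phase ω t u) = phase w t (g u) := fun t u => by
    ext l
    simp only [g, hq, weightedSq_phase, heq, phase_apply, Pi.smul_apply, mul_smul_comm]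
  have hA : IsCompact {u | 2 ≤ q u ∧ q u ≤ 4} :=
    (isCompact_weightedSq_le hω 4).inter_left (isClosed_le continuous_const hqc)
  obtain ⟨ε, hε, hgε⟩ : ∃ ε > 0, ∀ u ∈ {u | 2 ≤ q u ∧ q u ≤ 4}, ε < ‖g u‖ := by
    have hpos : ∀ u ∈ {u | 2 ≤ q u ∧ q u ≤ 4}, 0 < ‖g u‖ := by
      rintro u ⟨hu, -⟩
      rw [norm_pos_iff]
      simp only [g]
      rw [smoothTransition.one_of_one_le (by linarith), one_smul]
      exact hne u (hq0 u (by linarith))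
    rcases Set.eq_empty_or_nonempty {u | 2 ≤ q u ∧ q u ≤ 4} with h | h
    · exact ⟨1, one_pos, by simp [h]⟩
    · obtain ⟨u₀, hu₀, hmin⟩ := hA.exists_isMinOn h hg.norm.continuousOn
      exact ⟨‖g u₀‖ / 2, by have := hpos u₀ hu₀; positivity, fun u hu =>
        (half_lt_self (hpos u₀ hu₀)).trans_le (hmin hu)⟩
  obtain ⟨K, hK, hKeq, hKg⟩ := exists_contDiff_phase_equivariant_approx ω w hg hgeq hA hε
  have hKne : ∀ u, 2 ≤ q u → q u ≤ 4 → K u ≠ 0 := fun u h2 h4 h0 => by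
    have h1 := hKg u ⟨h2, h4⟩
    have h2 := hgε u ⟨h2, h4⟩
    rw [h0, zero_sub, norm_neg] at h1
    linarith
  -- the comparison map
  let ψ : ℝ → ℝ := fun r => r + smoothTransition (1 - r)
  have hψ : ∀ u, 0 < ψ (q u) := fun u => by
    rcases lt_or_ge (q u) 1 with h | h
    · exact add_pos_of_nonneg_of_pos (weightedSq_nonneg hω u)
        (smoothTransition.pos_of_pos (by linarith))
    · exact add_pos_of_pos_of_nonneg (by linarith) (smoothTransition.nonneg _)
  let χ : ℝ → ℝ := fun r => π / 2 * smoothTransition (2 * (r - 2))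
  let D : (ι → ℂ) → ℝ := fun u => weightedSq w (K u) + smoothTransition (2 - q u) +
    smoothTransition (q u - 4)
  have hD : ∀ u, 0 < D u := fun u => by
    have h1 := weightedSq_nonneg hw (K u)
    have h2 := smoothTransition.nonneg (2 - q u)
    have h3 := smoothTransition.nonneg (q u - 4)
    by_cases ha : q u < 2
    · have := smoothTransition.pos_of_pos (x := 2 - q u) (by linarith)
      simp only [D]; linarith
    · by_cases hb : 4 < q u
      · have := smoothTransition.pos_of_pos (x := q u - 4) (by linarith)
        simp only [D]; linarith
      · have : weightedSq w (K u) ≠ 0 := fun h =>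
          hKne u (not_lt.1 ha) (not_lt.1 hb) ((weightedSq_eq_zero hw).1 h)
        have : 0 < weightedSq w (K u) := lt_of_le_of_ne h1 this.symm
        simp only [D]; linarith
  let A : (ι → ℂ) → ℝ := fun u => cos (χ (q u)) * (√(ψ (q u)))⁻¹
  let B : (ι → ℂ) → ℝ := fun u => sin (χ (q u)) * smoothTransition (4 - q u) * (√(D u))⁻¹
  let G : (ι → ℂ) → ι ⊕ κ → ℂ := fun u => Sum.elim (A u • u) (B u • K u)
  have hqs : ContDiff ℝ 1 q := contDiff_weightedSq ω
  have hτ : ContDiff ℝ 1 smoothTransition := smoothTransition.contDiff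
  have hχ : ContDiff ℝ 1 fun u => χ (q u) :=
    contDiff_const.mul (hτ.comp (contDiff_const.mul (hqs.sub contDiff_const)))
  have hG : ContDiff ℝ 1 G := by
    have hAs : ContDiff ℝ 1 A := by
      refine (contDiff_cos.comp hχ).mul (ContDiff.inv (ContDiff.sqrt ?_ fun u => (hψ u).ne') ?_)
      · exact hqs.add (hτ.comp (contDiff_const.sub hqs))
      · exact fun u => (sqrt_pos.2 (hψ u)).ne'
    have hBs : ContDiff ℝ 1 B := by
      refine ((contDiff_sin.comp hχ).mul (hτ.comp (contDiff_const.sub hqs))).mul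
        (ContDiff.inv (ContDiff.sqrt ?_ fun u => (hD u).ne') fun u => (sqrt_pos.2 (hD u)).ne')
      exact (((contDiff_weightedSq w).comp hK).add (hτ.comp (contDiff_const.sub hqs))).add
        (hτ.comp (hqs.sub contDiff_const))
    refine contDiff_pi.2 fun l => ?_
    rcases l with i | k
    · exact hAs.smul (contDiff_apply ℝ ℂ i)
    · exact hBs.smul (contDiff_pi.1 hK k)
  have hGc : HasCompactSupport G := by
    refine HasCompactSupport.intro (isCompact_weightedSq_le hω 4) fun u hu => ?_
    have hu : 4 < q u := not_le.1 hu
    ext l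
    rcases l with i | k
    · have : cos (χ (q u)) = 0 := by
        simp only [χ]
        rw [smoothTransition.one_of_one_le (by linarith), mul_one, cos_pi_div_two]
      simp [G, A, this]
    · simp [G, B, smoothTransition.zero_of_nonpos (x := 4 - q u) (by linarith)]
  have hGeq : ∀ t u, G (phase ω t u) = phase (Sum.elim ω w) t (G u) := fun t u => by
    ext l
    have hq' : q (phase ω t u) = q u := weightedSq_phase ..
    have hD' : D (phase ω t u) = D u := by simp only [D, hq', hKeq, weightedSq_phase]
    rcases l with i | k <;>
      simp [G, A, B, hq', hD', phase_apply, hKeq, mul_left_comm]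
  have hzero := integral_sumDet_fderiv hG hGc
  -- near the origin
  have hinner : ∀ u, q u < 2 → ∃ T : (ι → ℂ) →L[ℝ] ι → ℂ, T.det ≤ sumDet (fderiv ℝ G u) ∧
      0 ≤ T.det ∧ (u = 0 → 0 < T.det) := by
    intro u hu
    set s := smoothTransition (1 - q u) with hs
    have hs0 : 0 ≤ s := smoothTransition.nonneg _
    have hτ' : HasDerivAt smoothTransition (deriv smoothTransition (1 - q u)) (1 - q u) :=
      (hτ.differentiable one_ne_zero _).hasDerivAt
    have hd0 : 0 ≤ deriv smoothTransition (1 - q u) := smoothTransition.monotone.deriv_nonneg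
    set d := deriv smoothTransition (1 - q u)
    have hψ' : HasDerivAt ψ (1 - d) (q u) := by
      have := (hasDerivAt_id (q u)).add
        (hτ'.comp (q u) ((hasDerivAt_const (q u) (1 : ℝ)).sub (hasDerivAt_id (q u))))
      exact this.congr_deriv (by ring)
    have hS := (hψ'.sqrt (hψ u).ne').inv (sqrt_pos.2 (hψ u)).ne'
    obtain ⟨T, hT, hTdet⟩ := det_fderiv_radial ω (u := u) hS
      (inv_pos.2 (sqrt_pos.2 (hψ u))).ne'
    have hval : T.det = ((√(ψ (q u)))⁻¹) ^ Module.finrank ℝ (ι → ℂ) *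
        ((s + q u * d) / ψ (q u)) := by
      rw [hTdet]
      change ((√(ψ (q u)))⁻¹) ^ Module.finrank ℝ (ι → ℂ) *
        (1 + ((√(ψ (q u)))⁻¹)⁻¹ * (2 * (-((1 - d) / (2 * √(ψ (q u)))) / √(ψ (q u)) ^ 2) * q u)) = _
      congr 1
      have h1 := sqrt_pos.2 (hψ u)
      have h2 := sq_sqrt (hψ u).le
      have h3 : ψ (q u) = q u + s := rfl
      rw [inv_inv, h2]
      have h4 := hψ u
      field_simp
      rw [h3]; ring
    have hqu : 0 ≤ q u := weightedSq_nonneg hω u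
    have hTn : 0 ≤ T.det := by
      rw [hval]
      have := hψ u
      positivity
    have hev : ∀ᶠ y in nhds u, χ (q y) = 0 := by
      filter_upwards [hqc.continuousAt.eventually (gt_mem_nhds hu)] with y hy
      simp only [χ]; rw [smoothTransition.zero_of_nonpos (by linarith), mul_zero]
    have hGd := (hG.differentiable one_ne_zero u).hasFDerivAt
    refine ⟨T, det_le_sumDet _ T ?_ ?_ hTn, hTn, ?_⟩
    · intro v i
      refine DFunLike.congr_fun (((hasFDerivAt_pi'.1 hGd (Sum.inl i)).unique
        ((hasFDerivAt_pi'.1 hT i).congr_of_eventuallyEq ?_))) v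
      filter_upwards [hev] with y hy
      simp only [G, A, Sum.elim_inl]
      simp [hy]
      exact Or.inl rfl
    · intro v k
      refine DFunLike.congr_fun (((hasFDerivAt_pi'.1 hGd (Sum.inr k)).unique
        ((hasFDerivAt_const (0 : ℂ) u).congr_of_eventuallyEq ?_))) v
      filter_upwards [hev] with y hy
      simp [G, B, hy]
    · rintro rfl
      have h1 : q 0 = 0 := (weightedSq_eq_zero hω).2 rfl
      have h2 : s = 1 := by rw [hs, h1, sub_zero, smoothTransition.one]
      rw [hval, h1, h2]
      have := hψ 0
      rw [h1] at this
      positivity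
  have hnonneg : ∀ u, 0 ≤ sumDet (fderiv ℝ G u) := by
    intro u
    by_cases h2 : q u < 2
    · obtain ⟨T, h, h', -⟩ := hinner u h2
      exact h'.trans h
    refine Eq.ge ?_
    by_cases h3 : q u < 3
    · have hloc : ∀ y, 1 < q y → q y < 3 → weightedSq (Sum.elim ω w) (G y) = 1 := by
        intro y h1 h3
        have e1 : weightedSq (Sum.elim ω w) (G y) =
            A y ^ 2 * q y + B y ^ 2 * weightedSq w (K y) := by
          rw [hq, ← weightedSq_smul, ← weightedSq_smul]
          simp only [weightedSq, Fintype.sum_sum_type, G, Sum.elim_inl, Sum.elim_inr]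
        rw [e1]
        simp only [A, B, ψ]
        rw [smoothTransition.zero_of_nonpos (x := 1 - q y) (by linarith),
          smoothTransition.one_of_one_le (x := 4 - q y) (by linarith), mul_pow, mul_pow, inv_pow,
          inv_pow, sq_sqrt (by linarith), sq_sqrt (hD y).le, add_zero, mul_one, mul_assoc,
          inv_mul_cancel₀ (by linarith), mul_one]
        rcases lt_or_ge (q y) 2 with h | h
        · have : χ (q y) = 0 := by
            simp only [χ]; rw [smoothTransition.zero_of_nonpos (by linarith), mul_zero]
          simp [this]
        · have hDy : D y = weightedSq w (K y) := by
            simp only [D]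
            rw [smoothTransition.zero_of_nonpos (x := 2 - q y) (by linarith),
              smoothTransition.zero_of_nonpos (x := q y - 4) (by linarith), add_zero, add_zero]
          rw [← hDy, mul_assoc, inv_mul_cancel₀ (hD y).ne', mul_one]
          exact cos_sq_add_sin_sq _
      have h1 : 1 < q u := by linarith
      refine sumDet_fderiv_eq_zero_of_moment hω (hq0 u (by linarith))
        (hG.differentiable one_ne_zero u) (fun t => hGeq t u) ?_
      filter_upwards [hqc.continuousAt.eventually (lt_mem_nhds h1),
        hqc.continuousAt.eventually (gt_mem_nhds h3)] with y hy1 hy3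
      rw [hloc y hy1 hy3, hloc u h1 h3]
    · refine sumDet_eq_zero_of_card_lt hcard _ fun v i => ?_
      have h52 : 5 / 2 < q u := by linarith
      have hev : (fun y => G y (Sum.inl i)) =ᶠ[nhds u] fun _ => 0 := by
        filter_upwards [hqc.continuousAt.eventually (lt_mem_nhds h52)] with y hy
        have : cos (χ (q y)) = 0 := by
          simp only [χ]
          rw [smoothTransition.one_of_one_le (by linarith), mul_one, cos_pi_div_two]
        simp [G, A, this]
      have e1 := (hasFDerivAt_pi'.1 (hG.differentiable one_ne_zero u).hasFDerivAt) (Sum.inl i)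
      have e2 := e1.unique ((hasFDerivAt_const (0 : ℂ) u).congr_of_eventuallyEq hev)
      exact DFunLike.congr_fun e2 v
  have hcont : Continuous fun u => sumDet (fderiv ℝ G u) :=
    continuous_sumDet.comp (hG.continuous_fderiv one_ne_zero)
  have hpos := hcont.integral_pos_of_hasCompactSupport_nonneg_nonzero
    (μ := MeasureTheory.volume) ((hGc.fderiv ℝ).comp_left (g := sumDet) sumDet_zero) hnonneg
    (x := 0) (by
      obtain ⟨T, h, -, h'⟩ := hinner 0 (by rw [hq, (weightedSq_eq_zero hω).2 rfl]; norm_num)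
      exact ((h' rfl).trans_le h).ne')
  exact hpos.ne' hzero

open Set Function in
/-- If a descent map `φ` on a compact set fails to decrease `g` strictly only at points whose
orbit is detected by one of finitely many open sets `O i` (at level `l i`), then iterating `φ` a
controlled number of times brings every point of a sublevel into one of the detecting sets. -/
theorem exists_iterate_mem_of_descent {X κ : Type*} [TopologicalSpace X] [T2Space X] [Fintype κ]
    {S : Set X}
    (hS : IsCompact S) {φ : X → X} {g : X → ℝ} (hφS : MapsTo φ S S) (hφ : ContinuousOn φ S)
    (hg : ContinuousOn g S) (hle : ∀ x ∈ S, g (φ x) ≤ g x) {O : κ → Set X}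
    (hO : ∀ i, IsOpen (O i)) {l : κ → ℝ}
    (hlt : ∀ x ∈ S, g (φ x) < g x ∨ ∃ i, x ∈ O i ∧ g x = l i) (c : ℝ) :
    ∃ n : κ → ℕ, ∀ x ∈ S, g x ≤ c → ∃ i, l i ≤ c ∧ φ^[n i] x ∈ O i := by
  classical
  have hgφ : ContinuousOn (fun x => g (φ x)) S := hg.comp hφ hφS
  induction hk : (Finset.univ.filter fun i => l i ≤ c).card using Nat.strong_induction_on
    generalizing c with
  | _ k ih =>
  subst hk
  rcases (Finset.univ.filter fun i => l i ≤ c).eq_empty_or_nonempty with hK | hK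
  · refine ⟨0, fun x hx hxc => ?_⟩
    exfalso
    obtain ⟨y, hy, hmin⟩ := hS.exists_isMinOn ⟨x, hx⟩ hg
    rcases hlt y hy with h | ⟨i, -, h⟩
    · exact absurd (hmin (hφS hy)) (not_le.2 h)
    · have h1 : i ∈ Finset.univ.filter fun i => l i ≤ c := by
        simp only [Finset.mem_filter, Finset.mem_univ, true_and]
        exact h ▸ (hmin hx).trans hxc
      simp [hK] at h1
  · obtain ⟨i₀, hi₀, hmax⟩ := Finset.exists_max_image _ l hK
    set b := l i₀ with hb
    simp only [Finset.mem_filter, Finset.mem_univ, true_and] at hi₀ hmax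
    set U : Set X := ⋃ i ∈ {i | l i = b}, O i with hU
    have hUo : IsOpen U := isOpen_biUnion fun i _ => hO i
    obtain ⟨ε, hε, hqε⟩ : ∃ ε > 0, ∀ x ∈ S \ U, ε ≤ max (g x - b) (b - g (φ x)) := by
      rcases (S \ U).eq_empty_or_nonempty with hD | hD
      · exact ⟨1, one_pos, by simp [hD]⟩
      · obtain ⟨y, hy, hmin⟩ := (hS.diff hUo).exists_isMinOn hD
          (f := fun x => max (g x - b) (b - g (φ x)))
          (((hg.sub continuousOn_const).sup (continuousOn_const.sub hgφ)).mono sdiff_subset)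
        refine ⟨_, ?_, fun x hx => hmin hx⟩
        rw [gt_iff_lt, lt_max_iff]
        by_contra! hcon
        have h1 := hle y hy.1
        rcases hlt y hy.1 with h | ⟨i, hi, h⟩
        · linarith
        · refine hy.2 (mem_biUnion (x := i) ?_ hi)
          simp only [mem_ofPred_eq]
          linarith
    obtain ⟨d, hd, hdrop⟩ : ∃ d > 0, ∀ x ∈ S, b + ε / 2 ≤ g x → g x ≤ c →
        d ≤ g x - g (φ x) := by
      have hcomp : IsCompact (S ∩ g ⁻¹' Icc (b + ε / 2) c) :=
        hS.of_isClosed_subset (hg.preimage_isClosed_of_isClosed hS.isClosed isClosed_Icc)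
          inter_subset_left
      rcases (S ∩ g ⁻¹' Icc (b + ε / 2) c).eq_empty_or_nonempty with hD | hD
      · refine ⟨1, one_pos, fun x hx h1 h2 => ?_⟩
        have : x ∈ S ∩ g ⁻¹' Icc (b + ε / 2) c := ⟨hx, h1, h2⟩
        simp [hD] at this
      · obtain ⟨y, hy, hmin⟩ := hcomp.exists_isMinOn hD ((hg.sub hgφ).mono inter_subset_left)
        refine ⟨_, ?_, fun x hx h1 h2 => hmin ⟨hx, h1, h2⟩⟩
        rcases hlt y hy.1 with h | ⟨i, -, h⟩
        · simpa using h
        · have h1 := hmax i (h ▸ hy.2.2)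
          have h2 := hy.2.1
          linarith
    have hmem : ∀ k, ∀ x ∈ S, φ^[k] x ∈ S := fun k x hx => hφS.iterate k hx
    have hiter : ∀ k : ℕ, ∀ x ∈ S, g x ≤ c → g (φ^[k] x) ≤ max (b + ε / 2) (c - k * d) := by
      intro k x hx hxc
      have hc : ∀ k, g (φ^[k] x) ≤ c := by
        intro k
        induction k with
        | zero => simpa using hxc
        | succ k ihk => rw [iterate_succ_apply']; exact (hle _ (hmem k x hx)).trans ihk
      induction k with
      | zero => simp [hxc]
      | succ k ihk =>
        rw [iterate_succ_apply']
        have h1 := hle _ (hmem k x hx)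
        by_cases h : b + ε / 2 ≤ g (φ^[k] x)
        · have h2 := hdrop _ (hmem k x hx) h (hc k)
          rcases le_max_iff.1 ihk with h3 | h3
          · exact le_max_of_le_left (h1.trans h3)
          · refine le_max_of_le_right ?_
            push_cast; linarith
        · exact le_max_of_le_left (h1.trans (not_le.1 h).le)
    obtain ⟨N, hN⟩ : ∃ N : ℕ, c - N * d ≤ b + ε / 2 := by
      obtain ⟨N, hN⟩ := exists_nat_gt ((c - b) / d)
      refine ⟨N, ?_⟩
      rw [div_lt_iff₀ hd] at hN
      linarith
    obtain ⟨n, hn⟩ := ih _ (Finset.card_lt_card (s := Finset.univ.filter fun i => l i ≤ b - ε) (by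
      rw [Finset.ssubset_iff_of_subset (fun i hi => by
        simp only [Finset.mem_filter, Finset.mem_univ, true_and] at hi ⊢; linarith)]
      exact ⟨i₀, by simpa using hi₀, by simp [← hb, hε]⟩)) (b - ε) rfl
    refine ⟨fun i => if l i = b then N else n i + (N + 1), fun x hx hxc => ?_⟩
    have hy := hiter N x hx hxc
    rw [max_eq_left hN] at hy
    by_cases hyU : φ^[N] x ∈ U
    · obtain ⟨i, hi, hiO⟩ := mem_iUnion₂.1 hyU
      refine ⟨i, ?_, ?_⟩
      · rw [show l i = b from hi]; exact hi₀
      · simpa only [if_pos (show l i = b from hi)] using hiO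
    · have h1 := hqε _ ⟨hmem N x hx, hyU⟩
      have h2 : g (φ^[N + 1] x) ≤ b - ε := by
        rw [iterate_succ_apply']
        rcases le_max_iff.1 h1 with h | h <;> linarith
      obtain ⟨i, hi, hiO⟩ := hn _ (hmem _ x hx) h2
      refine ⟨i, by linarith, ?_⟩
      have h3 : l i ≠ b := by linarith
      simpa only [if_neg h3, iterate_add_apply] using hiO

/-- Rotation of each coordinate `x j` by the angle `ω j * t`. -/
noncomputable def rot {ι : Type*} (ω : ι → ℝ) (t : ℝ) (x : EuclideanSpace ℂ ι) :
    EuclideanSpace ℂ ι :=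
  WithLp.toLp 2 (phase ω t x.ofLp)

@[simp] theorem rot_apply {ι : Type*} (ω : ι → ℝ) (t : ℝ) (x : EuclideanSpace ℂ ι) (j : ι) :
    rot ω t x j = Complex.exp ((ω j * t : ℝ) * Complex.I) * x j := rfl

theorem rot_zero {ι : Type*} (ω : ι → ℝ) (x : EuclideanSpace ℂ ι) : rot ω 0 x = x := by
  ext j; simp

theorem rot_add {ι : Type*} (ω : ι → ℝ) (s t : ℝ) (x : EuclideanSpace ℂ ι) :
    rot ω (s + t) x = rot ω s (rot ω t x) := by
  ext j
  simp only [rot_apply, ← mul_assoc, ← Complex.exp_add]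
  congr 2
  push_cast; ring

theorem norm_rot_apply {ι : Type*} (ω : ι → ℝ) (t : ℝ) (x : EuclideanSpace ℂ ι) (j : ι) :
    ‖rot ω t x j‖ = ‖x j‖ := by
  rw [rot_apply, norm_mul, Complex.norm_exp_ofReal_mul_I, one_mul]

theorem norm_rot {ι : Type*} [Fintype ι] (ω : ι → ℝ) (t : ℝ) (x : EuclideanSpace ℂ ι) :
    ‖rot ω t x‖ = ‖x‖ := by
  simp only [EuclideanSpace.norm_eq, norm_rot_apply]

theorem rot_smul {ι : Type*} (ω : ι → ℝ) (t : ℝ) (c : ℝ) (x : EuclideanSpace ℂ ι) :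
    rot ω t (c • x) = c • rot ω t x := by
  ext j
  simp only [rot_apply, PiLp.smul_apply, mul_smul_comm]

/-- The unit sphere of the coordinate subspace of `ℂ^ι` spanned by the coordinates in `C`. -/
def coordSphere {ι : Type*} [Fintype ι] (C : Set ι) : Set (EuclideanSpace ℂ ι) :=
  {x | ‖x‖ = 1 ∧ ∀ j ∉ C, x j = 0}

theorem isCompact_coordSphere {ι : Type*} [Fintype ι] (C : Set ι) :
    IsCompact (coordSphere C) := by
  refine (isCompact_sphere (0 : EuclideanSpace ℂ ι) 1).of_isClosed_subset ?_
    fun x hx => mem_sphere_zero_iff_norm.2 hx.1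
  have h : coordSphere C = {x : EuclideanSpace ℂ ι | ‖x‖ = 1} ∩ ⋂ j ∈ Cᶜ, {x | x j = 0} := by
    ext x; simp [coordSphere]
  rw [h]
  exact (isClosed_eq continuous_norm continuous_const).inter
    (isClosed_biInter fun j _ => isClosed_eq (PiLp.continuous_apply 2 _ j) continuous_const)

theorem rot_mem_coordSphere {ι : Type*} [Fintype ι] {C : Set ι} (ω : ι → ℝ) (t : ℝ)
    {x : EuclideanSpace ℂ ι} (hx : x ∈ coordSphere C) : rot ω t x ∈ coordSphere C :=
  ⟨(norm_rot ω t x).trans hx.1, fun j hj => by rw [rot_apply, hx.2 j hj, mul_zero]⟩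

open Set Function in
/-- A Lusternik–Schnirelmann type bound: an equivariant descent map on the unit sphere of `ℂ^C`
for a linear circle-type action with positive weights has at least `|C|` orbits where it does not
decrease the invariant function `g` strictly. -/
theorem exists_family_of_equivariant_descent {ι : Type*} [Fintype ι] {C : Set ι} {ω : ι → ℝ}
    (hω : ∀ j ∈ C, 0 < ω j) {φ : EuclideanSpace ℂ ι → EuclideanSpace ℂ ι}
    {g : EuclideanSpace ℂ ι → ℝ} (hφS : MapsTo φ (coordSphere C) (coordSphere C))
    (hφ : ContinuousOn φ (coordSphere C)) (hφeq : ∀ t, ∀ x ∈ coordSphere C,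
      φ (rot ω t x) = rot ω t (φ x))
    (hg : ContinuousOn g (coordSphere C)) (hgeq : ∀ t, ∀ x ∈ coordSphere C, g (rot ω t x) = g x)
    (hle : ∀ x ∈ coordSphere C, g (φ x) ≤ g x) {Z : Set (EuclideanSpace ℂ ι)}
    (hlt : ∀ x ∈ coordSphere C, x ∉ Z → g (φ x) < g x) :
    ∃ z : C → EuclideanSpace ℂ ι, (∀ j, z j ∈ coordSphere C ∧ z j ∈ Z) ∧
      ∀ i j, i ≠ j → ∀ t, z i ≠ rot ω t (z j) := by
  classical
  let s : Setoid {x // x ∈ coordSphere C ∩ Z} :=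
    { r := fun x y => ∃ t, x.1 = rot ω t y.1
      iseqv := ⟨fun x => ⟨0, (rot_zero ω _).symm⟩,
        fun {x y} ⟨t, h⟩ => ⟨-t, by rw [h, ← rot_add, neg_add_cancel, rot_zero]⟩,
        fun {x y z} ⟨t, h⟩ ⟨t', h'⟩ => ⟨t + t', by rw [h, h', rot_add]⟩⟩ }
  suffices hemb : Nonempty (C ↪ Quotient s) by
    obtain ⟨e⟩ := hemb
    refine ⟨fun j => ((e j).out).1, fun j => ((e j).out).2, fun i j hij t h => hij ?_⟩
    apply e.injective
    rw [← Quotient.out_equiv_out]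
    exact ⟨t, h⟩
  cases finite_or_infinite (Quotient s) with
  | inr h => exact ⟨(Fintype.equivFin C).toEmbedding.trans
      (Fin.valEmbedding.trans (Infinite.natEmbedding _))⟩
  | inl h =>
  have := Fintype.ofFinite (Quotient s)
  refine Function.Embedding.nonempty_of_card_le (not_lt.1 fun hcard => ?_)
  let v : Quotient s → EuclideanSpace ℂ ι := fun i => i.out.1
  have hv : ∀ i, v i ∈ coordSphere C := fun i => i.out.2.1
  have hcov : ∀ x ∈ coordSphere C, x ∈ Z → ∃ i t, x = rot ω t (v i) := fun x hx hxZ => by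
    obtain ⟨t, ht⟩ := (Quotient.mk_out (s := s) ⟨x, hx, hxZ⟩)
    refine ⟨⟦⟨x, hx, hxZ⟩⟧, -t, ?_⟩
    rw [show v ⟦⟨x, hx, hxZ⟩⟧ = rot ω t x from ht, ← rot_add, neg_add_cancel, rot_zero]
  have hne : ∀ i, ∃ j, v i j ≠ 0 := fun i => by
    by_contra! h
    have h0 : v i = 0 := by ext j; exact h j
    have := (hv i).1
    simp [h0] at this
  choose jc hjc using hne
  have hjC : ∀ i, jc i ∈ C := fun i => by
    by_contra h
    exact hjc i ((hv i).2 _ h)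
  obtain ⟨c, hc⟩ := ((isCompact_coordSphere C).image_of_continuousOn hg).bddAbove
  obtain ⟨N, hN⟩ := exists_iterate_mem_of_descent (isCompact_coordSphere C) hφS hφ hg hle
    (O := fun i => {x | x (jc i) ≠ 0}) (l := fun i => g (v i))
    (fun i => isOpen_ne_fun (by fun_prop) continuous_const) (fun x hx => by
      by_cases hxZ : x ∈ Z
      · obtain ⟨i, t, rfl⟩ := hcov x hx hxZ
        refine Or.inr ⟨i, ?_, hgeq t _ (hv i)⟩
        simp [hjc i]
      · exact Or.inl (hlt x hx hxZ)) c
  let ext : (C → ℂ) → EuclideanSpace ℂ ι := fun u =>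
    WithLp.toLp 2 fun j => if h : j ∈ C then u ⟨j, h⟩ else 0
  have hext : Continuous ext := by
    refine (PiLp.continuous_toLp 2 _).comp (continuous_pi fun j => ?_)
    split_ifs <;> fun_prop
  have hext0 : ∀ u ≠ 0, ext u ≠ 0 := fun u hu h => hu (by
    ext j
    simpa [ext] using congrArg (fun x : EuclideanSpace ℂ ι => x j) h)
  have hextrot : ∀ t u, ext (phase (fun j : C => ω j) t u) = rot ω t (ext u) := fun t u => by
    ext j
    by_cases h : j ∈ C <;> simp [ext, h, phase_apply]
  let nrm : (C → ℂ) → EuclideanSpace ℂ ι := fun u => ‖ext u‖⁻¹ • ext u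
  have hnS : ∀ u ≠ 0, nrm u ∈ coordSphere C := fun u hu => by
    refine ⟨norm_smul_inv_norm (𝕜 := ℝ) (hext0 u hu), fun j hj => ?_⟩
    simp [nrm, ext, hj]
  have hnc : ContinuousOn nrm {0}ᶜ := fun u hu => ContinuousAt.continuousWithinAt
    ((hext.norm.continuousAt.inv₀ (norm_ne_zero_iff.2 (hext0 u hu))).smul hext.continuousAt)
  have hiterS : ∀ k, MapsTo φ^[k] (coordSphere C) (coordSphere C) := fun k => hφS.iterate k
  have hiterc : ∀ k, ContinuousOn φ^[k] (coordSphere C) := fun k => hφ.iterate hφS k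
  have hitereq : ∀ k t, ∀ x ∈ coordSphere C, φ^[k] (rot ω t x) = rot ω t (φ^[k] x) := by
    intro k t
    induction k with
    | zero => intro x _; rfl
    | succ k ih =>
      intro x hx
      rw [iterate_succ_apply', iterate_succ_apply', ih x hx, hφeq t _ (hiterS k hx)]
  obtain ⟨u, hu, hFu⟩ := exists_ne_zero_eq_zero_of_equivariant
    (ω := fun j : C => ω j) (w := fun i => ω (jc i))
    (F := fun u i => if u = 0 then 0 else φ^[N i] (nrm u) (jc i)) (by simpa using hcard)
    (fun j => hω j j.2) (fun i => hω _ (hjC i)) (by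
      refine continuousOn_pi.2 fun i => ?_
      have h1 : ContinuousOn (fun u => φ^[N i] (nrm u) (jc i)) {0}ᶜ :=
        (PiLp.continuous_apply 2 (fun _ : ι => ℂ) (jc i)).comp_continuousOn
          ((hiterc (N i)).comp hnc hnS)
      exact h1.congr fun u hu => if_neg hu) (by
      intro t u
      ext i
      by_cases hu : u = 0
      · subst hu
        have h0 : phase (fun j : C => ω j) t 0 = 0 := by ext j; simp [phase_apply]
        simp [h0, phase_apply]
      · have h0 : phase (fun j : C => ω j) t u ≠ 0 := by
          intro h
          apply hu
          ext j
          have := congrFun h j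
          simpa [phase_apply] using this
        have h1 : nrm (phase (fun j : C => ω j) t u) = rot ω t (nrm u) := by
          simp only [nrm, hextrot, norm_rot, rot_smul]
        simp only [if_neg hu, if_neg h0, h1, hitereq _ t _ (hnS u hu), rot_apply, phase_apply])
  obtain ⟨i, -, hi⟩ := hN (nrm u) (hnS u hu) (hc (mem_image_of_mem _ (hnS u hu)))
  exact hi (by simpa [hu] using congrFun hFu i)

open Complex in
theorem hasDerivAt_integral_add_one {h : ℝ → ℂ} (hh : Continuous h) (t : ℝ) :
    HasDerivAt (fun t => ∫ s in t..t + 1, h s) (h (t + 1) - h t) t := by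
  have h1 : ∀ t, HasDerivAt (fun t => ∫ s in (0 : ℝ)..t, h s) (h t) t := fun t =>
    intervalIntegral.integral_hasDerivAt_right (hh.intervalIntegrable _ _)
      (hh.stronglyMeasurableAtFilter _ _) hh.continuousAt
  refine (((h1 (t + 1)).comp_add_const t 1).sub (h1 t)).congr_of_eventuallyEq
    (Filter.Eventually.of_forall fun s => ?_)
  exact (intervalIntegral.integral_interval_sub_left (hh.intervalIntegrable _ _)
    (hh.intervalIntegrable _ _)).symm

/-- The coefficient of `exp (iθt)` in the `1`-periodic function `u`. -/
noncomputable def expCoeff (θ : ℝ) (u : ℝ → ℂ) : ℂ :=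
  ∫ s in (0 : ℝ)..1, Complex.exp (-(θ * s : ℝ) * Complex.I) * u s

theorem expCoeff_comp_add {θ : ℝ} (hθ : Complex.exp (θ * Complex.I) = 1) {u : ℝ → ℂ}
    (hper : ∀ t, u (t + 1) = u t) (t : ℝ) :
    expCoeff θ (fun s => u (t + s)) = Complex.exp ((θ * t : ℝ) * Complex.I) * expCoeff θ u := by
  let h : ℝ → ℂ := fun s => Complex.exp (-(θ * s : ℝ) * Complex.I) * u s
  have hP : Function.Periodic h 1 := fun s => by
    simp only [h, hper]
    congr 1
    rw [show -((θ * (s + 1) : ℝ) : ℂ) * Complex.I = -(θ * s : ℝ) * Complex.I - θ * Complex.I by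
      push_cast; ring, Complex.exp_sub, hθ, div_one]
  have h1 : ∫ s in (0 : ℝ)..1, h (t + s) = ∫ s in (0 : ℝ)..1, h s := by
    rw [intervalIntegral.integral_comp_add_left, add_zero, hP.intervalIntegral_add_eq t 0, zero_add]
  rw [expCoeff, expCoeff, ← h1, ← intervalIntegral.integral_const_mul]
  congr 1
  ext s
  simp only [h, ← mul_assoc, ← Complex.exp_add]
  congr 2
  push_cast; ring

/-- Variation of constants: a kernel of the form `(α s + β) exp (-iθs)` solves
`w' = iθ w + u - α (e^{iθ·} * u)`. -/
theorem hasDerivAt_green {θ : ℝ} {α β : ℂ}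
    (hαβ : (α + β) * Complex.exp (-(θ * Complex.I)) - β = 1) {u : ℝ → ℂ} (hu : Continuous u)
    (hper : ∀ t, u (t + 1) = u t) (t : ℝ) :
    HasDerivAt (fun t => ∫ s in (0 : ℝ)..1,
        (α * s + β) * Complex.exp (-(θ * s : ℝ) * Complex.I) * u (t + s))
      (θ * Complex.I * (∫ s in (0 : ℝ)..1,
        (α * s + β) * Complex.exp (-(θ * s : ℝ) * Complex.I) * u (t + s)) + u t
        - α * expCoeff θ (fun s => u (t + s))) t := by
  have hPc : Continuous fun s : ℝ => (s : ℂ) * (Complex.exp (-(θ * s : ℝ) * Complex.I) * u s) := by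
    fun_prop
  have hQc : Continuous fun s : ℝ => Complex.exp (-(θ * s : ℝ) * Complex.I) * u s := by fun_prop
  have hP := hasDerivAt_integral_add_one hPc t
  have hQ := hasDerivAt_integral_add_one hQc t
  set P : ℝ → ℂ := fun t => ∫ s in t..t + 1,
    (s : ℂ) * (Complex.exp (-(θ * s : ℝ) * Complex.I) * u s) with hPdef
  set Q : ℝ → ℂ := fun t => ∫ s in t..t + 1,
    Complex.exp (-(θ * s : ℝ) * Complex.I) * u s with hQdef
  have hQt : ∀ t, expCoeff θ (fun s => u (t + s)) =
        Complex.exp ((θ * t : ℝ) * Complex.I) * Q t := by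
    intro t
    have h1 : Q t = ∫ s in (0 : ℝ)..1,
          Complex.exp (-(θ * (t + s) : ℝ) * Complex.I) * u (t + s) := by
      rw [intervalIntegral.integral_comp_add_left
        (fun s => Complex.exp (-(θ * s : ℝ) * Complex.I) * u s), add_zero]
    rw [h1, expCoeff, ← intervalIntegral.integral_const_mul]
    congr 1
    ext s
    simp only [← mul_assoc, ← Complex.exp_add]
    congr 2
    push_cast; ring
  have hKt : ∀ t, (∫ s in (0 : ℝ)..1,
      (α * s + β) * Complex.exp (-(θ * s : ℝ) * Complex.I) * u (t + s)) =
      Complex.exp ((θ * t : ℝ) * Complex.I) * (α * P t + (β - α * t) * Q t) := by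
    intro t
    rw [hPdef, hQdef]
    simp only
    rw [← intervalIntegral.integral_const_mul, ← intervalIntegral.integral_const_mul,
      ← intervalIntegral.integral_add (Continuous.intervalIntegrable (by fun_prop) _ _)
        (Continuous.intervalIntegrable (by fun_prop) _ _),
      ← intervalIntegral.integral_const_mul]
    have h2 := intervalIntegral.integral_comp_add_left (a := 0) (b := 1)
      (fun s : ℝ => Complex.exp ((θ * t : ℝ) * Complex.I) *
        (α * ((s : ℂ) * (Complex.exp (-(θ * s : ℝ) * Complex.I) * u s)) +
          (β - α * t) * (Complex.exp (-(θ * s : ℝ) * Complex.I) * u s))) t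
    rw [add_zero] at h2
    rw [← h2]
    congr 1
    ext s
    have h3 : Complex.exp (-(θ * s : ℝ) * Complex.I) =
        Complex.exp ((θ * t : ℝ) * Complex.I) * Complex.exp (-(θ * (t + s) : ℝ) * Complex.I) := by
      rw [← Complex.exp_add]
      congr 1
      push_cast; ring
    rw [h3]
    push_cast
    ring
  rw [hKt t, hQt t]
  have hexp : HasDerivAt (fun t : ℝ => Complex.exp ((θ * t : ℝ) * Complex.I))
      (Complex.exp ((θ * t : ℝ) * Complex.I) * (θ * Complex.I)) t := by
    have h1 : HasDerivAt (fun t : ℝ => ((θ * t : ℝ) : ℂ) * Complex.I) (θ * Complex.I) t := by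
      have := ((hasDerivAt_id t).const_mul θ).ofReal_comp.mul_const Complex.I
      simpa using this
    exact h1.cexp
  have hlin : HasDerivAt (fun t : ℝ => β - α * (t : ℂ)) (-α) t := by
    have := ((hasDerivAt_id t).ofReal_comp.const_mul α).const_sub β
    simpa using this
  have hmain := hexp.mul ((hP.const_mul α).add (hlin.mul hQ))
  refine (hmain.congr_of_eventuallyEq (Filter.Eventually.of_forall fun t => hKt t)).congr_deriv ?_
  have e1 : Complex.exp (-(θ * (t + 1) : ℝ) * Complex.I) =
      Complex.exp (-(θ * t : ℝ) * Complex.I) * Complex.exp (-(θ * Complex.I)) := by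
    rw [← Complex.exp_add]; congr 1; push_cast; ring
  have e2 : Complex.exp ((θ * t : ℝ) * Complex.I) * Complex.exp (-(θ * t : ℝ) * Complex.I) = 1 := by
    rw [← Complex.exp_add, neg_mul, add_neg_cancel, Complex.exp_zero]
  simp only [Pi.add_apply, Pi.mul_apply, hper, e1]
  push_cast
  push_cast at e2
  linear_combination (u t * ((α + β) * Complex.exp (-(θ * Complex.I)) - β)) * e2 + u t * hαβ

section PeriodicOperators

variable {ι : Type*}

theorem continuous_euclideanSpace {X : Type*} [TopologicalSpace X] {x : X → EuclideanSpace ℂ ι}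
    (h : ∀ j, Continuous fun s => x s j) : Continuous x :=
  (PiLp.continuous_toLp 2 (fun _ : ι => ℂ)).comp (continuous_pi h)

theorem rot_sub (θ : ι → ℝ) (t : ℝ) (x y : EuclideanSpace ℂ ι) :
    rot θ t (x - y) = rot θ t x - rot θ t y := by
  ext j; simp [mul_sub]

theorem rot_add_vec (θ : ι → ℝ) (t : ℝ) (x y : EuclideanSpace ℂ ι) :
    rot θ t (x + y) = rot θ t x + rot θ t y := by
  ext j; simp [mul_add]

open Classical in
/-- The projection of a `1`-periodic curve to the modes `exp (i θⱼ t) eⱼ`, `j ∈ C`. -/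
noncomputable def modeProj (C : Set ι) (θ : ι → ℝ) (u : ℝ → EuclideanSpace ℂ ι) :
    EuclideanSpace ℂ ι :=
  WithLp.toLp 2 fun j => if j ∈ C then expCoeff (θ j) (fun s => u s j) else 0

theorem modeProj_apply_of_mem {C : Set ι} (θ : ι → ℝ) (u : ℝ → EuclideanSpace ℂ ι) {j : ι}
    (hj : j ∈ C) : modeProj C θ u j = expCoeff (θ j) (fun s => u s j) := by
  simp [modeProj, hj]

theorem modeProj_apply_of_notMem {C : Set ι} (θ : ι → ℝ) (u : ℝ → EuclideanSpace ℂ ι) {j : ι}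
    (hj : j ∉ C) : modeProj C θ u j = 0 := by
  simp [modeProj, hj]

/-- The frequencies in `C` are resonant with period `1` and the others are not. -/
def IsResonant (C : Set ι) (θ : ι → ℝ) : Prop :=
  ∀ j, Complex.exp (θ j * Complex.I) = 1 ↔ j ∈ C

theorem continuous_rot (θ : ι → ℝ) (x : EuclideanSpace ℂ ι) : Continuous fun t => rot θ t x :=
  continuous_euclideanSpace fun j => by simp only [rot_apply]; fun_prop

theorem expCoeff_sub {θ : ℝ} {u v : ℝ → ℂ} (hu : Continuous u) (hv : Continuous v) :
    expCoeff θ (fun s => u s - v s) = expCoeff θ u - expCoeff θ v := by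
  simp only [expCoeff, mul_sub]
  exact intervalIntegral.integral_sub (Continuous.intervalIntegrable (by fun_prop) _ _)
    (Continuous.intervalIntegrable (by fun_prop) _ _)

theorem modeProj_sub {C : Set ι} {θ : ι → ℝ} {u v : ℝ → EuclideanSpace ℂ ι} (hu : Continuous u)
    (hv : Continuous v) :
    modeProj C θ (fun s => u s - v s) = modeProj C θ u - modeProj C θ v := by
  ext j
  by_cases hj : j ∈ C
  · simp only [PiLp.sub_apply, modeProj_apply_of_mem θ _ hj]
    exact expCoeff_sub (by fun_prop) (by fun_prop)
  · simp [modeProj_apply_of_notMem θ _ hj]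

theorem modeProj_add {C : Set ι} {θ : ι → ℝ} {u v : ℝ → EuclideanSpace ℂ ι} (hu : Continuous u)
    (hv : Continuous v) :
    modeProj C θ (fun s => u s + v s) = modeProj C θ u + modeProj C θ v := by
  have h := modeProj_sub (C := C) (θ := θ) (u := fun s => u s + v s)
    (continuous_euclideanSpace fun j => by simp only [PiLp.add_apply]; fun_prop) hv
  simp only [add_sub_cancel_right] at h
  exact (sub_eq_iff_eq_add.1 h.symm)

theorem modeProj_smul {C : Set ι} (θ : ι → ℝ) (c : ℝ) (u : ℝ → EuclideanSpace ℂ ι) :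
    modeProj C θ (fun s => c • u s) = c • modeProj C θ u := by
  ext j
  by_cases hj : j ∈ C
  · simp only [PiLp.smul_apply, modeProj_apply_of_mem θ _ hj, expCoeff, mul_smul_comm]
    exact intervalIntegral.integral_smul _ _
  · simp [modeProj_apply_of_notMem θ _ hj]

theorem norm_expCoeff_le {θ : ℝ} {u : ℝ → ℂ} {M : ℝ} (h : ∀ t, ‖u t‖ ≤ M) :
    ‖expCoeff θ u‖ ≤ M := by
  have := intervalIntegral.norm_integral_le_of_norm_le_const (a := 0) (b := 1) (C := M)
    (f := fun s : ℝ => Complex.exp (-(θ * s : ℝ) * Complex.I) * u s) fun s _ => by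
      rw [norm_mul, ← Complex.ofReal_neg, Complex.norm_exp_ofReal_mul_I, one_mul]
      exact h s
  simpa [expCoeff] using this

theorem modeProj_rot {C : Set ι} (θ : ι → ℝ) {v : EuclideanSpace ℂ ι} (hv : ∀ j ∉ C, v j = 0) :
    modeProj C θ (fun t => rot θ t v) = v := by
  ext j
  by_cases hj : j ∈ C
  · simp only [modeProj_apply_of_mem θ _ hj, rot_apply, expCoeff, ← mul_assoc, ← Complex.exp_add,
      neg_mul, neg_add_cancel, Complex.exp_zero, one_mul]
    simp
  · rw [modeProj_apply_of_notMem θ _ hj, hv j hj]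

theorem modeProj_comp_add {C : Set ι} {θ : ι → ℝ} (hC : IsResonant C θ)
    {u : ℝ → EuclideanSpace ℂ ι} (hper : ∀ t, u (t + 1) = u t) (t : ℝ) :
    modeProj C θ (fun s => u (t + s)) = rot θ t (modeProj C θ u) := by
  ext j
  by_cases hj : j ∈ C
  · rw [rot_apply, modeProj_apply_of_mem θ _ hj, modeProj_apply_of_mem θ _ hj]
    exact expCoeff_comp_add ((hC j).2 hj) (u := fun s => u s j) (fun t => by simp only [hper]) t
  · rw [rot_apply, modeProj_apply_of_notMem θ _ hj, modeProj_apply_of_notMem θ _ hj, mul_zero]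

variable [Fintype ι]

theorem hasDerivAt_euclideanSpace {x : ℝ → EuclideanSpace ℂ ι} {x' : EuclideanSpace ℂ ι} {t : ℝ}
    (h : ∀ j, HasDerivAt (fun s => x s j) (x' j) t) : HasDerivAt x x' t := by
  have h1 : HasDerivAt (fun s j => x s j) (fun j => x' j) t := hasDerivAt_pi.2 h
  exact (PiLp.continuousLinearEquiv 2 ℝ (fun _ : ι => ℂ)).symm.hasFDerivAt.comp_hasDerivAt t h1

theorem norm_le_card_mul {x : EuclideanSpace ℂ ι} {M : ℝ} (hM : 0 ≤ M) (h : ∀ j, ‖x j‖ ≤ M) :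
    ‖x‖ ≤ Fintype.card ι * M := by
  rw [EuclideanSpace.norm_eq, Real.sqrt_le_left (by positivity)]
  calc ∑ j, ‖x j‖ ^ 2 ≤ ∑ _j : ι, M ^ 2 := by gcongr; exact h _
    _ = Fintype.card ι * M ^ 2 := by simp
    _ ≤ (Fintype.card ι * M) ^ 2 := by
      rw [mul_pow]
      gcongr
      exact_mod_cast Nat.le_self_pow two_ne_zero _

theorem inner_rot_rot (θ : ι → ℝ) (t : ℝ) (x y : EuclideanSpace ℂ ι) :
    ⟪rot θ t x, rot θ t y⟫ = ⟪x, y⟫ := by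
  rw [real_inner_eq_norm_add_mul_self_sub_norm_mul_self_sub_norm_mul_self_div_two,
    real_inner_eq_norm_add_mul_self_sub_norm_mul_self_sub_norm_mul_self_div_two,
    ← rot_add_vec, norm_rot, norm_rot, norm_rot]

/-- The linear map `x ↦ (i θⱼ xⱼ)ⱼ`. -/
noncomputable def diagI (θ : ι → ℝ) : EuclideanSpace ℂ ι →L[ℝ] EuclideanSpace ℂ ι :=
  LinearMap.toContinuousLinearMap
    { toFun := fun x => WithLp.toLp 2 fun j => θ j * Complex.I * x j
      map_add' := fun x y => by ext j; simp [mul_add]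
      map_smul' := fun c x => by ext j; simp; ring }

@[simp] theorem diagI_apply (θ : ι → ℝ) (x : EuclideanSpace ℂ ι) (j : ι) :
    diagI θ x j = θ j * Complex.I * x j := rfl

theorem hasDerivAt_rot (θ : ι → ℝ) (x : EuclideanSpace ℂ ι) (t : ℝ) :
    HasDerivAt (fun t => rot θ t x) (diagI θ (rot θ t x)) t :=
  hasDerivAt_euclideanSpace fun j => by
    have h1 : HasDerivAt (fun t : ℝ => ((θ j * t : ℝ) : ℂ) * Complex.I) (θ j * Complex.I) t := by
      have := ((hasDerivAt_id t).const_mul (θ j)).ofReal_comp.mul_const Complex.I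
      simpa using this
    refine (h1.cexp.mul_const (x j)).congr_deriv ?_
    simp only [diagI_apply, rot_apply]
    ring

theorem inner_diagI_left (θ : ι → ℝ) (x y : EuclideanSpace ℂ ι) :
    ⟪diagI θ x, y⟫ = -⟪x, diagI θ y⟫ := by
  simp only [PiLp.inner_apply, diagI_apply, ← Finset.sum_neg_distrib]
  refine Finset.sum_congr rfl fun j _ => ?_
  simp only [Complex.inner, map_mul, Complex.conj_ofReal, Complex.conj_I]
  simp
  ring

theorem norm_modeProj_le {C : Set ι} {θ : ι → ℝ} {u : ℝ → EuclideanSpace ℂ ι} {M : ℝ}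
    (hM : 0 ≤ M) (h : ∀ t, ‖u t‖ ≤ M) : ‖modeProj C θ u‖ ≤ Fintype.card ι * M := by
  refine norm_le_card_mul hM fun j => ?_
  by_cases hj : j ∈ C
  · rw [modeProj_apply_of_mem θ _ hj]
    exact norm_expCoeff_le fun t => (PiLp.norm_apply_le _ j).trans (h t)
  · rw [modeProj_apply_of_notMem θ _ hj, norm_zero]
    exact hM

theorem inner_modeProj {C : Set ι} (θ : ι → ℝ) {c : EuclideanSpace ℂ ι} (hc : ∀ j ∉ C, c j = 0)
    {u : ℝ → EuclideanSpace ℂ ι} (hu : Continuous u) :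
    ⟪c, modeProj C θ u⟫ = ∫ t in (0 : ℝ)..1, ⟪rot θ t c, u t⟫ := by
  simp only [PiLp.inner_apply]
  rw [intervalIntegral.integral_finsetSum fun j _ => Continuous.intervalIntegrable (by
    simp only [rot_apply]; fun_prop) _ _]
  refine Finset.sum_congr rfl fun j _ => ?_
  by_cases hj : j ∈ C
  · rw [modeProj_apply_of_mem θ _ hj, expCoeff]
    have h1 := ((innerSL ℝ (c j)).intervalIntegral_comp_comm (μ := MeasureTheory.volume)
      (a := 0) (b := 1) (f := fun s : ℝ => Complex.exp (-(θ j * s : ℝ) * Complex.I) * u s j)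
      (Continuous.intervalIntegrable (by fun_prop) _ _))
    simp only [innerSL_apply_apply] at h1
    rw [← h1]
    congr 1
    ext s
    simp only [Complex.inner, rot_apply, map_mul, ← Complex.exp_conj, Complex.conj_ofReal,
      Complex.conj_I, mul_neg, neg_mul]
    congr 1
    ring
  · simp [rot_apply, hc j hj]

end PeriodicOperators

section GreenOperator

variable {ι : Type*}

open Classical in
/-- A right inverse of `w ↦ w' - diagI θ w` on the curves `diagI θ u` with `modeProj C θ u = 0`. -/
noncomputable def greenAux (C : Set ι) (θ : ι → ℝ) (u : ℝ → EuclideanSpace ℂ ι) (t : ℝ) :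
    EuclideanSpace ℂ ι :=
  WithLp.toLp 2 fun j => θ j * Complex.I * ∫ s in (0 : ℝ)..1,
    ((if j ∈ C then 1 else 0) * s +
      (if j ∈ C then 0 else (Complex.exp (-(θ j * Complex.I)) - 1)⁻¹)) *
      Complex.exp (-(θ j * s : ℝ) * Complex.I) * u (t + s) j

/-- The right inverse of `w ↦ w' - diagI θ w` on the curves `diagI θ u` with
`modeProj C θ u = 0`, normalised to have values with `modeProj C θ w = 0`. -/
noncomputable def green (C : Set ι) (θ : ι → ℝ) (u : ℝ → EuclideanSpace ℂ ι) (t : ℝ) :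
    EuclideanSpace ℂ ι :=
  greenAux C θ u t - rot θ t (modeProj C θ (greenAux C θ u))

theorem greenAux_comp_add (C : Set ι) (θ : ι → ℝ) (u : ℝ → EuclideanSpace ℂ ι) (s t : ℝ) :
    greenAux C θ (fun r => u (s + r)) t = greenAux C θ u (s + t) := by
  simp only [greenAux, add_assoc]

theorem greenAux_add_one (C : Set ι) (θ : ι → ℝ) {u : ℝ → EuclideanSpace ℂ ι}
    (hper : ∀ t, u (t + 1) = u t) (t : ℝ) : greenAux C θ u (t + 1) = greenAux C θ u t := by
  simp only [greenAux, add_right_comm t 1, hper]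

theorem rot_add_one {C : Set ι} {θ : ι → ℝ} (hC : IsResonant C θ) {x : EuclideanSpace ℂ ι}
    (hx : ∀ j ∉ C, x j = 0) (t : ℝ) : rot θ (t + 1) x = rot θ t x := by
  rw [rot_add]
  congr 1
  ext j
  by_cases hj : j ∈ C
  · rw [rot_apply, mul_one, (hC j).2 hj, one_mul]
  · rw [rot_apply, hx j hj, mul_zero]

theorem green_comp_add {C : Set ι} {θ : ι → ℝ} (hC : IsResonant C θ)
    {u : ℝ → EuclideanSpace ℂ ι} (hper : ∀ t, u (t + 1) = u t) (s t : ℝ) :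
    green C θ (fun r => u (s + r)) t = green C θ u (s + t) := by
  have h := modeProj_comp_add hC (greenAux_add_one C θ hper) s
  have h' : greenAux C θ (fun r => u (s + r)) = fun r => greenAux C θ u (s + r) :=
    funext fun r => greenAux_comp_add C θ u s r
  simp only [green, h', h, add_comm s t, rot_add]

theorem green_add_one {C : Set ι} {θ : ι → ℝ} (hC : IsResonant C θ)
    {u : ℝ → EuclideanSpace ℂ ι} (hper : ∀ t, u (t + 1) = u t) (t : ℝ) :
    green C θ u (t + 1) = green C θ u t := by
  rw [green, greenAux_add_one C θ hper,
    rot_add_one hC fun j hj => modeProj_apply_of_notMem θ _ hj, green]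

theorem continuous_greenAux (C : Set ι) (θ : ι → ℝ) {u : ℝ → EuclideanSpace ℂ ι}
    (hu : Continuous u) : Continuous (greenAux C θ u) :=
  continuous_euclideanSpace fun j => by simp only [greenAux]; fun_prop

theorem greenAux_sub (C : Set ι) (θ : ι → ℝ) {u v : ℝ → EuclideanSpace ℂ ι}
    (hu : Continuous u) (hv : Continuous v) (t : ℝ) :
    greenAux C θ (fun s => u s - v s) t = greenAux C θ u t - greenAux C θ v t := by
  ext j
  simp only [greenAux, PiLp.sub_apply, mul_sub]
  rw [intervalIntegral.integral_sub (Continuous.intervalIntegrable (by fun_prop) _ _)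
    (Continuous.intervalIntegrable (by fun_prop) _ _), mul_sub]

theorem green_sub (C : Set ι) (θ : ι → ℝ) {u v : ℝ → EuclideanSpace ℂ ι}
    (hu : Continuous u) (hv : Continuous v) (t : ℝ) :
    green C θ (fun s => u s - v s) t = green C θ u t - green C θ v t := by
  have h : greenAux C θ (fun s => u s - v s) = fun t => greenAux C θ u t - greenAux C θ v t :=
    funext fun t => greenAux_sub C θ hu hv t
  simp only [green, h, modeProj_sub (continuous_greenAux C θ hu) (continuous_greenAux C θ hv),
    rot_sub]
  abel

theorem modeProj_green (C : Set ι) (θ : ι → ℝ) {u : ℝ → EuclideanSpace ℂ ι}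
    (hu : Continuous u) : modeProj C θ (green C θ u) = 0 := by
  have h : modeProj C θ (green C θ u) = _ :=
    modeProj_sub (continuous_greenAux C θ hu) (continuous_rot θ _)
  rw [h, modeProj_rot θ fun j hj => modeProj_apply_of_notMem θ _ hj, sub_self]

variable [Fintype ι]

theorem continuous_green (C : Set ι) (θ : ι → ℝ) {u : ℝ → EuclideanSpace ℂ ι}
    (hu : Continuous u) : Continuous (green C θ u) :=
  (continuous_greenAux C θ hu).sub (continuous_rot θ _)

theorem hasDerivAt_greenAux {C : Set ι} {θ : ι → ℝ} (hC : IsResonant C θ)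
    {u : ℝ → EuclideanSpace ℂ ι} (hu : Continuous u) (hper : ∀ t, u (t + 1) = u t) (t : ℝ) :
    HasDerivAt (greenAux C θ u)
      (diagI θ (greenAux C θ u t + u t - rot θ t (modeProj C θ u))) t := by
  classical
  refine hasDerivAt_euclideanSpace fun j => ?_
  have huj : Continuous fun t => u t j := by fun_prop
  have hE : Complex.exp (-(θ j * Complex.I)) = (Complex.exp (θ j * Complex.I))⁻¹ :=
    Complex.exp_neg _
  refine ((hasDerivAt_green (θ := θ j) (α := if j ∈ C then 1 else 0)
    (β := if j ∈ C then 0 else (Complex.exp (-(θ j * Complex.I)) - 1)⁻¹) ?_ huj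
    (fun t => by rw [hper]) t).const_mul (θ j * Complex.I)).congr_deriv ?_
  · by_cases hj : j ∈ C
    · simp [hj, hE, (hC j).2 hj]
    · have h1 : Complex.exp (-(θ j * Complex.I)) - 1 ≠ 0 := by
        intro h
        rw [sub_eq_zero, hE, inv_eq_one] at h
        exact hj ((hC j).1 h)
      simp only [hj, if_false]
      field_simp
      ring
  · simp only [diagI_apply, PiLp.sub_apply, PiLp.add_apply, rot_apply]
    by_cases hj : j ∈ C
    · rw [expCoeff_comp_add (u := fun t => u t j) ((hC j).2 hj) (fun t => by rw [hper]),
        modeProj_apply_of_mem θ _ hj]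
      simp only [greenAux, hj, if_true]
      ring
    · rw [modeProj_apply_of_notMem θ _ hj]
      simp only [greenAux, hj, if_false]
      ring

theorem hasDerivAt_green_operator {C : Set ι} {θ : ι → ℝ} (hC : IsResonant C θ)
    {u : ℝ → EuclideanSpace ℂ ι} (hu : Continuous u) (hper : ∀ t, u (t + 1) = u t) (t : ℝ) :
    HasDerivAt (green C θ u) (diagI θ (green C θ u t + u t - rot θ t (modeProj C θ u))) t := by
  refine ((hasDerivAt_greenAux hC hu hper t).sub (hasDerivAt_rot θ _ t)).congr_deriv ?_
  rw [← map_sub, green]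
  congr 1
  abel

theorem exists_norm_green_le (C : Set ι) (θ : ι → ℝ) :
    ∃ K ≥ 1, ∀ (u : ℝ → EuclideanSpace ℂ ι) (M : ℝ), 0 ≤ M → (∀ t, ‖u t‖ ≤ M) →
      (∀ t, ‖green C θ u t‖ ≤ K * M) ∧ ‖modeProj C θ u‖ ≤ K * M := by
  classical
  set b : ι → ℝ := fun j =>
    |θ j| * (1 + ‖if j ∈ C then 0 else (Complex.exp (-(θ j * Complex.I)) - 1)⁻¹‖) with hb
  have hb0 : ∀ j, 0 ≤ b j := fun j => by positivity
  set L := ∑ j, b j with hL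
  have hL0 : 0 ≤ L := Finset.sum_nonneg fun j _ => hb0 j
  set k : ℝ := (Fintype.card ι : ℝ) with hk
  have hk0 : 0 ≤ k := by positivity
  refine ⟨1 + k + k * L + k * (k * L), by
    have : 0 ≤ k + k * L + k * (k * L) := by positivity
    linarith, fun u M hM h => ?_⟩
  have haux : ∀ t, ‖greenAux C θ u t‖ ≤ k * (L * M) := fun t => by
    refine norm_le_card_mul (by positivity) fun j => ?_
    have h1 : ‖∫ s in (0 : ℝ)..1, ((if j ∈ C then 1 else 0) * (s : ℂ) +
      (if j ∈ C then 0 else (Complex.exp (-(θ j * Complex.I)) - 1)⁻¹)) *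
      Complex.exp (-(θ j * s : ℝ) * Complex.I) * u (t + s) j‖ ≤
        (1 + ‖if j ∈ C then 0 else (Complex.exp (-(θ j * Complex.I)) - 1)⁻¹‖) * M * |1 - 0| := by
      refine intervalIntegral.norm_integral_le_of_norm_le_const fun s hs => ?_
      rw [Set.uIoc_of_le zero_le_one] at hs
      rw [norm_mul, norm_mul, ← Complex.ofReal_neg, Complex.norm_exp_ofReal_mul_I, mul_one]
      gcongr
      · refine (norm_add_le _ _).trans (add_le_add ?_ le_rfl)
        rw [norm_mul, Complex.norm_real, Real.norm_of_nonneg hs.1.le]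
        split_ifs
        · simpa using hs.2
        · simp
      · exact (PiLp.norm_apply_le _ j).trans (h _)
    calc ‖greenAux C θ u t j‖ ≤ |θ j| *
        ((1 + ‖if j ∈ C then 0 else (Complex.exp (-(θ j * Complex.I)) - 1)⁻¹‖) * M * |1 - 0|) := by
          simp only [greenAux, norm_mul, Complex.norm_I, mul_one, Complex.norm_real,
            Real.norm_eq_abs]
          gcongr
      _ = b j * M := by simp [hb]; ring
      _ ≤ L * M := by
          gcongr
          exact Finset.single_le_sum (fun j _ => hb0 j) (Finset.mem_univ j)
  have hp := norm_modeProj_le (C := C) (θ := θ) hM h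
  have hq := norm_modeProj_le (C := C) (θ := θ) (by positivity) haux
  refine ⟨fun t => ?_, hp.trans ?_⟩
  · refine (norm_sub_le _ _).trans ?_
    rw [norm_rot]
    have h2 := add_le_add (haux t) hq
    have h3 : 0 ≤ (1 + k) * M := by positivity
    rw [← hk] at h2
    nlinarith
  · have : 0 ≤ (1 + k * L + k * (k * L)) * M := by positivity
    rw [← hk]
    nlinarith

end GreenOperator

section Perturbation

variable {ι : Type*} [Fintype ι]

/-- `H` is `C¹`-close to the Hamiltonian `‖z‖² / 2`: on the ball of radius `2` its gradient is
`z + G z` with `G` globally `η`-Lipschitz. -/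
structure IsPerturbation (η : NNReal) (H : EuclideanSpace ℂ ι → ℝ)
    (G : EuclideanSpace ℂ ι → EuclideanSpace ℂ ι) : Prop where
  continuous : Continuous H
  zero : H 0 = 0
  lipschitz : LipschitzWith η G
  map_zero : G 0 = 0
  hasGradientAt : ∀ z, ‖z‖ ≤ 2 → HasGradientAt H (z + G z) z

namespace IsPerturbation

variable {η : NNReal} {H : EuclideanSpace ℂ ι → ℝ} {G : EuclideanSpace ℂ ι → EuclideanSpace ℂ ι}

theorem norm_le (h : IsPerturbation η H G) (z : EuclideanSpace ℂ ι) : ‖G z‖ ≤ η * ‖z‖ := by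
  simpa [h.map_zero] using h.lipschitz.norm_sub_le z 0

theorem abs_sub_half_sq_sub_le (h : IsPerturbation η H G) {z z' : EuclideanSpace ℂ ι}
    (hz : ‖z‖ ≤ 2) (hz' : ‖z'‖ ≤ 2) :
    |(H z - ‖z‖ ^ 2 / 2) - (H z' - ‖z'‖ ^ 2 / 2)| ≤ 2 * η * ‖z - z'‖ := by
  have hconv := convex_closedBall (0 : EuclideanSpace ℂ ι) 2
  have := hconv.norm_image_sub_le_of_norm_hasFDerivWithin_le
    (f := fun z => H z - ‖z‖ ^ 2 / 2) (C := 2 * η) (x := z') (y := z)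
    (f' := fun z => innerSL ℝ (G z)) (fun x hx => ?_) (fun x hx => ?_)
    (mem_closedBall_zero_iff.2 hz') (mem_closedBall_zero_iff.2 hz)
  · simpa [Real.norm_eq_abs] using this
  · have h1 := (h.hasGradientAt x (mem_closedBall_zero_iff.1 hx)).hasFDerivAt
    have h2 : HasFDerivAt (fun z : EuclideanSpace ℂ ι => ‖z‖ ^ 2 / 2) (innerSL ℝ x) x := by
      refine ((hasStrictFDerivAt_norm_sq x).hasFDerivAt.mul_const (1 / 2)).congr_fderiv ?_
        |>.congr_of_eventuallyEq ?_
      · ext y; simp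
      · exact Filter.Eventually.of_forall fun z => by simp only [div_eq_mul_inv, one_mul]
    refine ((h1.sub h2).congr_fderiv ?_).hasFDerivWithinAt
    ext y
    simp
  · rw [innerSL_apply_norm]
    have h1 := h.norm_le x
    have h2 := mem_closedBall_zero_iff.1 hx
    nlinarith [η.2]

theorem abs_sub_half_sq_le (h : IsPerturbation η H G) {z : EuclideanSpace ℂ ι}
    (hz : ‖z‖ ≤ 2) : |H z - ‖z‖ ^ 2 / 2| ≤ 4 * (η : ℝ) := by
  have := h.abs_sub_half_sq_sub_le hz (z' := 0) (by simp)
  simp only [h.zero, norm_zero, sub_zero] at this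
  norm_num at this
  refine this.trans ?_
  nlinarith [η.2]

theorem abs_sub_sub_inner_le (h : IsPerturbation η H G) (hη : η ≤ 1) {z z' : EuclideanSpace ℂ ι}
    (hz : ‖z‖ ≤ 2) (hz' : ‖z'‖ ≤ 2) :
    |H z' - H z - ⟪z + G z, z' - z⟫| ≤ 2 * ‖z' - z‖ ^ 2 := by
  have := ((convex_closedBall (0 : EuclideanSpace ℂ ι) 2).inter
    (convex_closedBall z ‖z' - z‖)).norm_image_sub_le_of_norm_hasFDerivWithin_le
    (f := fun x => H x - innerSL ℝ (z + G z) x) (C := 2 * ‖z' - z‖) (x := z) (y := z')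
    (f' := fun x => innerSL ℝ (x + G x) - innerSL ℝ (z + G z)) (fun x hx => ?_) (fun x hx => ?_)
    ⟨mem_closedBall_zero_iff.2 hz, by simp⟩
    ⟨mem_closedBall_zero_iff.2 hz', by simp [dist_eq_norm]⟩
  · rw [Real.norm_eq_abs] at this
    convert this using 1
    · congr 1
      simp only [innerSL_apply_apply, inner_sub_right]
      ring
    · ring
  · have h1 := (h.hasGradientAt x (mem_closedBall_zero_iff.1 hx.1)).hasFDerivAt
    exact ((h1.congr_fderiv (by ext y; simp)).sub
      (innerSL ℝ (z + G z)).hasFDerivAt).hasFDerivWithinAt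
  · rw [← map_sub, innerSL_apply_norm]
    have h1 := h.lipschitz.norm_sub_le x z
    have h2 : ‖x - z‖ ≤ ‖z' - z‖ := by simpa [dist_eq_norm] using hx.2
    have h3 : (η : ℝ) ≤ 1 := by exact_mod_cast hη
    calc ‖x + G x - (z + G z)‖ = ‖(x - z) + (G x - G z)‖ := by congr 1; abel
      _ ≤ ‖x - z‖ + ‖G x - G z‖ := norm_add_le _ _
      _ ≤ 2 * ‖z' - z‖ := by nlinarith [norm_nonneg (x - z)]

end IsPerturbation

end Perturbation

section Contraction

variable {ι : Type*} [Fintype ι]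

open BoundedContinuousFunction

/-- The orbit of `v` under the linear flow, as a bounded curve. -/
noncomputable def rotCurve (θ : ι → ℝ) (v : EuclideanSpace ℂ ι) : ℝ →ᵇ EuclideanSpace ℂ ι :=
  ofNormedAddCommGroup (fun t => rot θ t v) (continuous_rot θ v) ‖v‖ fun t => (norm_rot θ t v).le

@[simp] theorem rotCurve_apply (θ : ι → ℝ) (v : EuclideanSpace ℂ ι) (t : ℝ) :
    rotCurve θ v t = rot θ t v := rfl

/-- A bound for the norms of the Green operator and of the mode projection. -/
noncomputable def greenConst (C : Set ι) (θ : ι → ℝ) : ℝ := (exists_norm_green_le C θ).choose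

theorem one_le_greenConst (C : Set ι) (θ : ι → ℝ) : 1 ≤ greenConst C θ :=
  (exists_norm_green_le C θ).choose_spec.1

theorem norm_green_le (C : Set ι) (θ : ι → ℝ) {u : ℝ → EuclideanSpace ℂ ι} {M : ℝ} (hM : 0 ≤ M)
    (h : ∀ t, ‖u t‖ ≤ M) (t : ℝ) : ‖green C θ u t‖ ≤ greenConst C θ * M :=
  ((exists_norm_green_le C θ).choose_spec.2 u M hM h).1 t

theorem norm_modeProj_le_greenConst (C : Set ι) (θ : ι → ℝ) {u : ℝ → EuclideanSpace ℂ ι} {M : ℝ}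
    (hM : 0 ≤ M) (h : ∀ t, ‖u t‖ ≤ M) : ‖modeProj C θ u‖ ≤ greenConst C θ * M :=
  ((exists_norm_green_le C θ).choose_spec.2 u M hM h).2

/-- The Green operator on bounded curves. -/
noncomputable def greenCurve (C : Set ι) (θ : ι → ℝ) (u : ℝ →ᵇ EuclideanSpace ℂ ι) :
    ℝ →ᵇ EuclideanSpace ℂ ι :=
  ofNormedAddCommGroup (green C θ u) (continuous_green C θ u.continuous) (greenConst C θ * ‖u‖)
    (norm_green_le C θ (norm_nonneg u) u.norm_coe_le_norm)

@[simp] theorem greenCurve_apply (C : Set ι) (θ : ι → ℝ) (u : ℝ →ᵇ EuclideanSpace ℂ ι) (t : ℝ) :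
    greenCurve C θ u t = green C θ u t := rfl

/-- The unknowns of the reduced problem: the non-resonant part of a curve, its excess amplitude
and its excess frequency. -/
abbrev ReductionSpace (ι : Type*) [Fintype ι] := (ℝ →ᵇ EuclideanSpace ℂ ι) × ℝ × ℝ

/-- The closed curve with resonant part `(1 + a) v` and non-resonant part `w`. -/
noncomputable def reductionCurve (θ : ι → ℝ) (v : EuclideanSpace ℂ ι) (p : ReductionSpace ι) :
    ℝ →ᵇ EuclideanSpace ℂ ι :=
  (1 + p.2.1) • rotCurve θ v + p.1

theorem reductionCurve_apply (θ : ι → ℝ) (v : EuclideanSpace ℂ ι) (p : ReductionSpace ι) (t : ℝ) :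
    reductionCurve θ v p t = (1 + p.2.1) • rot θ t v + p.1 t := rfl

/-- The inhomogeneity of the linearised equation. -/
noncomputable def reductionForce (θ : ι → ℝ) {η : NNReal}
    {G : EuclideanSpace ℂ ι → EuclideanSpace ℂ ι} (hG : LipschitzWith η G)
    (v : EuclideanSpace ℂ ι) (p : ReductionSpace ι) : ℝ →ᵇ EuclideanSpace ℂ ι :=
  p.2.2 • p.1 + (1 + p.2.2) • BoundedContinuousFunction.comp G hG (reductionCurve θ v p)

theorem reductionForce_apply (θ : ι → ℝ) {η : NNReal}
    {G : EuclideanSpace ℂ ι → EuclideanSpace ℂ ι} (hG : LipschitzWith η G)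
    (v : EuclideanSpace ℂ ι) (p : ReductionSpace ι) (t : ℝ) :
    reductionForce θ hG v p t =
      p.2.2 • p.1 t + (1 + p.2.2) • G (reductionCurve θ v p t) := rfl

/-- The map whose fixed points solve the range equation, the energy constraint and the tangential
part of the bifurcation equation. -/
noncomputable def reductionMap (C : Set ι) (θ : ι → ℝ) (H : EuclideanSpace ℂ ι → ℝ) {η : NNReal}
    {G : EuclideanSpace ℂ ι → EuclideanSpace ℂ ι} (hG : LipschitzWith η G)
    (v : EuclideanSpace ℂ ι) (p : ReductionSpace ι) : ReductionSpace ι :=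
  (greenCurve C θ (reductionForce θ hG v p),
    -((p.2.1 ^ 2 + ∫ t in (0 : ℝ)..1, ‖p.1 t‖ ^ 2) / 2 + ∫ t in (0 : ℝ)..1,
      (H (reductionCurve θ v p t) - ‖reductionCurve θ v p t‖ ^ 2 / 2)),
    -(p.2.1 * p.2.2 + ⟪modeProj C θ (reductionForce θ hG v p), v⟫))

/-- The small closed set of `1`-periodic unknowns. -/
def reductionBall (ι : Type*) [Fintype ι] (r : ℝ) : Set (ReductionSpace ι) :=
  {p | ‖p‖ ≤ r ∧ ∀ t, p.1 (t + 1) = p.1 t}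

theorem isClosed_reductionBall (r : ℝ) : IsClosed (reductionBall ι r) := by
  have h : reductionBall ι r = {p | ‖p‖ ≤ r} ∩ ⋂ t, {p | p.1 (t + 1) = p.1 t} := by
    ext; simp [reductionBall]
  rw [h]
  refine (isClosed_le continuous_norm continuous_const).inter ?_
  refine isClosed_iInter fun t => isClosed_eq ?_ ?_
  · exact (continuous_eval_const (t + 1)).comp continuous_fst
  · exact (continuous_eval_const t).comp continuous_fst

theorem reductionBall.bounds {r : ℝ} {p : ReductionSpace ι} (hp : p ∈ reductionBall ι r) :
    (∀ t, ‖p.1 t‖ ≤ r) ∧ |p.2.1| ≤ r ∧ |p.2.2| ≤ r :=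
  ⟨fun t => (p.1.norm_coe_le_norm t).trans ((norm_fst_le p).trans hp.1),
    ((norm_fst_le p.2).trans (norm_snd_le p)).trans hp.1,
    ((norm_snd_le p.2).trans (norm_snd_le p)).trans hp.1⟩

theorem ReductionSpace.dist_bounds (p q : ReductionSpace ι) :
    (∀ t, ‖p.1 t - q.1 t‖ ≤ dist p q) ∧ |p.2.1 - q.2.1| ≤ dist p q ∧
      |p.2.2 - q.2.2| ≤ dist p q := by
  rw [dist_eq_norm]
  exact ⟨fun t => ((p - q).1.norm_coe_le_norm t).trans (norm_fst_le _),
    (norm_fst_le (p - q).2).trans (norm_snd_le _), (norm_snd_le (p - q).2).trans (norm_snd_le _)⟩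

theorem ReductionSpace.dist_le {p q : ReductionSpace ι} {r : ℝ} (hr : 0 ≤ r)
    (h1 : ∀ t, ‖p.1 t - q.1 t‖ ≤ r) (h2 : |p.2.1 - q.2.1| ≤ r) (h3 : |p.2.2 - q.2.2| ≤ r) :
    dist p q ≤ r := by
  rw [Prod.dist_eq, Prod.dist_eq]
  refine max_le ((BoundedContinuousFunction.dist_le hr).2 fun t => ?_) (max_le h2 h3)
  rw [dist_eq_norm]
  exact h1 t

end Contraction

section Estimates

variable {ι : Type*} [Fintype ι] {C : Set ι} {θ : ι → ℝ} {η : NNReal}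
  {H : EuclideanSpace ℂ ι → ℝ} {G : EuclideanSpace ℂ ι → EuclideanSpace ℂ ι} {r : ℝ}
  {v v' : EuclideanSpace ℂ ι} {p p' : ReductionSpace ι}

theorem norm_reductionCurve_sub_le (hp : p ∈ reductionBall ι r) (hv : ‖v‖ = 1) (t : ℝ) :
    ‖reductionCurve θ v p t - rot θ t v‖ ≤ 2 * r := by
  obtain ⟨h1, h2, -⟩ := reductionBall.bounds hp
  have h3 : reductionCurve θ v p t - rot θ t v = p.2.1 • rot θ t v + p.1 t := by
    rw [reductionCurve_apply]; module
  rw [h3]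
  refine (norm_add_le _ _).trans ?_
  rw [norm_smul, norm_rot, hv, Real.norm_eq_abs, mul_one]
  linarith [h1 t]

theorem norm_reductionCurve_le (hp : p ∈ reductionBall ι r) (hv : ‖v‖ = 1) (hr : r ≤ 1 / 2)
    (t : ℝ) : ‖reductionCurve θ v p t‖ ≤ 2 := by
  have h1 := norm_reductionCurve_sub_le (θ := θ) hp hv t
  have h2 := norm_sub_norm_le (reductionCurve θ v p t) (rot θ t v)
  rw [norm_rot, hv] at h2
  linarith

theorem norm_reductionCurve_sub_reductionCurve_le (hv : ‖v‖ = 1) (t : ℝ) :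
    ‖reductionCurve θ v p t - reductionCurve θ v' p' t‖ ≤
      2 * dist p p' + (1 + |p'.2.1|) * ‖v - v'‖ := by
  obtain ⟨d1, d2, -⟩ := ReductionSpace.dist_bounds p p'
  have h3 : reductionCurve θ v p t - reductionCurve θ v' p' t =
      (p.2.1 - p'.2.1) • rot θ t v + (1 + p'.2.1) • rot θ t (v - v') + (p.1 t - p'.1 t) := by
    rw [reductionCurve_apply, reductionCurve_apply, rot_sub]; module
  rw [h3]
  refine (norm_add₃_le).trans ?_
  rw [norm_smul, norm_smul, norm_rot, norm_rot, hv, Real.norm_eq_abs, mul_one, Real.norm_eq_abs]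
  have h4 : |1 + p'.2.1| ≤ 1 + |p'.2.1| := (abs_add_le _ _).trans (by simp)
  have h5 := mul_le_mul_of_nonneg_right h4 (norm_nonneg (v - v'))
  linarith [d1 t]

theorem norm_reductionForce_le (h : IsPerturbation η H G) (hp : p ∈ reductionBall ι r)
    (hv : ‖v‖ = 1) (hr : r ≤ 1 / 2) (t : ℝ) :
    ‖reductionForce θ h.lipschitz v p t‖ ≤ r ^ 2 + 4 * η := by
  obtain ⟨h1, h2, h3⟩ := reductionBall.bounds hp
  have hr0 : 0 ≤ r := (abs_nonneg _).trans h2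
  have hy := norm_reductionCurve_le (θ := θ) hp hv hr t
  have hG := h.norm_le (reductionCurve θ v p t)
  rw [reductionForce_apply]
  refine (norm_add_le _ _).trans ?_
  rw [norm_smul, norm_smul, Real.norm_eq_abs, Real.norm_eq_abs]
  have h4 : |1 + p.2.2| ≤ 2 := (abs_add_le _ _).trans (by rw [abs_one]; linarith)
  have h5 : ‖G (reductionCurve θ v p t)‖ ≤ η * 2 :=
    hG.trans (mul_le_mul_of_nonneg_left hy η.2)
  have h6 := mul_le_mul h4 h5 (norm_nonneg _) zero_le_two
  have h7 := mul_le_mul h3 (h1 t) (norm_nonneg _) hr0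
  linarith

theorem norm_reductionForce_sub_le (h : IsPerturbation η H G) (hp : p ∈ reductionBall ι r)
    (hp' : p' ∈ reductionBall ι r) (hv : ‖v‖ = 1) (hv' : ‖v'‖ = 1) (hr : r ≤ 1 / 2) (t : ℝ) :
    ‖reductionForce θ h.lipschitz v p t - reductionForce θ h.lipschitz v' p' t‖ ≤
      (2 * r + 6 * η) * dist p p' + 4 * η * ‖v - v'‖ := by
  obtain ⟨h1, h2, h3⟩ := reductionBall.bounds hp
  obtain ⟨h1', h2', h3'⟩ := reductionBall.bounds hp'
  obtain ⟨d1, d2, d3⟩ := ReductionSpace.dist_bounds p p'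
  have hr0 : 0 ≤ r := (abs_nonneg _).trans h2
  have hη : 0 ≤ (η : ℝ) := η.2
  set y := reductionCurve θ v p t with hy
  set y' := reductionCurve θ v' p' t with hy'
  have hyy : ‖y - y'‖ ≤ 2 * dist p p' + 2 * ‖v - v'‖ := by
    refine (norm_reductionCurve_sub_reductionCurve_le hv t).trans ?_
    gcongr
    linarith
  have hG : ‖G y - G y'‖ ≤ η * (2 * dist p p' + 2 * ‖v - v'‖) :=
    (h.lipschitz.norm_sub_le _ _).trans (mul_le_mul_of_nonneg_left hyy hη)
  have hG' : ‖G y'‖ ≤ η * 2 :=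
    (h.norm_le _).trans (mul_le_mul_of_nonneg_left (norm_reductionCurve_le hp' hv' hr t) hη)
  have e : reductionForce θ h.lipschitz v p t - reductionForce θ h.lipschitz v' p' t =
      p.2.2 • (p.1 t - p'.1 t) + (p.2.2 - p'.2.2) • p'.1 t +
        ((1 + p.2.2) • (G y - G y') + (p.2.2 - p'.2.2) • G y') := by
    rw [reductionForce_apply, reductionForce_apply]; module
  rw [e]
  refine (norm_add_le _ _).trans ((add_le_add (norm_add_le _ _) (norm_add_le _ _)).trans ?_)
  simp only [norm_smul, Real.norm_eq_abs]
  have h4 : |1 + p.2.2| ≤ 2 := (abs_add_le _ _).trans (by rw [abs_one]; linarith)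
  have i1 := mul_le_mul h3 (d1 t) (norm_nonneg _) hr0
  have i2 := mul_le_mul d3 (h1' t) (norm_nonneg _) dist_nonneg
  have i3 := mul_le_mul h4 hG (norm_nonneg _) zero_le_two
  have i4 := mul_le_mul d3 hG' (norm_nonneg _) dist_nonneg
  linarith

theorem reductionCurve_add_one (hC : IsResonant C θ) (hv : ∀ j ∉ C, v j = 0)
    (hp : p ∈ reductionBall ι r) (t : ℝ) :
    reductionCurve θ v p (t + 1) = reductionCurve θ v p t := by
  rw [reductionCurve_apply, reductionCurve_apply, hp.2, rot_add_one hC hv]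

theorem reductionForce_add_one (hC : IsResonant C θ) (hG : LipschitzWith η G)
    (hv : ∀ j ∉ C, v j = 0) (hp : p ∈ reductionBall ι r) (t : ℝ) :
    reductionForce θ hG v p (t + 1) = reductionForce θ hG v p t := by
  rw [reductionForce_apply, reductionForce_apply, hp.2, reductionCurve_add_one hC hv hp]

theorem abs_integral_sub_integral_le {f g : ℝ → ℝ} (hf : Continuous f) (hg : Continuous g)
    {M : ℝ} (h : ∀ t, |f t - g t| ≤ M) :
    |(∫ t in (0 : ℝ)..1, f t) - ∫ t in (0 : ℝ)..1, g t| ≤ M := by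
  rw [← intervalIntegral.integral_sub (hf.intervalIntegrable _ _) (hg.intervalIntegrable _ _)]
  simpa using intervalIntegral.norm_integral_le_of_norm_le_const (a := 0) (b := 1) (C := M)
    (f := fun t => f t - g t) (fun t _ => h t)

theorem abs_integral_le {f : ℝ → ℝ} {M : ℝ} (h : ∀ t, |f t| ≤ M) :
    |∫ t in (0 : ℝ)..1, f t| ≤ M := by
  simpa using intervalIntegral.norm_integral_le_of_norm_le_const (a := 0) (b := 1) (C := M)
    (f := f) (fun t _ => h t)

theorem reductionMap_mem_reductionBall (hC : IsResonant C θ) (h : IsPerturbation η H G)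
    (hr : 16 * greenConst C θ * r ≤ 1) (hη : 24 * greenConst C θ * η ≤ r)
    (hv : v ∈ coordSphere C) (hp : p ∈ reductionBall ι r) :
    reductionMap C θ H h.lipschitz v p ∈ reductionBall ι r := by
  obtain ⟨h1, h2, h3⟩ := reductionBall.bounds hp
  have hr0 : 0 ≤ r := (abs_nonneg _).trans h2
  have hη0 : 0 ≤ (η : ℝ) := η.2
  have hK := one_le_greenConst C θ
  set K := greenConst C θ with hKdef
  have hr1 : 16 * r ≤ 1 := by nlinarith
  have hη1 : 24 * (η : ℝ) ≤ r := by nlinarith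
  have hF := norm_reductionForce_le (θ := θ) h hp hv.1 (by linarith)
  have hM : 0 ≤ r ^ 2 + 4 * (η : ℝ) := by positivity
  have hKF : K * (r ^ 2 + 4 * (η : ℝ)) ≤ r / 4 := by nlinarith
  refine ⟨?_, fun t => green_add_one hC (reductionForce_add_one hC h.lipschitz hv.2 hp) t⟩
  rw [← dist_zero_right]
  refine ReductionSpace.dist_le hr0 (fun t => ?_) ?_ ?_
  · have := norm_green_le C θ hM hF t
    simp only [reductionMap, greenCurve_apply, Prod.fst_zero, BoundedContinuousFunction.coe_zero,
      Pi.zero_apply, sub_zero]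
    linarith
  · have i1 : |∫ t in (0 : ℝ)..1, ‖p.1 t‖ ^ 2| ≤ r ^ 2 := abs_integral_le fun t => by
      rw [abs_of_nonneg (by positivity)]
      have := h1 t
      gcongr
    have i2 : |∫ t in (0 : ℝ)..1, (H (reductionCurve θ v p t) - ‖reductionCurve θ v p t‖ ^ 2 / 2)|
        ≤ 4 * (η : ℝ) := abs_integral_le fun t =>
      h.abs_sub_half_sq_le (norm_reductionCurve_le hp hv.1 (by linarith) t)
    have i3 : p.2.1 ^ 2 ≤ r ^ 2 := sq_le_sq' (abs_le.1 h2).1 (abs_le.1 h2).2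
    have i4 : r ^ 2 ≤ r / 16 := by nlinarith
    simp only [reductionMap, Prod.snd_zero, Prod.fst_zero, sub_zero, abs_neg]
    rw [abs_le] at i1 i2 ⊢
    constructor <;> nlinarith [sq_nonneg p.2.1]
  · have i1 : |⟪modeProj C θ (reductionForce θ h.lipschitz v p), v⟫| ≤ r / 4 := by
      refine (abs_real_inner_le_norm _ _).trans ?_
      rw [hv.1, mul_one]
      exact (norm_modeProj_le_greenConst C θ hM hF).trans hKF
    have i2 : |p.2.1 * p.2.2| ≤ r * r := by
      rw [abs_mul]
      exact mul_le_mul h2 h3 (abs_nonneg _) hr0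
    simp only [reductionMap, Prod.snd_zero, sub_zero, abs_neg]
    refine (abs_add_le _ _).trans ?_
    nlinarith

theorem dist_reductionMap_le (h : IsPerturbation η H G)
    (hr : 16 * greenConst C θ * r ≤ 1) (hη : 24 * greenConst C θ * η ≤ r)
    (hv : v ∈ coordSphere C) (hv' : v' ∈ coordSphere C) (hp : p ∈ reductionBall ι r)
    (hp' : p' ∈ reductionBall ι r) :
    dist (reductionMap C θ H h.lipschitz v p) (reductionMap C θ H h.lipschitz v' p') ≤
      dist p p' / 2 + 2 * ‖v - v'‖ := by
  obtain ⟨h1, h2, h3⟩ := reductionBall.bounds hp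
  obtain ⟨h1', h2', h3'⟩ := reductionBall.bounds hp'
  obtain ⟨d1, d2, d3⟩ := ReductionSpace.dist_bounds p p'
  have hr0 : 0 ≤ r := (abs_nonneg _).trans h2
  have hη0 : 0 ≤ (η : ℝ) := η.2
  have hK := one_le_greenConst C θ
  set K := greenConst C θ with hKdef
  have hr1 : 16 * r ≤ 1 := by nlinarith
  have hη1 : 24 * (η : ℝ) ≤ r := by nlinarith
  set d := dist p p' with hd
  set e := ‖v - v'‖ with he
  have hd0 : 0 ≤ d := dist_nonneg
  have he0 : 0 ≤ e := norm_nonneg _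
  have hF := norm_reductionForce_le (θ := θ) h hp hv.1 (by linarith)
  have hF' := norm_reductionForce_le (θ := θ) h hp' hv'.1 (by linarith)
  have hFF := norm_reductionForce_sub_le (θ := θ) h hp hp' hv.1 hv'.1 (by linarith)
  have hM : 0 ≤ r ^ 2 + 4 * (η : ℝ) := by positivity
  have hM' : 0 ≤ (2 * r + 6 * (η : ℝ)) * d + 4 * η * e := by positivity
  have hKF : K * (r ^ 2 + 4 * (η : ℝ)) ≤ r / 4 := by nlinarith
  have hKF' : K * ((2 * r + 6 * (η : ℝ)) * d + 4 * η * e) ≤ d / 4 + e := by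
    have i1 : K * (2 * r + 6 * (η : ℝ)) ≤ 1 / 4 := by nlinarith
    have i2 : K * (4 * (η : ℝ)) ≤ 1 := by nlinarith
    nlinarith [mul_le_mul_of_nonneg_right i1 hd0, mul_le_mul_of_nonneg_right i2 he0]
  have hyy : ∀ t, ‖reductionCurve θ v p t - reductionCurve θ v' p' t‖ ≤ 2 * d + 2 * e := by
    intro t
    refine (norm_reductionCurve_sub_reductionCurve_le hv.1 t).trans ?_
    gcongr
    linarith
  refine ReductionSpace.dist_le (by positivity) (fun t => ?_) ?_ ?_
  · simp only [reductionMap, greenCurve_apply]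
    rw [← green_sub C θ (BoundedContinuousFunction.continuous _)
      (BoundedContinuousFunction.continuous _)]
    have := norm_green_le C θ hM' hFF t
    linarith
  · have i1 := abs_integral_sub_integral_le (f := fun t => ‖p.1 t‖ ^ 2)
      (g := fun t => ‖p'.1 t‖ ^ 2) (M := 2 * r * d) (by fun_prop) (by fun_prop) fun t => by
        have j1 : |‖p.1 t‖ - ‖p'.1 t‖| ≤ d := (abs_norm_sub_norm_le _ _).trans (d1 t)
        have j2 : |‖p.1 t‖ + ‖p'.1 t‖| ≤ 2 * r := by
          rw [abs_of_nonneg (by positivity)]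
          linarith [h1 t, h1' t]
        rw [sq_sub_sq, abs_mul]
        exact mul_le_mul j2 j1 (abs_nonneg _) (by positivity)
    have hc := h.continuous
    have i2 := abs_integral_sub_integral_le
      (f := fun t => H (reductionCurve θ v p t) - ‖reductionCurve θ v p t‖ ^ 2 / 2)
      (g := fun t => H (reductionCurve θ v' p' t) - ‖reductionCurve θ v' p' t‖ ^ 2 / 2)
      (M := 2 * η * (2 * d + 2 * e)) (by fun_prop) (by fun_prop) fun t =>
        (h.abs_sub_half_sq_sub_le (norm_reductionCurve_le hp hv.1 (by linarith) t)
          (norm_reductionCurve_le hp' hv'.1 (by linarith) t)).trans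
          (mul_le_mul_of_nonneg_left (hyy t) (by positivity))
    have i3 : |p.2.1 ^ 2 - p'.2.1 ^ 2| ≤ 2 * r * d := by
      have j2 : |p.2.1 + p'.2.1| ≤ 2 * r := (abs_add_le _ _).trans (by linarith)
      rw [sq_sub_sq, abs_mul]
      exact mul_le_mul j2 d2 (abs_nonneg _) (by positivity)
    have j1 : 2 * r * d ≤ d / 8 := by nlinarith
    have j2 : 2 * (η : ℝ) * (2 * d + 2 * e) ≤ d / 8 + e := by nlinarith
    simp only [reductionMap]
    rw [abs_le] at i1 i2 i3 ⊢
    constructor <;> linarith [i1.1, i1.2, i2.1, i2.2, i3.1, i3.2]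
  · have i1 : |p.2.1 * p.2.2 - p'.2.1 * p'.2.2| ≤ 2 * r * d := by
      have : p.2.1 * p.2.2 - p'.2.1 * p'.2.2 =
        p.2.1 * (p.2.2 - p'.2.2) + (p.2.1 - p'.2.1) * p'.2.2 := by ring
      rw [this]
      refine (abs_add_le _ _).trans ?_
      rw [abs_mul, abs_mul]
      have := mul_le_mul h2 d3 (abs_nonneg _) hr0
      have := mul_le_mul d2 h3' (abs_nonneg _) hd0
      linarith
    have i2 : |⟪modeProj C θ (reductionForce θ h.lipschitz v p), v⟫ -
        ⟪modeProj C θ (reductionForce θ h.lipschitz v' p'), v'⟫| ≤ d / 4 + e + r / 4 * e := by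
      have : ⟪modeProj C θ (reductionForce θ h.lipschitz v p), v⟫ -
          ⟪modeProj C θ (reductionForce θ h.lipschitz v' p'), v'⟫ =
          ⟪modeProj C θ (reductionForce θ h.lipschitz v p) -
            modeProj C θ (reductionForce θ h.lipschitz v' p'), v⟫ +
          ⟪modeProj C θ (reductionForce θ h.lipschitz v' p'), v - v'⟫ := by
        rw [inner_sub_left, inner_sub_right]; ring
      rw [this]
      refine (abs_add_le _ _).trans (add_le_add ?_ ?_)
      · refine (abs_real_inner_le_norm _ _).trans ?_
        rw [hv.1, mul_one, ← modeProj_sub (BoundedContinuousFunction.continuous _)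
          (BoundedContinuousFunction.continuous _)]
        exact (norm_modeProj_le_greenConst C θ hM' hFF).trans hKF'
      · refine (abs_real_inner_le_norm _ _).trans ?_
        exact mul_le_mul_of_nonneg_right
          ((norm_modeProj_le_greenConst C θ hM hF').trans hKF) he0
    have j1 : 2 * r * d ≤ d / 8 := by nlinarith
    have j2 : r / 4 * e ≤ e := by nlinarith
    simp only [reductionMap]
    rw [abs_le] at i1 i2 ⊢
    constructor <;> linarith [i1.1, i1.2, i2.1, i2.2]

end Estimates

section FixedPoint

variable {ι : Type*} [Fintype ι] {C : Set ι} {θ : ι → ℝ} {η : NNReal}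
  {H : EuclideanSpace ℂ ι → ℝ} {G : EuclideanSpace ℂ ι → EuclideanSpace ℂ ι} {r : ℝ}
  {v v' : EuclideanSpace ℂ ι} {p p' : ReductionSpace ι}

open BoundedContinuousFunction

/-- `p` solves the reduced problem for the direction `v`. -/
def IsReducedPair (C : Set ι) (θ : ι → ℝ) (H : EuclideanSpace ℂ ι → ℝ)
    {G : EuclideanSpace ℂ ι → EuclideanSpace ℂ ι} (hG : LipschitzWith η G) (r : ℝ)
    (v : EuclideanSpace ℂ ι) (p : ReductionSpace ι) : Prop :=
  p ∈ reductionBall ι r ∧ reductionMap C θ H hG v p = p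

theorem exists_isReducedPair (hC : IsResonant C θ) (h : IsPerturbation η H G) (hr0 : 0 ≤ r)
    (hr : 16 * greenConst C θ * r ≤ 1) (hη : 24 * greenConst C θ * η ≤ r)
    (hv : v ∈ coordSphere C) : ∃ p, IsReducedPair C θ H h.lipschitz r v p := by
  have hmaps : Set.MapsTo (reductionMap C θ H h.lipschitz v) (reductionBall ι r)
      (reductionBall ι r) := fun p hp => reductionMap_mem_reductionBall hC h hr hη hv hp
  have hcontr : ContractingWith (1 / 2) (hmaps.restrict _ _ _) := by
    refine ⟨by norm_num, LipschitzWith.of_dist_le_mul fun p p' => ?_⟩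
    have := dist_reductionMap_le h hr hη hv hv p.2 p'.2
    simp only [sub_self, norm_zero, mul_zero, add_zero] at this
    refine this.trans (le_of_eq ?_)
    rw [Subtype.dist_eq]
    push_cast
    ring
  obtain ⟨p, hp, hfix, -⟩ := hcontr.exists_fixedPoint' (isClosed_reductionBall r).isComplete hmaps
    (x := 0) ⟨by simpa using hr0, fun t => rfl⟩ (edist_ne_top _ _)
  exact ⟨p, hp, hfix⟩

theorem IsReducedPair.dist_le (h : IsPerturbation η H G)
    (hr : 16 * greenConst C θ * r ≤ 1) (hη : 24 * greenConst C θ * η ≤ r)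
    (hv : v ∈ coordSphere C) (hv' : v' ∈ coordSphere C)
    (hp : IsReducedPair C θ H h.lipschitz r v p) (hp' : IsReducedPair C θ H h.lipschitz r v' p') :
    dist p p' ≤ 4 * ‖v - v'‖ := by
  have := dist_reductionMap_le h hr hη hv hv' hp.1 hp'.1
  rw [hp.2, hp'.2] at this
  linarith

/-- Translation of the time parameter of a bounded curve. -/
noncomputable def shiftCurve (s : ℝ) (u : ℝ →ᵇ EuclideanSpace ℂ ι) : ℝ →ᵇ EuclideanSpace ℂ ι :=
  u.compContinuous ⟨fun t => s + t, by fun_prop⟩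

@[simp] theorem shiftCurve_apply (s : ℝ) (u : ℝ →ᵇ EuclideanSpace ℂ ι) (t : ℝ) :
    shiftCurve s u t = u (s + t) := rfl

theorem reductionCurve_shift (θ : ι → ℝ) (s : ℝ) (v : EuclideanSpace ℂ ι) (p : ReductionSpace ι)
    (t : ℝ) : reductionCurve θ (rot θ s v) (shiftCurve s p.1, p.2) t =
      reductionCurve θ v p (s + t) := by
  rw [reductionCurve_apply, reductionCurve_apply, ← rot_add, add_comm t s, shiftCurve_apply]

theorem reductionForce_shift (θ : ι → ℝ) (hG : LipschitzWith η G) (s : ℝ)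
    (v : EuclideanSpace ℂ ι) (p : ReductionSpace ι) (t : ℝ) :
    reductionForce θ hG (rot θ s v) (shiftCurve s p.1, p.2) t =
      reductionForce θ hG v p (s + t) := by
  rw [reductionForce_apply, reductionForce_apply, reductionCurve_shift, shiftCurve_apply]

theorem integral_comp_add_of_periodic {f : ℝ → ℝ} (hf : ∀ t, f (t + 1) = f t) (s : ℝ) :
    ∫ t in (0 : ℝ)..1, f (s + t) = ∫ t in (0 : ℝ)..1, f t := by
  rw [intervalIntegral.integral_comp_add_left, add_zero]
  have : Function.Periodic f 1 := hf
  simpa using this.intervalIntegral_add_eq s 0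

theorem IsReducedPair.shift (hC : IsResonant C θ) {hG : LipschitzWith η G} (hv : v ∈ coordSphere C)
    (hp : IsReducedPair C θ H hG r v p) (s : ℝ) :
    IsReducedPair C θ H hG r (rot θ s v) (shiftCurve s p.1, p.2) := by
  have hF : ⇑(reductionForce θ hG (rot θ s v) (shiftCurve s p.1, p.2)) =
      fun t => reductionForce θ hG v p (s + t) :=
    funext (reductionForce_shift θ hG s v p)
  have hper := reductionForce_add_one hC hG hv.2 hp.1
  have hper' := reductionCurve_add_one hC hv.2 hp.1
  have hfix := hp.2
  refine ⟨⟨?_, fun t => ?_⟩, ?_⟩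
  · refine le_trans ?_ hp.1.1
    refine max_le_max ?_ le_rfl
    exact norm_compContinuous_le _ _
  · simp only [shiftCurve_apply, ← add_assoc]
    exact hp.1.2 _
  · refine Prod.ext ?_ (Prod.ext ?_ ?_)
    · ext1 t
      have h1 : greenCurve C θ (reductionForce θ hG v p) (s + t) = p.1 (s + t) :=
        DFunLike.congr_fun (congrArg Prod.fst hfix) (s + t)
      simp only [reductionMap, greenCurve_apply, hF, shiftCurve_apply]
      rw [green_comp_add hC hper]
      exact h1
    · rw [← congrArg (fun q : ReductionSpace ι => q.2.1) hfix]
      simp only [reductionMap, reductionCurve_shift, shiftCurve_apply]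
      rw [integral_comp_add_of_periodic (f := fun t => ‖p.1 t‖ ^ 2) fun t => by rw [hp.1.2],
        integral_comp_add_of_periodic (f := fun t => H (reductionCurve θ v p t) -
          ‖reductionCurve θ v p t‖ ^ 2 / 2) fun t => by rw [hper']]
    · rw [← congrArg (fun q : ReductionSpace ι => q.2.2) hfix]
      simp only [reductionMap, hF]
      rw [modeProj_comp_add hC hper, inner_rot_rot]

/-- The part of the bifurcation equation that is not yet solved. -/
noncomputable def reductionDefect (C : Set ι) (θ : ι → ℝ)
    {G : EuclideanSpace ℂ ι → EuclideanSpace ℂ ι} (hG : LipschitzWith η G)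
    (v : EuclideanSpace ℂ ι) (p : ReductionSpace ι) : EuclideanSpace ℂ ι :=
  (p.2.2 * (1 + p.2.1)) • v + modeProj C θ (reductionForce θ hG v p)

theorem reductionDefect_shift (hC : IsResonant C θ) (hG : LipschitzWith η G)
    (hv : v ∈ coordSphere C) (hp : p ∈ reductionBall ι r) (s : ℝ) :
    reductionDefect C θ hG (rot θ s v) (shiftCurve s p.1, p.2) =
      rot θ s (reductionDefect C θ hG v p) := by
  have hF : ⇑(reductionForce θ hG (rot θ s v) (shiftCurve s p.1, p.2)) =
      fun t => reductionForce θ hG v p (s + t) :=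
    funext (reductionForce_shift θ hG s v p)
  simp only [reductionDefect, hF]
  rw [modeProj_comp_add hC (reductionForce_add_one hC hG hv.2 hp), rot_add_vec, rot_smul]

theorem reductionDefect_apply_of_notMem {hG : LipschitzWith η G} (hv : v ∈ coordSphere C)
    {j : ι} (hj : j ∉ C) : reductionDefect C θ hG v p j = 0 := by
  simp [reductionDefect, hv.2 j hj, modeProj_apply_of_notMem θ _ hj]

theorem IsReducedPair.inner_reductionDefect {hG : LipschitzWith η G} (hv : v ∈ coordSphere C)
    (hp : IsReducedPair C θ H hG r v p) : ⟪reductionDefect C θ hG v p, v⟫ = 0 := by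
  have h1 : -(p.2.1 * p.2.2 + ⟪modeProj C θ (reductionForce θ hG v p), v⟫) = p.2.2 :=
    congrArg (fun q : ReductionSpace ι => q.2.2) hp.2
  rw [reductionDefect, inner_add_left, real_inner_smul_left, real_inner_self_eq_norm_sq, hv.1]
  linarith

/-- The velocity of the reduced curve is `diagI θ` applied to this curve. -/
noncomputable def reductionVelocity (C : Set ι) (θ : ι → ℝ)
    {G : EuclideanSpace ℂ ι → EuclideanSpace ℂ ι} (hG : LipschitzWith η G)
    (v : EuclideanSpace ℂ ι) (p : ReductionSpace ι) (t : ℝ) : EuclideanSpace ℂ ι :=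
  (1 + p.2.2) • (reductionCurve θ v p t + G (reductionCurve θ v p t)) -
    rot θ t (reductionDefect C θ hG v p)

theorem continuous_reductionVelocity (C : Set ι) (θ : ι → ℝ) (hG : LipschitzWith η G)
    (v : EuclideanSpace ℂ ι) (p : ReductionSpace ι) :
    Continuous (reductionVelocity C θ hG v p) := by
  have h1 := hG.continuous
  have h2 := continuous_rot θ (reductionDefect C θ hG v p)
  unfold reductionVelocity
  fun_prop

theorem IsReducedPair.coe_fst {hG : LipschitzWith η G} (hp : IsReducedPair C θ H hG r v p) :
    ⇑p.1 = green C θ (reductionForce θ hG v p) :=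
  funext fun t => (DFunLike.congr_fun (congrArg Prod.fst hp.2) t).symm

theorem IsReducedPair.hasDerivAt (hC : IsResonant C θ) {hG : LipschitzWith η G}
    (hv : v ∈ coordSphere C) (hp : IsReducedPair C θ H hG r v p) (t : ℝ) :
    HasDerivAt (reductionCurve θ v p) (diagI θ (reductionVelocity C θ hG v p t)) t := by
  have h1 := hasDerivAt_green_operator hC (reductionForce θ hG v p).continuous
    (reductionForce_add_one hC hG hv.2 hp.1) t
  rw [← hp.coe_fst] at h1
  refine (((hasDerivAt_rot θ v t).const_smul (1 + p.2.1)).add h1).congr_deriv ?_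
  rw [← map_smul, ← map_add]
  congr 1
  rw [reductionVelocity, reductionDefect, reductionForce_apply, reductionCurve_apply, rot_add_vec,
    rot_smul]
  module

theorem IsReducedPair.modeProj_fst {hG : LipschitzWith η G} (hp : IsReducedPair C θ H hG r v p) :
    modeProj C θ p.1 = 0 := by
  rw [hp.coe_fst]
  exact modeProj_green C θ (reductionForce θ hG v p).continuous

theorem IsReducedPair.modeProj_reductionCurve {hG : LipschitzWith η G} (hv : v ∈ coordSphere C)
    (hp : IsReducedPair C θ H hG r v p) : modeProj C θ (reductionCurve θ v p) =
      (1 + p.2.1) • v := by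
  have hrot := continuous_rot θ v
  have : ⇑(reductionCurve θ v p) = fun t => (1 + p.2.1) • rot θ t v + p.1 t := rfl
  rw [this, modeProj_add (u := fun t => (1 + p.2.1) • rot θ t v)
    (by fun_prop) p.1.continuous, modeProj_smul,
    modeProj_rot θ hv.2, hp.modeProj_fst, add_zero]

theorem IsReducedPair.integral_eq {hG : LipschitzWith η G} (hH : Continuous H)
    (hv : v ∈ coordSphere C) (hp : IsReducedPair C θ H hG r v p) :
    ∫ t in (0 : ℝ)..1, H (reductionCurve θ v p t) = 1 / 2 := by
  have h1 : -((p.2.1 ^ 2 + ∫ t in (0 : ℝ)..1, ‖p.1 t‖ ^ 2) / 2 + ∫ t in (0 : ℝ)..1,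
      (H (reductionCurve θ v p t) - ‖reductionCurve θ v p t‖ ^ 2 / 2)) = p.2.1 :=
    congrArg (fun q : ReductionSpace ι => q.2.1) hp.2
  have h2 : ∫ t in (0 : ℝ)..1, ⟪rot θ t v, p.1 t⟫ = 0 := by
    rw [← inner_modeProj θ hv.2 p.1.continuous, hp.modeProj_fst, inner_zero_right]
  have hrot := continuous_rot θ v
  have h3 : ∫ t in (0 : ℝ)..1, ‖reductionCurve θ v p t‖ ^ 2 / 2 =
      ((1 + p.2.1) ^ 2 + ∫ t in (0 : ℝ)..1, ‖p.1 t‖ ^ 2) / 2 := by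
    have e : ∀ t, ‖reductionCurve θ v p t‖ ^ 2 / 2 =
        (1 + p.2.1) ^ 2 / 2 + (1 + p.2.1) * ⟪rot θ t v, p.1 t⟫ + ‖p.1 t‖ ^ 2 / 2 := by
      intro t
      rw [reductionCurve_apply, norm_add_sq_real, norm_smul, norm_rot, hv.1, mul_one,
        Real.norm_eq_abs, sq_abs, real_inner_smul_left]
      ring
    simp only [e]
    rw [intervalIntegral.integral_add (Continuous.intervalIntegrable (by fun_prop) _ _)
      (Continuous.intervalIntegrable (by fun_prop) _ _),
      intervalIntegral.integral_add (Continuous.intervalIntegrable (by fun_prop) _ _)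
      (Continuous.intervalIntegrable (by fun_prop) _ _), intervalIntegral.integral_const_mul, h2,
      intervalIntegral.integral_div]
    simp
    ring
  rw [intervalIntegral.integral_sub (Continuous.intervalIntegrable (by fun_prop) _ _)
      (Continuous.intervalIntegrable (by fun_prop) _ _), h3] at h1
  linarith

end FixedPoint

section Action

variable {ι : Type*} [Fintype ι] {C : Set ι} {θ : ι → ℝ} {η : NNReal}
  {H : EuclideanSpace ℂ ι → ℝ} {G : EuclideanSpace ℂ ι → EuclideanSpace ℂ ι} {r : ℝ}
  {v v' : EuclideanSpace ℂ ι} {p p' : ReductionSpace ι}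

theorem diagI_inv_diagI {θ : ι → ℝ} (hθ : ∀ j, θ j ≠ 0) (x : EuclideanSpace ℂ ι) :
    diagI θ⁻¹ (diagI θ x) = -x := by
  ext j
  have : (θ j : ℂ) ≠ 0 := by exact_mod_cast hθ j
  simp only [diagI_apply, Pi.inv_apply, Complex.ofReal_inv, PiLp.neg_apply]
  field_simp
  simp

/-- Integration by parts for the symplectic action. -/
theorem integral_inner_comm_of_hasDerivAt {θ : ι → ℝ} (hθ : ∀ j, θ j ≠ 0)
    {x y x' y' : ℝ → EuclideanSpace ℂ ι} (hx : ∀ t, HasDerivAt x (diagI θ (x' t)) t)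
    (hy : ∀ t, HasDerivAt y (diagI θ (y' t)) t) (hx' : Continuous x') (hy' : Continuous y')
    (hx1 : x 1 = x 0) (hy1 : y 1 = y 0) :
    ∫ t in (0 : ℝ)..1, ⟪x' t, y t⟫ = ∫ t in (0 : ℝ)..1, ⟪x t, y' t⟫ := by
  have hcx : Continuous x := continuous_iff_continuousAt.2 fun t => (hx t).continuousAt
  have hcy : Continuous y := continuous_iff_continuousAt.2 fun t => (hy t).continuousAt
  have hd : ∀ t, HasDerivAt (fun t => ⟪diagI θ⁻¹ (x t), y t⟫) (⟪x t, y' t⟫ - ⟪x' t, y t⟫) t := by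
    intro t
    refine (HasDerivAt.inner ℝ ((diagI θ⁻¹).hasFDerivAt.comp_hasDerivAt t (hx t))
      (hy t)).congr_deriv ?_
    rw [diagI_inv_diagI hθ, Function.comp_apply, inner_diagI_left, diagI_inv_diagI hθ,
      inner_neg_right, inner_neg_left]
    ring
  have := intervalIntegral.integral_eq_sub_of_hasDerivAt (a := 0) (b := 1) (fun t _ => hd t)
    (Continuous.intervalIntegrable (by fun_prop) _ _)
  rw [hx1, hy1, sub_self, intervalIntegral.integral_sub
    (Continuous.intervalIntegrable (by fun_prop) _ _)
    (Continuous.intervalIntegrable (by fun_prop) _ _)] at this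
  linarith

/-- The symplectic action of the reduced curve. -/
noncomputable def reductionAction (C : Set ι) (θ : ι → ℝ)
    {G : EuclideanSpace ℂ ι → EuclideanSpace ℂ ι} (hG : LipschitzWith η G)
    (v : EuclideanSpace ℂ ι) (p : ReductionSpace ι) : ℝ :=
  (∫ t in (0 : ℝ)..1, ⟪reductionVelocity C θ hG v p t, reductionCurve θ v p t⟫) / 2

theorem norm_reductionDefect_le (h : IsPerturbation η H G)
    (hr : 16 * greenConst C θ * r ≤ 1) (hη : 24 * greenConst C θ * η ≤ r)
    (hv : v ∈ coordSphere C) (hp : p ∈ reductionBall ι r) :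
    ‖reductionDefect C θ h.lipschitz v p‖ ≤ 1 := by
  obtain ⟨h1, h2, h3⟩ := reductionBall.bounds hp
  have hr0 : 0 ≤ r := (abs_nonneg _).trans h2
  have hη0 : 0 ≤ (η : ℝ) := η.2
  have hK := one_le_greenConst C θ
  set K := greenConst C θ with hKdef
  have hr1 : 16 * r ≤ 1 := by nlinarith
  have hF := norm_modeProj_le_greenConst C θ (by positivity)
    (norm_reductionForce_le (θ := θ) h hp hv.1 (by linarith))
  have hKF : K * (r ^ 2 + 4 * (η : ℝ)) ≤ r / 4 := by nlinarith
  rw [reductionDefect]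
  refine (norm_add_le _ _).trans ?_
  rw [norm_smul, hv.1, mul_one, Real.norm_eq_abs, abs_mul]
  have h4 : |1 + p.2.1| ≤ 2 := (abs_add_le _ _).trans (by rw [abs_one]; linarith)
  have := mul_le_mul h3 h4 (abs_nonneg _) hr0
  linarith

theorem IsReducedPair.norm_reductionCurve_sub_le (h : IsPerturbation η H G)
    (hr : 16 * greenConst C θ * r ≤ 1) (hη : 24 * greenConst C θ * η ≤ r)
    (hv : v ∈ coordSphere C) (hv' : v' ∈ coordSphere C)
    (hp : IsReducedPair C θ H h.lipschitz r v p)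
    (hp' : IsReducedPair C θ H h.lipschitz r v' p') (t : ℝ) :
    ‖reductionCurve θ v' p' t - reductionCurve θ v p t‖ ≤ 10 * ‖v' - v‖ := by
  obtain ⟨-, h2, -⟩ := reductionBall.bounds hp.1
  have hK := one_le_greenConst C θ
  have hr0 : 0 ≤ r := (abs_nonneg _).trans h2
  have hr1 : 16 * r ≤ 1 := by nlinarith
  have h1 := norm_reductionCurve_sub_reductionCurve_le (θ := θ) (v' := v) (p := p') (p' := p)
    hv'.1 t
  have h3 := hp'.dist_le h hr hη hv' hv hp
  have h4 : |p.2.1| * ‖v' - v‖ ≤ 1 * ‖v' - v‖ :=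
    mul_le_mul_of_nonneg_right (by linarith) (norm_nonneg _)
  linarith

theorem IsReducedPair.norm_reductionDefect_sub_le (h : IsPerturbation η H G)
    (hr : 16 * greenConst C θ * r ≤ 1) (hη : 24 * greenConst C θ * η ≤ r)
    (hv : v ∈ coordSphere C) (hv' : v' ∈ coordSphere C)
    (hp : IsReducedPair C θ H h.lipschitz r v p)
    (hp' : IsReducedPair C θ H h.lipschitz r v' p') :
    ‖reductionDefect C θ h.lipschitz v' p' - reductionDefect C θ h.lipschitz v p‖ ≤
      16 * ‖v' - v‖ := by
  obtain ⟨h1, h2, h3⟩ := reductionBall.bounds hp.1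
  obtain ⟨h1', h2', h3'⟩ := reductionBall.bounds hp'.1
  obtain ⟨-, d2, d3⟩ := ReductionSpace.dist_bounds p' p
  have hd := hp'.dist_le h hr hη hv' hv hp
  have hr0 : 0 ≤ r := (abs_nonneg _).trans h2
  have hη0 : 0 ≤ (η : ℝ) := η.2
  have hK := one_le_greenConst C θ
  have hr1 : 16 * r ≤ 1 := by nlinarith
  have hη1 : 24 * (η : ℝ) ≤ r := by nlinarith
  set e := ‖v' - v‖ with he
  have he0 : 0 ≤ e := norm_nonneg _
  have hFF : ∀ t, ‖reductionForce θ h.lipschitz v' p' t - reductionForce θ h.lipschitz v p t‖ ≤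
      (2 * r + 6 * η) * (4 * e) + 4 * η * e := fun t =>
    (norm_reductionForce_sub_le (θ := θ) h hp'.1 hp.1 hv'.1 hv.1 (by linarith) t).trans (by gcongr)
  have hP := norm_modeProj_le_greenConst C θ (by positivity) hFF
  rw [modeProj_sub (BoundedContinuousFunction.continuous _)
    (BoundedContinuousFunction.continuous _)] at hP
  set K := greenConst C θ with hKdef
  have hKF : K * ((2 * r + 6 * (η : ℝ)) * (4 * e) + 4 * η * e) ≤ 2 * e := by
    have i1 : K * (2 * r + 6 * (η : ℝ)) ≤ 1 / 4 := by nlinarith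
    have i2 : K * (4 * (η : ℝ)) ≤ 1 := by nlinarith
    nlinarith [mul_le_mul_of_nonneg_right i1 he0, mul_le_mul_of_nonneg_right i2 he0]
  have e1 : reductionDefect C θ h.lipschitz v' p' - reductionDefect C θ h.lipschitz v p =
      ((p'.2.2 - p.2.2) * (1 + p'.2.1) + p.2.2 * (p'.2.1 - p.2.1)) • v' +
        (p.2.2 * (1 + p.2.1)) • (v' - v) + (modeProj C θ (reductionForce θ h.lipschitz v' p') -
        modeProj C θ (reductionForce θ h.lipschitz v p)) := by
    rw [reductionDefect, reductionDefect]; module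
  rw [e1]
  refine norm_add₃_le.trans ?_
  rw [norm_smul, norm_smul, hv'.1, mul_one, Real.norm_eq_abs, Real.norm_eq_abs, abs_mul]
  have h4 : |1 + p.2.1| ≤ 2 := (abs_add_le _ _).trans (by rw [abs_one]; linarith)
  have h4' : |1 + p'.2.1| ≤ 2 := (abs_add_le _ _).trans (by rw [abs_one]; linarith)
  have j1 : |(p'.2.2 - p.2.2) * (1 + p'.2.1) + p.2.2 * (p'.2.1 - p.2.1)| ≤
      4 * e * 2 + 1 * (4 * e) := by
    refine (abs_add_le _ _).trans ?_
    rw [abs_mul, abs_mul]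
    exact add_le_add (mul_le_mul (d3.trans hd) h4' (abs_nonneg _) (by positivity))
      (mul_le_mul (by linarith) (d2.trans hd) (abs_nonneg _) zero_le_one)
  have j2 : |p.2.2| * |1 + p.2.1| ≤ 1 * 2 :=
    mul_le_mul (by linarith) h4 (abs_nonneg _) zero_le_one
  have j3 := mul_le_mul_of_nonneg_right j2 he0
  linarith

theorem IsReducedPair.norm_reductionVelocity_sub_le (h : IsPerturbation η H G)
    (hr : 16 * greenConst C θ * r ≤ 1) (hη : 24 * greenConst C θ * η ≤ r)
    (hv : v ∈ coordSphere C) (hv' : v' ∈ coordSphere C)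
    (hp : IsReducedPair C θ H h.lipschitz r v p)
    (hp' : IsReducedPair C θ H h.lipschitz r v' p') (t : ℝ) :
    ‖reductionVelocity C θ h.lipschitz v' p' t - reductionVelocity C θ h.lipschitz v p t‖ ≤
      72 * ‖v' - v‖ := by
  obtain ⟨h1, h2, h3⟩ := reductionBall.bounds hp.1
  obtain ⟨-, d2, d3⟩ := ReductionSpace.dist_bounds p' p
  have hd := hp'.dist_le h hr hη hv' hv hp
  have hc := hp.norm_reductionDefect_sub_le h hr hη hv hv' hp'
  have hδ := hp.norm_reductionCurve_sub_le h hr hη hv hv' hp' t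
  have hr0 : 0 ≤ r := (abs_nonneg _).trans h2
  have hη0 : 0 ≤ (η : ℝ) := η.2
  have hK := one_le_greenConst C θ
  have hr1 : 16 * r ≤ 1 := by nlinarith
  have hη1 : 24 * (η : ℝ) ≤ r := by nlinarith
  have hy' := norm_reductionCurve_le (θ := θ) hp'.1 hv'.1 (by linarith) t
  have hG' := h.norm_le (reductionCurve θ v' p' t)
  have hG := h.lipschitz.norm_sub_le (reductionCurve θ v' p' t) (reductionCurve θ v p t)
  set y' := reductionCurve θ v' p' t with hydef'
  set y := reductionCurve θ v p t with hydef
  set e := ‖v' - v‖ with he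
  have he0 : 0 ≤ e := norm_nonneg _
  have e1 : reductionVelocity C θ h.lipschitz v' p' t - reductionVelocity C θ h.lipschitz v p t =
      (p'.2.2 - p.2.2) • (y' + G y') + (1 + p.2.2) • ((y' - y) + (G y' - G y)) +
        (-rot θ t (reductionDefect C θ h.lipschitz v' p' -
          reductionDefect C θ h.lipschitz v p)) := by
    rw [reductionVelocity, reductionVelocity, rot_sub]; module
  rw [e1]
  refine norm_add₃_le.trans ?_
  rw [norm_smul, norm_smul, norm_neg, norm_rot, Real.norm_eq_abs, Real.norm_eq_abs]
  have h4 : |1 + p.2.2| ≤ 2 := (abs_add_le _ _).trans (by rw [abs_one]; linarith)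
  have j1 : ‖y' + G y'‖ ≤ 4 := (norm_add_le _ _).trans (by nlinarith)
  have j2 : ‖(y' - y) + (G y' - G y)‖ ≤ 20 * e :=
    (norm_add_le _ _).trans (by nlinarith [norm_nonneg (y' - y)])
  have i1 := mul_le_mul (d3.trans hd) j1 (norm_nonneg _) (by positivity)
  have i2 := mul_le_mul h4 j2 (norm_nonneg _) zero_le_two
  linarith

theorem IsReducedPair.reductionAction_sub_le (hC : IsResonant C θ) (hθ : ∀ j, θ j ≠ 0)
    (h : IsPerturbation η H G)
    (hr : 16 * greenConst C θ * r ≤ 1) (hη : 24 * greenConst C θ * η ≤ r)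
    (hv : v ∈ coordSphere C) (hv' : v' ∈ coordSphere C)
    (hp : IsReducedPair C θ H h.lipschitz r v p)
    (hp' : IsReducedPair C θ H h.lipschitz r v' p') :
    reductionAction C θ h.lipschitz v' p' - reductionAction C θ h.lipschitz v p ≤
      -((1 + p'.2.1) * ⟪reductionDefect C θ h.lipschitz v p, v'⟫) + 1000 * ‖v' - v‖ ^ 2 := by
  obtain ⟨h1, h2, h3⟩ := reductionBall.bounds hp.1
  have hr0 : 0 ≤ r := (abs_nonneg _).trans h2
  have hη0 : 0 ≤ (η : ℝ) := η.2
  have hK := one_le_greenConst C θ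
  have hr1 : 16 * r ≤ 1 := by nlinarith
  have hη1 : 24 * (η : ℝ) ≤ r := by nlinarith
  have hη2 : η ≤ 1 := by
    rw [← NNReal.coe_le_coe]; push_cast; linarith
  set y := reductionCurve θ v p with hydef
  set y' := reductionCurve θ v' p' with hydef'
  set D := reductionVelocity C θ h.lipschitz v p with hDdef
  set D' := reductionVelocity C θ h.lipschitz v' p' with hDdef'
  set c := reductionDefect C θ h.lipschitz v p with hcdef
  set e := ‖v' - v‖ with he
  have he0 : 0 ≤ e := norm_nonneg _
  have hδ : ∀ t, ‖y' t - y t‖ ≤ 10 * e := hp.norm_reductionCurve_sub_le h hr hη hv hv' hp'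
  have hDD : ∀ t, ‖D' t - D t‖ ≤ 72 * e := hp.norm_reductionVelocity_sub_le h hr hη hv hv' hp'
  have hy : ∀ t, ‖y t‖ ≤ 2 := norm_reductionCurve_le hp.1 hv.1 (by linarith)
  have hy' : ∀ t, ‖y' t‖ ≤ 2 := norm_reductionCurve_le hp'.1 hv'.1 (by linarith)
  have cD : Continuous D := continuous_reductionVelocity C θ h.lipschitz v p
  have cD' : Continuous D' := continuous_reductionVelocity C θ h.lipschitz v' p'
  have cH := h.continuous
  have cG := h.lipschitz.continuous
  have crot := continuous_rot θ c
  have hy1 : y 1 = y 0 := by simpa using reductionCurve_add_one hC hv.2 hp.1 0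
  have hy1' : y' 1 = y' 0 := by simpa using reductionCurve_add_one hC hv'.2 hp'.1 0
  have hsymm : ∫ t in (0 : ℝ)..1, ⟪D' t, y t⟫ = ∫ t in (0 : ℝ)..1, ⟪D t, y' t⟫ := by
    rw [integral_inner_comm_of_hasDerivAt hθ (hp'.hasDerivAt hC hv') (hp.hasDerivAt hC hv)
      cD' cD hy1' hy1]
    exact intervalIntegral.integral_congr fun t _ => real_inner_comm _ _
  have hfint : ∀ f : ℝ → ℝ, Continuous f → IntervalIntegrable f MeasureTheory.volume 0 1 :=
    fun f hf => hf.intervalIntegrable _ _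
  have e1 : reductionAction C θ h.lipschitz v' p' - reductionAction C θ h.lipschitz v p =
      (∫ t in (0 : ℝ)..1, ⟪D t, y' t - y t⟫) +
        (∫ t in (0 : ℝ)..1, ⟪D' t - D t, y' t - y t⟫) / 2 := by
    simp only [reductionAction, inner_sub_left, inner_sub_right]
    rw [intervalIntegral.integral_sub (hfint _ (by fun_prop)) (hfint _ (by fun_prop)),
      intervalIntegral.integral_sub (hfint _ (by fun_prop)) (hfint _ (by fun_prop)),
      intervalIntegral.integral_sub (hfint _ (by fun_prop)) (hfint _ (by fun_prop)),
      intervalIntegral.integral_sub (hfint _ (by fun_prop)) (hfint _ (by fun_prop)), hsymm]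
    ring
  have e2 : ∫ t in (0 : ℝ)..1, ⟪D t, y' t - y t⟫ =
      (1 + p.2.2) * (∫ t in (0 : ℝ)..1, ⟪y t + G (y t), y' t - y t⟫) -
        (1 + p'.2.1) * ⟪c, v'⟫ := by
    have hm : modeProj C θ (fun t => y' t - y t) = (1 + p'.2.1) • v' - (1 + p.2.1) • v := by
      rw [modeProj_sub y'.continuous y.continuous, hp'.modeProj_reductionCurve hv',
        hp.modeProj_reductionCurve hv]
    have hm' := inner_modeProj θ (c := c) (fun j hj => reductionDefect_apply_of_notMem hv hj)
      (u := fun t => y' t - y t) (by fun_prop)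
    rw [hm, inner_sub_right, real_inner_smul_right, real_inner_smul_right,
      hp.inner_reductionDefect hv] at hm'
    have : ∀ t, ⟪D t, y' t - y t⟫ = (1 + p.2.2) * ⟪y t + G (y t), y' t - y t⟫ -
        ⟪rot θ t c, y' t - y t⟫ := fun t => by
      rw [hDdef, reductionVelocity, inner_sub_left, real_inner_smul_left]
    simp only [this]
    rw [intervalIntegral.integral_sub (hfint _ (by fun_prop)) (hfint _ (by fun_prop)),
      intervalIntegral.integral_const_mul, ← hm']
    ring
  have b1 : |∫ t in (0 : ℝ)..1, ⟪D' t - D t, y' t - y t⟫| ≤ 72 * e * (10 * e) :=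
    abs_integral_le fun t => (abs_real_inner_le_norm _ _).trans
      (mul_le_mul (hDD t) (hδ t) (norm_nonneg _) (by positivity))
  have b2 : |∫ t in (0 : ℝ)..1, ⟪y t + G (y t), y' t - y t⟫| ≤ 2 * (10 * e) ^ 2 := by
    have hE : ∫ t in (0 : ℝ)..1, (H (y' t) - H (y t)) = 0 := by
      rw [intervalIntegral.integral_sub (hfint _ (by fun_prop)) (hfint _ (by fun_prop)),
        hp.integral_eq h.continuous hv, hp'.integral_eq h.continuous hv', sub_self]
    have := abs_integral_sub_integral_le (f := fun t => H (y' t) - H (y t))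
      (g := fun t => ⟪y t + G (y t), y' t - y t⟫) (M := 2 * (10 * e) ^ 2) (by fun_prop)
      (by fun_prop) fun t => (h.abs_sub_sub_inner_le hη2 (hy t) (hy' t)).trans (by
        have := hδ t
        gcongr)
    rwa [hE, zero_sub, abs_neg] at this
  have h4 : |1 + p.2.2| ≤ 2 := (abs_add_le _ _).trans (by rw [abs_one]; linarith)
  have b3 : (1 + p.2.2) * (∫ t in (0 : ℝ)..1, ⟪y t + G (y t), y' t - y t⟫) ≤
      2 * (2 * (10 * e) ^ 2) := by
    refine (le_abs_self _).trans ?_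
    rw [abs_mul]
    exact mul_le_mul h4 b2 (abs_nonneg _) zero_le_two
  rw [e1, e2]
  have := (abs_le.1 b1).2
  nlinarith [sq_nonneg e]

end Action

section Family

variable {ι : Type*} [Fintype ι] {C : Set ι} {θ : ι → ℝ} {η : NNReal}
  {H : EuclideanSpace ℂ ι → ℝ} {G : EuclideanSpace ℂ ι → EuclideanSpace ℂ ι} {r : ℝ}

theorem norm_normalize_sub_le {E : Type*} [NormedAddCommGroup E] [InnerProductSpace ℝ E] {v c : E}
    (hv : ‖v‖ = 1) (hw : v + c ≠ 0) : ‖‖v + c‖⁻¹ • (v + c) - v‖ ≤ 2 * ‖c‖ := by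
  have h0 : ‖v + c‖ ≠ 0 := norm_ne_zero_iff.2 hw
  have e : ‖v + c‖⁻¹ • (v + c) - v = (1 - ‖v + c‖) • (‖v + c‖⁻¹ • (v + c)) + c := by
    rw [sub_smul, smul_smul ‖v + c‖, mul_inv_cancel₀ h0]; module
  have h1 : ‖‖v + c‖⁻¹ • (v + c)‖ = 1 := by
    rw [norm_smul, norm_inv, norm_norm, inv_mul_cancel₀ h0]
  have h2 : |1 - ‖v + c‖| ≤ ‖c‖ := by
    rw [← hv]; simpa using abs_norm_sub_norm_le v (v + c)
  rw [e]
  refine (norm_add_le _ _).trans ?_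
  rw [norm_smul, h1, mul_one, Real.norm_eq_abs]
  linarith

theorem exists_family_isReducedPair (hC : IsResonant C θ) (hθ : ∀ j, 0 < θ j)
    (h : IsPerturbation η H G) (hr0 : 0 ≤ r)
    (hr : 16 * greenConst C θ * r ≤ 1) (hη : 24 * greenConst C θ * η ≤ r) :
    ∃ (z : C → EuclideanSpace ℂ ι) (p : C → ReductionSpace ι),
      (∀ j, z j ∈ coordSphere C ∧ IsReducedPair C θ H h.lipschitz r (z j) (p j) ∧
        reductionDefect C θ h.lipschitz (z j) (p j) = 0) ∧
      ∀ i j, i ≠ j → ∀ t, z i ≠ rot θ t (z j) := by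
  have hex : ∀ v, ∃ p, v ∈ coordSphere C → IsReducedPair C θ H h.lipschitz r v p := fun v => by
    by_cases hv : v ∈ coordSphere C
    · obtain ⟨p, hp⟩ := exists_isReducedPair hC h hr0 hr hη hv
      exact ⟨p, fun _ => hp⟩
    · exact ⟨0, fun hv' => absurd hv' hv⟩
  choose P hP using hex
  have hK := one_le_greenConst C θ
  have hr1 : 16 * r ≤ 1 := by nlinarith
  set c : EuclideanSpace ℂ ι → EuclideanSpace ℂ ι :=
    fun v => reductionDefect C θ h.lipschitz v (P v) with hc
  set g : EuclideanSpace ℂ ι → ℝ := fun v => reductionAction C θ h.lipschitz v (P v) with hg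
  have hcn : ∀ v ∈ coordSphere C, ‖c v‖ ≤ 1 := fun v hv =>
    norm_reductionDefect_le h hr hη hv (hP v hv).1
  have hci : ∀ v ∈ coordSphere C, ⟪c v, v⟫ = 0 := fun v hv => (hP v hv).inner_reductionDefect hv
  have hgle : ∀ v ∈ coordSphere C, ∀ v' ∈ coordSphere C, g v' - g v ≤
      -((1 + (P v').2.1) * ⟪c v, v'⟫) + 1000 * ‖v' - v‖ ^ 2 := fun v hv v' hv' =>
    (hP v hv).reductionAction_sub_le hC (fun j => (hθ j).ne') h hr hη hv hv' (hP v' hv')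
  have hρ : ∀ v ∈ coordSphere C, 1 / 2 ≤ 1 + (P v).2.1 ∧ 1 + (P v).2.1 ≤ 2 := fun v hv => by
    have := abs_le.1 (reductionBall.bounds (hP v hv).1).2.1
    constructor <;> linarith
  have hshift : ∀ t, ∀ v ∈ coordSphere C, P (rot θ t v) = (shiftCurve t (P v).1, (P v).2) := by
    intro t v hv
    have hv' := rot_mem_coordSphere θ t hv
    have := (hP _ hv').dist_le h hr hη hv' hv' ((hP v hv).shift hC hv t)
    rw [sub_self, norm_zero, mul_zero] at this
    exact dist_le_zero.1 this
  have hceq : ∀ t, ∀ v ∈ coordSphere C, c (rot θ t v) = rot θ t (c v) := fun t v hv => by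
    simp only [hc]
    rw [hshift t v hv, reductionDefect_shift hC h.lipschitz hv (hP v hv).1]
  have hgeq : ∀ t, ∀ v ∈ coordSphere C, g (rot θ t v) = g v := fun t v hv => by
    have hvel : ∀ s, reductionVelocity C θ h.lipschitz (rot θ t v) (P (rot θ t v)) s =
        reductionVelocity C θ h.lipschitz v (P v) (t + s) := fun s => by
      rw [hshift t v hv, reductionVelocity, reductionCurve_shift,
        reductionDefect_shift hC h.lipschitz hv (hP v hv).1, ← rot_add, add_comm s t,
        reductionVelocity]
    simp only [hg, reductionAction, hvel]
    congr 1
    rw [hshift t v hv]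
    simp only [reductionCurve_shift]
    refine integral_comp_add_of_periodic (f := fun s => ⟪reductionVelocity C θ h.lipschitz
      v (P v) s,
      reductionCurve θ v (P v) s⟫) (fun s => ?_) t
    have h1 := reductionCurve_add_one hC hv.2 (hP v hv).1 s
    simp only [reductionVelocity, h1]
    rw [rot_add_one hC fun j hj => reductionDefect_apply_of_notMem hv hj]
  have hccont : ContinuousOn c (coordSphere C) := by
    refine (LipschitzOnWith.of_dist_le_mul (K := 16) fun v hv v' hv' => ?_).continuousOn
    rw [dist_eq_norm, dist_eq_norm]
    exact (hP v' hv').norm_reductionDefect_sub_le h hr hη hv' hv (hP v hv)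
  have hgcont : ContinuousOn g (coordSphere C) := by
    refine (LipschitzOnWith.of_dist_le_mul (K := 3000) fun v hv v' hv' => ?_).continuousOn
    have key : ∀ v ∈ coordSphere C, ∀ v' ∈ coordSphere C, g v' - g v ≤ 3000 * ‖v' - v‖ := by
      intro v hv v' hv'
      have i1 := hgle v hv v' hv'
      have i2 : |⟪c v, v' - v⟫| ≤ 1 * ‖v' - v‖ := (abs_real_inner_le_norm _ _).trans
        (mul_le_mul_of_nonneg_right (hcn v hv) (norm_nonneg _))
      rw [inner_sub_right, hci v hv, sub_zero, one_mul] at i2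
      have i3 : ‖v' - v‖ ≤ 2 := (norm_sub_le _ _).trans (by rw [hv.1, hv'.1]; norm_num)
      have i4 := (abs_le.1 i2).1
      obtain ⟨i5, i6⟩ := hρ v' hv'
      nlinarith [norm_nonneg (v' - v)]
    rw [dist_eq_norm v v', Real.dist_eq, abs_le]
    have k1 := key v hv v' hv'
    have k2 := key v' hv' v hv
    rw [norm_sub_rev v' v] at k1
    push_cast
    constructor <;> linarith
  obtain ⟨σ, hσ⟩ : ∃ σ : ℝ, σ = 1 / 20000 := ⟨_, rfl⟩
  have hσ0 : 0 ≤ σ := by rw [hσ]; norm_num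
  have hne : ∀ v ∈ coordSphere C, v + σ • c v ≠ 0 := fun v hv h0 => by
    have : ⟪v + σ • c v, v⟫ = 1 := by
      rw [inner_add_left, real_inner_smul_left, hci v hv, real_inner_self_eq_norm_sq, hv.1]; simp
    rw [h0, inner_zero_left] at this
    exact zero_ne_one this
  set φ : EuclideanSpace ℂ ι → EuclideanSpace ℂ ι :=
    fun v => ‖v + σ • c v‖⁻¹ • (v + σ • c v) with hφ
  have hφS : Set.MapsTo φ (coordSphere C) (coordSphere C) := fun v hv => by
    refine ⟨?_, fun j hj => ?_⟩
    · rw [hφ, norm_smul, norm_inv, norm_norm, inv_mul_cancel₀ (norm_ne_zero_iff.2 (hne v hv))]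
    · simp [hφ, hc, hv.2 j hj, reductionDefect_apply_of_notMem hv hj]
  have hdec : ∀ v ∈ coordSphere C, g (φ v) - g v ≤ -(σ * ‖c v‖ ^ 2 / 20) := by
    intro v hv
    have i1 := hgle v hv (φ v) (hφS hv)
    have i2 : ‖φ v - v‖ ≤ 2 * (σ * ‖c v‖) := by
      refine (norm_normalize_sub_le hv.1 (hne v hv)).trans_eq ?_
      rw [norm_smul, Real.norm_of_nonneg (by positivity)]
    have i3 : σ * ‖c v‖ ^ 2 / 2 ≤ ⟪c v, φ v⟫ := by
      rw [hφ, real_inner_smul_right, inner_add_right, hci v hv, real_inner_smul_right,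
        real_inner_self_eq_norm_sq, zero_add]
      have n0 : 0 < ‖v + σ • c v‖ := norm_pos_iff.2 (hne v hv)
      have n1 : ‖v + σ • c v‖ ≤ 2 := by
        refine (norm_add_le _ _).trans ?_
        rw [norm_smul, Real.norm_of_nonneg (by positivity), hv.1]
        have := hcn v hv
        norm_num [hσ]
        linarith
      have n2 : 2⁻¹ ≤ ‖v + σ • c v‖⁻¹ := inv_anti₀ n0 n1
      have := mul_le_mul_of_nonneg_right n2 (show 0 ≤ σ * ‖c v‖ ^ 2 by positivity)
      linarith
    obtain ⟨i5, i6⟩ := hρ _ (hφS hv)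
    have i7 : ‖φ v - v‖ ^ 2 ≤ (2 * (σ * ‖c v‖)) ^ 2 := by gcongr
    have i8 : 1 / 2 * (σ * ‖c v‖ ^ 2 / 2) ≤ (1 + (P (φ v)).2.1) * ⟪c v, φ v⟫ :=
      mul_le_mul i5 i3 (by positivity) (by linarith)
    have i9 : (2 * (σ * ‖c v‖)) ^ 2 = σ * ‖c v‖ ^ 2 / 5000 := by rw [hσ]; ring
    rw [i9] at i7
    linarith only [i1, i7, i8]
  have hφcont : ContinuousOn φ (coordSphere C) := by
    have : ContinuousOn (fun v => v + σ • c v) (coordSphere C) :=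
      continuousOn_id.add (hccont.const_smul σ)
    exact (this.norm.inv₀ fun v hv => norm_ne_zero_iff.2 (hne v hv)).smul this
  have hφeq : ∀ t, ∀ v ∈ coordSphere C, φ (rot θ t v) = rot θ t (φ v) := by
    intro t v hv
    simp only [hφ]
    rw [hceq t v hv, ← rot_smul, ← rot_add_vec, norm_rot, rot_smul]
  have hle : ∀ v ∈ coordSphere C, g (φ v) ≤ g v := by
    intro v hv
    have := hdec v hv
    have : 0 ≤ σ * ‖c v‖ ^ 2 / 20 := by positivity
    linarith
  have hlt : ∀ v ∈ coordSphere C, v ∉ {v | c v = 0} → g (φ v) < g v := by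
    intro v hv hvZ
    have := hdec v hv
    have hcv : 0 < ‖c v‖ := norm_pos_iff.2 hvZ
    have : 0 < σ * ‖c v‖ ^ 2 / 20 := by rw [hσ]; positivity
    linarith
  obtain ⟨z, hz, hzz⟩ := exists_family_of_equivariant_descent (fun j _ => hθ j) hφS hφcont hφeq
    hgcont hgeq hle hlt
  exact ⟨z, fun j => P (z j), fun j => ⟨(hz j).1, hP _ (hz j).1, (hz j).2⟩, hzz⟩

end Family

section Orbits

variable {ι : Type*} [Fintype ι] {C : Set ι} {θ : ι → ℝ} {η : NNReal}
  {H : EuclideanSpace ℂ ι → ℝ} {G : EuclideanSpace ℂ ι → EuclideanSpace ℂ ι} {r : ℝ}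
  {v v' : EuclideanSpace ℂ ι} {p p' : ReductionSpace ι}

theorem lipschitzWith_diagI_add (θ : ι → ℝ) (hG : LipschitzWith η G) :
    ∃ K, LipschitzWith K fun z => diagI θ (z + G z) :=
  ⟨_, (diagI θ).lipschitz.comp (LipschitzWith.id.add hG)⟩

theorem eq_of_hasDerivAt_diagI (hG : LipschitzWith η G) {x y : ℝ → EuclideanSpace ℂ ι}
    (hx : ∀ t, HasDerivAt x (diagI θ (x t + G (x t))) t)
    (hy : ∀ t, HasDerivAt y (diagI θ (y t + G (y t))) t) (h0 : x 0 = y 0) : x = y := by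
  obtain ⟨K, hK⟩ := lipschitzWith_diagI_add θ hG
  exact ODE_solution_unique_univ (v := fun _ z => diagI θ (z + G z)) (s := fun _ => Set.univ)
    (fun t => hK.lipschitzOnWith) (fun t => ⟨hx t, trivial⟩) (fun t => ⟨hy t, trivial⟩) h0

theorem eq_one_of_exp_eq_one {θ q : ℝ} (hθ : 0 < θ) (h1 : Complex.exp (θ * Complex.I) = 1)
    (hq : Complex.exp ((θ * q : ℝ) * Complex.I) = 1) (hlt : θ * |q - 1| < 2 * Real.pi) : q = 1 := by
  obtain ⟨n, hn⟩ := Complex.exp_eq_one_iff.1 h1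
  obtain ⟨m, hm⟩ := Complex.exp_eq_one_iff.1 hq
  have hn' : θ = n * (2 * Real.pi) := by
    have := congrArg Complex.im hn
    simpa using this
  have hm' : θ * q = m * (2 * Real.pi) := by
    have := congrArg Complex.im hm
    simpa using this
  have e : θ * (q - 1) = ((m - n : ℤ) : ℝ) * (2 * Real.pi) := by
    push_cast
    linarith
  have h2 : |((m - n : ℤ) : ℝ)| * (2 * Real.pi) < 1 * (2 * Real.pi) := by
    rw [one_mul]
    calc |((m - n : ℤ) : ℝ)| * (2 * Real.pi) = |θ * (q - 1)| := by
          rw [e, abs_mul, abs_of_pos Real.two_pi_pos]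
      _ < 2 * Real.pi := by rwa [abs_mul, abs_of_pos hθ]
  have h3 : |m - n| < 1 := by
    have := lt_of_mul_lt_mul_right h2 Real.two_pi_pos.le
    exact_mod_cast this
  rw [Int.abs_lt_one_iff.1 h3, Int.cast_zero, zero_mul] at e
  have := (mul_eq_zero.1 e).resolve_left hθ.ne'
  linarith

/-- The reduced curve, parametrised by the time of the Hamiltonian flow. -/
noncomputable def reductionOrbit (θ : ι → ℝ) (v : EuclideanSpace ℂ ι) (p : ReductionSpace ι)
    (t : ℝ) : EuclideanSpace ℂ ι :=
  reductionCurve θ v p ((1 + p.2.2)⁻¹ * t)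

theorem IsReducedPair.hasDerivAt_reductionOrbit (hC : IsResonant C θ) {hG : LipschitzWith η G}
    (hv : v ∈ coordSphere C) (hp : IsReducedPair C θ H hG r v p)
    (hc : reductionDefect C θ hG v p = 0) (hb : 1 + p.2.2 ≠ 0) (t : ℝ) :
    HasDerivAt (reductionOrbit θ v p)
      (diagI θ (reductionOrbit θ v p t + G (reductionOrbit θ v p t))) t := by
  have h1 := (hp.hasDerivAt hC hv ((1 + p.2.2)⁻¹ * t)).scomp t
    ((hasDerivAt_id t).const_mul (1 + p.2.2)⁻¹)
  refine h1.congr_deriv ?_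
  have h0 : ∀ s, rot θ s (0 : EuclideanSpace ℂ ι) = 0 := fun s => by ext j; simp
  rw [reductionVelocity, hc, h0, sub_zero, map_smul, smul_smul, mul_one, inv_mul_cancel₀ hb,
    one_smul]
  rfl

theorem IsReducedPair.apply_reductionOrbit_eq (hC : IsResonant C θ) (h : IsPerturbation η H G)
    (hv : v ∈ coordSphere C) (hp : IsReducedPair C θ H h.lipschitz r v p) (hr : r ≤ 1 / 2)
    (hc : reductionDefect C θ h.lipschitz v p = 0) (t : ℝ) :
    H (reductionOrbit θ v p t) = 1 / 2 := by
  have hd : ∀ s, HasDerivAt (fun s => H (reductionCurve θ v p s)) 0 s := by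
    intro s
    have h1 := (h.hasGradientAt _ (norm_reductionCurve_le (θ := θ) hp.1 hv.1 hr s)).hasFDerivAt
    refine (h1.comp_hasDerivAt s (hp.hasDerivAt hC hv s)).congr_deriv ?_
    have h0 : rot θ s (0 : EuclideanSpace ℂ ι) = 0 := by ext j; simp
    rw [reductionVelocity, hc, h0, sub_zero, map_smul]
    have h2 := inner_diagI_left θ (reductionCurve θ v p s + G (reductionCurve θ v p s))
      (reductionCurve θ v p s + G (reductionCurve θ v p s))
    rw [real_inner_comm] at h2
    simp only [InnerProductSpace.toDual_apply_apply, real_inner_smul_right]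
    have h3 : ⟪reductionCurve θ v p s + G (reductionCurve θ v p s),
      diagI θ (reductionCurve θ v p s + G (reductionCurve θ v p s))⟫ = 0 := by linarith
    rw [h3, mul_zero]
  have hconst : ∀ s s', H (reductionCurve θ v p s) = H (reductionCurve θ v p s') :=
    is_const_of_deriv_eq_zero (fun s => (hd s).differentiableAt) fun s => (hd s).deriv
  have := hp.integral_eq h.continuous hv
  rw [intervalIntegral.integral_congr fun s _ => hconst s ((1 + p.2.2)⁻¹ * t)] at this
  simpa [reductionOrbit] using this

theorem IsReducedPair.eq_rot_of_range_eq (hC : IsResonant C θ) (hθ : ∀ j, 0 < θ j)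
    (h : IsPerturbation η H G) (hr : 16 * r ≤ 1) (hrθ : ∀ j, θ j * r ≤ 1)
    (hv : v ∈ coordSphere C) (hp : IsReducedPair C θ H h.lipschitz r v p)
    (hc : reductionDefect C θ h.lipschitz v p = 0)
    (hv' : v' ∈ coordSphere C) (hp' : IsReducedPair C θ H h.lipschitz r v' p')
    (hc' : reductionDefect C θ h.lipschitz v' p' = 0)
    (hrange : Set.range (reductionOrbit θ v p) = Set.range (reductionOrbit θ v' p')) :
    ∃ s, v' = rot θ s v := by
  obtain ⟨-, h2, h3⟩ := reductionBall.bounds hp.1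
  obtain ⟨-, h2', h3'⟩ := reductionBall.bounds hp'.1
  rw [abs_le] at h2 h3 h2' h3'
  set l := 1 + p.2.2 with hl
  set l' := 1 + p'.2.2 with hl'
  have hl0 : 1 / 2 ≤ l := by linarith
  have hl0' : 1 / 2 ≤ l' := by linarith
  have hlne : l ≠ 0 := by linarith
  have hlne' : l' ≠ 0 := by linarith
  obtain ⟨t₀, ht₀⟩ : reductionOrbit θ v' p' 0 ∈ Set.range (reductionOrbit θ v p) :=
    hrange ▸ Set.mem_range_self 0
  have heq : reductionOrbit θ v' p' = fun t => reductionOrbit θ v p (t + t₀) := by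
    refine eq_of_hasDerivAt_diagI h.lipschitz (hp'.hasDerivAt_reductionOrbit hC hv' hc' hlne')
      (fun t => ?_) (by simp [ht₀])
    exact (hp.hasDerivAt_reductionOrbit hC hv hc hlne (t + t₀)).comp_add_const t t₀
  have heq' : ∀ t, reductionCurve θ v' p' t = reductionCurve θ v p (l⁻¹ * (l' * t + t₀)) := by
    intro t
    have := congrFun heq (l' * t)
    simpa only [reductionOrbit, ← hl', ← hl, inv_mul_cancel_left₀ hlne'] using this
  have hper := reductionCurve_add_one hC hv.2 hp.1
  have hper' := reductionCurve_add_one hC hv'.2 hp'.1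
  have hq : ∀ t, reductionCurve θ v p (l' / l + t) = reductionCurve θ v p t := by
    intro t
    have h1 := hper' ((l * t - t₀) / l')
    rw [heq', heq'] at h1
    convert h1 using 2 <;> field_simp <;> ring
  have hρ0 : 0 < 1 + p.2.1 := by linarith
  have hq1 : l' / l = 1 := by
    obtain ⟨j, hj⟩ : ∃ j, v j ≠ 0 := by
      by_contra! hall
      have : v = 0 := by ext j; exact hall j
      have h1 := hv.1
      simp [this] at h1
    have hjC : j ∈ C := by_contra fun hjC => hj (hv.2 j hjC)
    have h1 := modeProj_comp_add hC hper (l' / l)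
    simp only [hq] at h1
    rw [hp.modeProj_reductionCurve hv, rot_smul] at h1
    have h4 := congrArg (fun x : EuclideanSpace ℂ ι => x j) (smul_right_injective _ hρ0.ne' h1)
    simp only [rot_apply] at h4
    refine eq_one_of_exp_eq_one (hθ j) ((hC j).2 hjC)
      (mul_right_cancel₀ hj (by rw [one_mul]; exact h4.symm)) ?_
    have h5 : |l' / l - 1| ≤ 4 * r := by
      rw [div_sub_one hlne, abs_div, div_le_iff₀ (abs_pos.2 hlne), abs_of_pos (by linarith : 0 < l)]
      have : |l' - l| ≤ 2 * r := by rw [abs_le]; constructor <;> linarith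
      have hr0 : 0 ≤ r := by linarith
      nlinarith
    have h6 := mul_le_mul_of_nonneg_left h5 (hθ j).le
    have h7 := hrθ j
    have h8 := Real.pi_gt_three
    linarith
  have hll : l' = l := by rwa [div_eq_one_iff_eq hlne] at hq1
  refine ⟨l⁻¹ * t₀, ?_⟩
  have heq2 : ⇑(reductionCurve θ v' p') = fun t => reductionCurve θ v p (l⁻¹ * t₀ + t) := by
    funext t
    rw [heq', hll, mul_add, inv_mul_cancel_left₀ hlne, add_comm]
  have h1 := modeProj_comp_add hC hper (l⁻¹ * t₀)
  rw [← heq2, hp.modeProj_reductionCurve hv, hp'.modeProj_reductionCurve hv', rot_smul] at h1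
  have hρ0' : 0 < 1 + p'.2.1 := by linarith
  have h4 := congrArg norm h1
  rw [norm_smul, norm_smul, norm_rot, hv.1, hv'.1, mul_one, mul_one,
    Real.norm_of_nonneg hρ0.le, Real.norm_of_nonneg hρ0'.le] at h4
  rw [h4] at h1
  have h5 := smul_right_injective (EuclideanSpace ℂ ι) hρ0.ne'
  exact h5 h1

/-- The Weinstein–Moser theorem near a resonant set of frequencies: every Hamiltonian that is
sufficiently close to `‖z‖² / 2` has, on its level `1 / 2`, as many periodic orbits as there are
frequencies in `C`, and these stay near the unit sphere of the coordinate subspace of `C`. -/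
theorem exists_periodic_family (hC : IsResonant C θ) (hθ : ∀ j, 0 < θ j) :
    ∃ η > (0 : NNReal), ∀ (H : EuclideanSpace ℂ ι → ℝ)
      (G : EuclideanSpace ℂ ι → EuclideanSpace ℂ ι),
      IsPerturbation η H G → ∃ x : C → ℝ → EuclideanSpace ℂ ι,
        (∀ j, (∀ t, HasDerivAt (x j) (diagI θ (x j t + G (x j t))) t) ∧
          (∀ t, H (x j t) = 1 / 2) ∧ (∀ t, ‖x j t‖ ≤ 2) ∧
          (∃ T > 0, ∀ t, x j (t + T) = x j t) ∧ (∃ t s, x j t ≠ x j s) ∧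
          ∀ t, ∃ v ∈ coordSphere C, ‖x j t - v‖ ≤ 1 / 4) ∧
        ∀ j k, j ≠ k → Set.range (x j) ≠ Set.range (x k) := by
  have hK := one_le_greenConst C θ
  set K := greenConst C θ with hKdef
  have hsum : 0 ≤ ∑ j, θ j := Finset.sum_nonneg fun j _ => (hθ j).le
  set r : ℝ := (16 * K * (1 + ∑ j, θ j))⁻¹ with hrdef
  have hr0 : 0 < r := by positivity
  have hrK : 16 * K * r ≤ 1 := by
    rw [hrdef, ← div_eq_mul_inv, div_le_one (by positivity)]
    nlinarith
  have hrθ : ∀ j, θ j * r ≤ 1 := fun j => by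
    have : θ j ≤ ∑ j, θ j := Finset.single_le_sum (fun j _ => (hθ j).le) (Finset.mem_univ j)
    rw [hrdef, ← div_eq_mul_inv, div_le_one (by positivity)]
    nlinarith
  have hr1 : 16 * r ≤ 1 := by nlinarith
  refine ⟨(r / (24 * K)).toNNReal, Real.toNNReal_pos.2 (by positivity), fun H G h => ?_⟩
  have hη : 24 * K * ((r / (24 * K)).toNNReal : ℝ) ≤ r := by
    rw [Real.coe_toNNReal _ (by positivity), mul_div_cancel₀]
    positivity
  obtain ⟨η, hηdef⟩ : ∃ η, η = (r / (24 * K)).toNNReal := ⟨_, rfl⟩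
  rw [← hηdef] at hη h
  obtain ⟨z, p, hzp, hzz⟩ := exists_family_isReducedPair hC hθ h hr0.le hrK hη
  have hl : ∀ j, 1 / 2 ≤ 1 + (p j).2.2 := fun j => by
    have := abs_le.1 (reductionBall.bounds (hzp j).2.1.1).2.2
    linarith
  have hE : ∀ j t, H (reductionOrbit θ (z j) (p j) t) = 1 / 2 := fun j =>
    (hzp j).2.1.apply_reductionOrbit_eq hC h (hzp j).1 (by linarith) (hzp j).2.2
  have hd := fun j => (hzp j).2.1.hasDerivAt_reductionOrbit hC (hzp j).1 (hzp j).2.2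
    (by linarith [hl j])
  refine ⟨fun j => reductionOrbit θ (z j) (p j), fun j => ⟨hd j, hE j, fun t => ?_, ?_, ?_,
    fun t => ?_⟩, fun j k hjk hrange => ?_⟩
  · exact norm_reductionCurve_le (hzp j).2.1.1 (hzp j).1.1 (by linarith) _
  · refine ⟨1 + (p j).2.2, by linarith [hl j], fun t => ?_⟩
    simp only [reductionOrbit]
    rw [mul_add, inv_mul_cancel₀ (by linarith [hl j]),
      reductionCurve_add_one hC (hzp j).1.2 (hzp j).2.1.1]
  · by_contra! hall
    have h1 : reductionOrbit θ (z j) (p j) = fun _ => reductionOrbit θ (z j) (p j) 0 :=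
      funext fun t => hall t 0
    have h2 := hd j 0
    rw [h1] at h2
    have h3 := h2.unique (hasDerivAt_const _ _)
    have h4 := diagI_inv_diagI (fun j => (hθ j).ne') (reductionOrbit θ (z j) (p j) 0 +
      G (reductionOrbit θ (z j) (p j) 0))
    rw [h3, map_zero, eq_comm, neg_eq_zero] at h4
    have h5 := h.norm_le (reductionOrbit θ (z j) (p j) 0)
    rw [eq_neg_of_add_eq_zero_right h4, norm_neg] at h5
    have h6 : (η : ℝ) ≤ 1 / 2 := by nlinarith [η.2]
    have h7 : ‖reductionOrbit θ (z j) (p j) 0‖ ≤ 0 := by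
      nlinarith [norm_nonneg (reductionOrbit θ (z j) (p j) 0)]
    have h8 := hE j 0
    rw [norm_le_zero_iff.1 h7, h.zero] at h8
    norm_num at h8
  · refine ⟨rot θ ((1 + (p j).2.2)⁻¹ * t) (z j), rot_mem_coordSphere θ _ (hzp j).1, ?_⟩
    exact (norm_reductionCurve_sub_le (hzp j).2.1.1 (hzp j).1.1 _).trans (by linarith)
  · obtain ⟨s, hs⟩ := (hzp j).2.1.eq_rot_of_range_eq hC hθ h hr1 hrθ (hzp j).1 (hzp j).2.2
      (hzp k).1 (hzp k).2.1 (hzp k).2.2 hrange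
    exact hzz k j hjk.symm s hs

end Orbits

section NormalForm

/-- A positive definite symmetric operator has a symmetric square root. -/
theorem exists_symmetric_sqrt {E : Type*} [NormedAddCommGroup E] [InnerProductSpace ℝ E]
    [FiniteDimensional ℝ E] (Q : E →ₗ[ℝ] E) (hQ : Q.IsSymmetric)
    (hpos : ∀ u, u ≠ 0 → 0 < ⟪Q u, u⟫) :
    ∃ P : E →ₗ[ℝ] E, P.IsSymmetric ∧ ∀ x, P (P x) = Q x := by
  let b := hQ.eigenvectorBasis rfl
  let l := hQ.eigenvalues rfl
  have hl : ∀ j, 0 < l j := fun j => by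
    have h := hpos (b j) (b.orthonormal.ne_zero j)
    rw [hQ.apply_eigenvectorBasis] at h
    simpa [inner_smul_left, b, l] using h
  let P : E →ₗ[ℝ] E := ∑ j, √(l j) • (innerₛₗ ℝ (b j)).smulRight (b j)
  have hP : ∀ x, P x = ∑ j, (√(l j) * ⟪b j, x⟫) • b j := fun x => by
    simp [P, mul_smul]
  refine ⟨P, fun x y => ?_, ?_⟩
  · rw [hP, hP, sum_inner, inner_sum]
    refine Finset.sum_congr rfl fun j _ => ?_
    rw [real_inner_smul_left, real_inner_smul_right, real_inner_comm x (b j)]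
    ring
  · suffices h : P ∘ₗ P = Q from fun x => congrArg (fun R : E →ₗ[ℝ] E => R x) h
    refine b.toBasis.ext fun k => ?_
    have hPk : P (b k) = √(l k) • b k := by
      rw [hP, Finset.sum_eq_single k]
      · rw [real_inner_self_eq_norm_sq, b.orthonormal.norm_eq_one]
        simp
      · intro j _ hj
        rw [b.orthonormal.inner_eq_zero hj, mul_zero, zero_smul]
      · simp
    rw [b.coe_toBasis, LinearMap.comp_apply, hPk, map_smul, hPk, smul_smul,
      Real.mul_self_sqrt (hl k).le]
    exact (hQ.apply_eigenvectorBasis rfl k).symm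

variable {E : Type*} [NormedAddCommGroup E] [InnerProductSpace ℝ E] [FiniteDimensional ℝ E]

/-- An injective antisymmetric operator on a nonzero invariant subspace rotates some plane. -/
theorem exists_rotation_plane (A : E →ₗ[ℝ] E) (hA : ∀ x y, ⟪A x, y⟫ = -⟪x, A y⟫)
    (hinj : Function.Injective A) (W : Submodule ℝ E) (hW : W ≠ ⊥) (hAW : ∀ x ∈ W, A x ∈ W) :
    ∃ (w : ℝ) (e f : E), 0 < w ∧ e ∈ W ∧ f ∈ W ∧ ‖e‖ = 1 ∧ ‖f‖ = 1 ∧ ⟪e, f⟫ = 0 ∧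
      A e = w • f ∧ A f = -(w • e) := by
  have hsymm : (A ∘ₗ A).IsSymmetric := fun x y => by
    simp only [LinearMap.comp_apply]
    rw [hA, hA, neg_neg]
  have hinv : ∀ x ∈ W, (A ∘ₗ A) x ∈ W := fun x hx => hAW _ (hAW _ hx)
  have := Submodule.nontrivial_iff_ne_bot.2 hW
  obtain ⟨v, hv⟩ :=
    (hsymm.restrict_invariant hinv).hasEigenvalue_iSup_of_finiteDimensional.exists_hasEigenvector
  have hv0 : (v : E) ≠ 0 := fun h => hv.2 (Subtype.ext h)
  have hv1 := congrArg Subtype.val hv.apply_eq_smul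
  generalize (⨆ x : { x : W // x ≠ 0 }, _ : ℝ) = μ at hv1
  replace hv1 : A (A v) = μ • (v : E) := hv1
  obtain ⟨e, he⟩ : ∃ e : E, e = ‖(v : E)‖⁻¹ • (v : E) := ⟨_, rfl⟩
  have heW : e ∈ W := he ▸ W.smul_mem _ v.2
  have hen : ‖e‖ = 1 := by rw [he, norm_smul, norm_inv, norm_norm,
    inv_mul_cancel₀ (norm_ne_zero_iff.2 hv0)]
  have hAe : A (A e) = μ • e := by rw [he, map_smul, map_smul, hv1, smul_comm]
  have he0 : A e ≠ 0 := fun h => by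
    rw [hinj (h.trans (map_zero A).symm), norm_zero] at hen
    exact zero_ne_one hen
  have hw := norm_pos_iff.2 he0
  have hμ : μ = -‖A e‖ ^ 2 := by
    have h := hA (A e) e
    rw [hAe, real_inner_smul_left, real_inner_self_eq_norm_sq, real_inner_self_eq_norm_sq, hen] at h
    linarith
  refine ⟨‖A e‖, e, ‖A e‖⁻¹ • A e, hw, heW, W.smul_mem _ (hAW _ heW), hen,
    ?_, ?_, ?_, ?_⟩
  · rw [norm_smul, norm_inv, norm_norm, inv_mul_cancel₀ hw.ne']
  · have h := hA e e
    rw [real_inner_comm] at h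
    rw [real_inner_smul_right]
    have : ⟪e, A e⟫ = 0 := by linarith
    rw [this, mul_zero]
  · rw [smul_inv_smul₀ hw.ne']
  · rw [map_smul, hAe, hμ, smul_smul, ← neg_smul]
    congr 1
    field_simp

theorem exists_isometry_intertwining (A : E →ₗ[ℝ] E) (hA : ∀ x y, ⟪A x, y⟫ = -⟪x, A y⟫)
    (hinj : Function.Injective A) (k : ℕ) (hk : 2 * k ≤ Module.finrank ℝ E) :
    ∃ (w : Fin k → ℝ) (U : EuclideanSpace ℂ (Fin k) →ₗᵢ[ℝ] E), (∀ j, 0 < w j) ∧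
      ∀ z, U (diagI w z) = A (U z) := by
  induction k with
  | zero =>
    refine ⟨fun _ => 1, ⟨0, fun x => ?_⟩, fun j => j.elim0, fun z => ?_⟩
    · rw [Subsingleton.elim x 0]; simp
    · simp [Subsingleton.elim z 0]
  | succ k ih =>
    obtain ⟨w, U, hw, hU⟩ := ih (by omega)
    obtain ⟨W, hWdef⟩ : ∃ W, W = (LinearMap.range U.toLinearMap)ᗮ := ⟨_, rfl⟩
    have hW : W ≠ ⊥ := by
      intro h
      rw [hWdef, Submodule.orthogonal_eq_bot_iff] at h
      have h1 := LinearMap.finrank_range_of_inj U.injective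
      have h2 : Module.finrank ℝ (EuclideanSpace ℂ (Fin k)) = 2 * k := by
        rw [← Module.finrank_mul_finrank ℝ ℂ, finrank_euclideanSpace_fin,
          Complex.finrank_real_complex]
      have h3 : Module.finrank ℝ (LinearMap.range U.toLinearMap) = Module.finrank ℝ E := by
        rw [h, finrank_top]
      have h4 : Module.finrank ℝ (LinearMap.range U.toLinearMap) = 2 * k := h1.trans h2
      omega
    have hperp : ∀ x ∈ W, ∀ z, ⟪U z, x⟫ = 0 := fun x hx z => by
      rw [hWdef] at hx
      exact (Submodule.mem_orthogonal _ x).1 hx _ ⟨z, rfl⟩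
    have hAW : ∀ x ∈ W, A x ∈ W := fun x hx => by
      rw [hWdef, Submodule.mem_orthogonal]
      rintro _ ⟨z, rfl⟩
      have h := hA (U z) x
      rw [← hU, hperp x hx] at h
      change ⟪U z, A x⟫ = 0
      linarith
    obtain ⟨w₀, e, f, hw₀, he, hf, hen, hfn, hef, hAe, hAf⟩ :=
      exists_rotation_plane A hA hinj W hW hAW
    let tail : EuclideanSpace ℂ (Fin (k + 1)) →ₗ[ℝ] EuclideanSpace ℂ (Fin k) :=
      { toFun := fun z => WithLp.toLp 2 fun j => z j.succ
        map_add' := fun _ _ => rfl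
        map_smul' := fun _ _ => rfl }
    let V : EuclideanSpace ℂ (Fin (k + 1)) →ₗ[ℝ] E :=
      { toFun := fun z => U (tail z) + ((z 0).re • e + (z 0).im • f)
        map_add' := fun x y => by
          simp only [map_add, PiLp.add_apply, Complex.add_re, Complex.add_im]
          module
        map_smul' := fun c x => by
          simp only [map_smul, PiLp.smul_apply, Complex.smul_re, Complex.smul_im, smul_eq_mul,
            RingHom.id_apply]
          module }
    refine ⟨Fin.cons w₀ w, ⟨V, fun z => ?_⟩, fun j => ?_, fun z => ?_⟩
    · change ‖U (tail z) + ((z 0).re • e + (z 0).im • f)‖ = ‖z‖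
      have h1 : ⟪U (tail z), (z 0).re • e + (z 0).im • f⟫ = 0 :=
        hperp _ (W.add_mem (W.smul_mem _ he) (W.smul_mem _ hf)) _
      have h2 : ⟪(z 0).re • e, (z 0).im • f⟫ = 0 := by
        rw [real_inner_smul_left, real_inner_smul_right, hef]; ring
      rw [← sq_eq_sq₀ (norm_nonneg _) (norm_nonneg _), sq,
        norm_add_sq_eq_norm_sq_add_norm_sq_real h1, norm_add_sq_eq_norm_sq_add_norm_sq_real h2,
        U.norm_map, norm_smul, norm_smul, hen, hfn, EuclideanSpace.norm_sq_eq, Fin.sum_univ_succ,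
        Complex.sq_norm, Complex.normSq_apply, ← sq, EuclideanSpace.norm_sq_eq]
      simp only [mul_one, Real.norm_eq_abs, abs_mul_abs_self]
      change (∑ j : Fin k, ‖z j.succ‖ ^ 2) + _ = _
      ring
    · refine Fin.cases ?_ (fun i => ?_) j
      · exact hw₀
      · exact hw i
    · change U (tail (diagI (Fin.cons w₀ w) z)) + ((diagI (Fin.cons w₀ w) z 0).re • e +
        (diagI (Fin.cons w₀ w) z 0).im • f) = A (U (tail z) + ((z 0).re • e + (z 0).im • f))
      have h1 : tail (diagI (Fin.cons w₀ w) z) = diagI w (tail z) := by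
        ext j; rfl
      rw [h1, hU, map_add, map_add, map_smul, map_smul, hAe, hAf]
      have h2 : diagI (Fin.cons w₀ w) z 0 = (w₀ : ℂ) * Complex.I * z 0 := rfl
      rw [h2]
      simp only [Complex.mul_re, Complex.mul_im, Complex.I_re, Complex.I_im, Complex.ofReal_re,
        Complex.ofReal_im]
      module

end NormalForm

section Williamson

/-- **Williamson normal form.** A positive definite quadratic form is diagonalised by a linear
map `S` carrying the symplectic structure to a weighted one; `T` is the adjoint of `S`. -/
theorem exists_williamson (n : ℕ)
    (Q : EuclideanSpace ℂ (Fin n) →ₗ[ℝ] EuclideanSpace ℂ (Fin n)) (hQ : Q.IsSymmetric)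
    (hpos : ∀ u, u ≠ 0 → 0 < ⟪Q u, u⟫) :
    ∃ (w : Fin n → ℝ) (S : EuclideanSpace ℂ (Fin n) ≃L[ℝ] EuclideanSpace ℂ (Fin n))
      (T : EuclideanSpace ℂ (Fin n) →L[ℝ] EuclideanSpace ℂ (Fin n)), (∀ j, 0 < w j) ∧
      (∀ x y, ⟪S x, y⟫ = ⟪x, T y⟫) ∧ (∀ x, S (diagI w (T x)) = Complex.I • x) ∧
      ∀ x, T (Q (S x)) = x := by
  obtain ⟨P, hP, hPQ⟩ := exists_symmetric_sqrt Q hQ hpos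
  have hPinj : Function.Injective P := by
    refine (injective_iff_map_eq_zero P).2 fun x hx => ?_
    by_contra h
    have := hpos x h
    rw [← hPQ, hx, map_zero, inner_zero_left] at this
    exact this.false
  let J : EuclideanSpace ℂ (Fin n) →ₗ[ℝ] EuclideanSpace ℂ (Fin n) :=
    (LinearMap.lsmul ℂ _ Complex.I).restrictScalars ℝ
  have hJ : ∀ x, J x = Complex.I • x := fun x => rfl
  have hJ1 : ∀ x : EuclideanSpace ℂ (Fin n), diagI (fun _ => 1) x = Complex.I • x := fun x => by
    ext j; simp
  have hdim : Module.finrank ℝ (EuclideanSpace ℂ (Fin n)) = 2 * n := by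
    rw [← Module.finrank_mul_finrank ℝ ℂ, finrank_euclideanSpace_fin, Complex.finrank_real_complex]
  have hA : ∀ x y, ⟪(P ∘ₗ J ∘ₗ P) x, y⟫ = -⟪x, (P ∘ₗ J ∘ₗ P) y⟫ := fun x y => by
    simp only [LinearMap.comp_apply, hJ]
    rw [hP, ← hP x, ← hJ1, ← hJ1, inner_diagI_left]
  have hAinj : Function.Injective (P ∘ₗ J ∘ₗ P) := by
    have hJinj : Function.Injective J := smul_right_injective _ Complex.I_ne_zero
    exact hPinj.comp (hJinj.comp hPinj)
  obtain ⟨w, U, hw, hU⟩ := exists_isometry_intertwining _ hA hAinj n hdim.ge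
  let U' := U.toLinearIsometryEquiv rfl
  let P' := LinearEquiv.ofInjectiveEndo P hPinj
  have hP' : ∀ x, P (P'.symm x) = x := fun x => P'.apply_symm_apply x
  have hP'' : ∀ x, P'.symm (P x) = x := fun x => P'.symm_apply_apply x
  have hU' : ∀ x, U (U'.symm x) = x := fun x => U'.apply_symm_apply x
  refine ⟨w, (U'.toLinearEquiv.trans P'.symm).toContinuousLinearEquiv,
    (P'.symm.trans U'.symm.toLinearEquiv).toContinuousLinearEquiv, hw, fun x y => ?_, fun x => ?_,
    fun x => ?_⟩
  · change ⟪P'.symm (U x), y⟫ = ⟪x, U'.symm (P'.symm y)⟫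
    rw [← U.inner_map_map x, hU']
    conv_lhs => rw [← hP' y]
    rw [← hP, hP']
  · change P'.symm (U (diagI w (U'.symm (P'.symm x)))) = _
    rw [hU, hU']
    simp only [LinearMap.comp_apply]
    rw [hP', hP'', hJ]
  · change U'.symm (P'.symm (Q (P'.symm (U x)))) = x
    rw [← hPQ, hP', hP'']
    exact U'.symm_apply_apply x

end Williamson

section Hessian

variable {E : Type*} [NormedAddCommGroup E] [InnerProductSpace ℝ E] [FiniteDimensional ℝ E]
  {f : E → ℝ}

/-- The inverse of the Riesz isomorphism of a real inner product space, as a linear map. -/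
noncomputable def rieszMap (E : Type*) [NormedAddCommGroup E] [InnerProductSpace ℝ E]
    [FiniteDimensional ℝ E] : StrongDual ℝ E →L[ℝ] E :=
  LinearMap.toContinuousLinearMap
    { toFun := (InnerProductSpace.toDual ℝ E).symm
      map_add' := map_add _
      map_smul' := fun c x => by simp }

/-- The derivative of the gradient of a function. -/
noncomputable def hessianMap (f : E → ℝ) (x : E) : E →L[ℝ] E :=
  rieszMap E ∘L fderiv ℝ (fderiv ℝ f) x

theorem inner_hessianMap (f : E → ℝ) (x u v : E) :
    ⟪hessianMap f x u, v⟫ = fderiv ℝ (fderiv ℝ f) x u v :=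
  InnerProductSpace.toDual_symm_apply (𝕜 := ℝ)

theorem ContDiff.hasStrictFDerivAt_gradient (hf : ContDiff ℝ (⊤ : ℕ∞) f) (x : E) :
    HasStrictFDerivAt (gradient f) (hessianMap f x) x := by
  have h : ContDiff ℝ 1 (fderiv ℝ f) := hf.fderiv_right (by norm_cast)
  exact (rieszMap E).hasStrictFDerivAt.comp x
    (h.contDiffAt.hasStrictFDerivAt one_ne_zero)

theorem ContDiff.hessianMap_isSymmetric (hf : ContDiff ℝ (⊤ : ℕ∞) f) (x : E) :
    (hessianMap f x : E →ₗ[ℝ] E).IsSymmetric := fun u v => by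
  have h : IsSymmSndFDerivAt ℝ f x :=
    hf.contDiffAt.isSymmSndFDerivAt (by simpa using WithTop.coe_le_coe.2 (le_top (a := (2 : ℕ∞))))
  change ⟪hessianMap f x u, v⟫ = ⟪u, hessianMap f x v⟫
  rw [real_inner_comm (hessianMap f x v) u, inner_hessianMap, inner_hessianMap, h.eq]

end Hessian

section Scaling

variable {n : ℕ} {f : EuclideanSpace ℂ (Fin n) → ℝ}

/-- In Williamson coordinates, the rescaled Hamiltonians converge to `‖z‖² / 2`. -/
theorem exists_isPerturbation_scaling (hf : ContDiff ℝ (⊤ : ℕ∞) f) (hf0 : f 0 = 0)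
    (hgrad : gradient f 0 = 0) (S : EuclideanSpace ℂ (Fin n) ≃L[ℝ] EuclideanSpace ℂ (Fin n))
    (T : EuclideanSpace ℂ (Fin n) →L[ℝ] EuclideanSpace ℂ (Fin n))
    (hST : ∀ x y, ⟪S x, y⟫ = ⟪x, T y⟫) (hT : ∀ x, T (hessianMap f 0 (S x)) = x)
    {η : NNReal} (hη : 0 < η) :
    ∃ δ₀ > (0 : ℝ), ∀ δ ∈ Set.Ioo 0 δ₀, ∃ G,
      IsPerturbation η (fun z => (δ ^ 2)⁻¹ * f (S (δ • z))) G ∧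
      ∀ z, ‖z‖ ≤ 2 → δ • (z + G z) = T (gradient f (S (δ • z))) := by
  obtain ⟨ρ, hρ⟩ : ∃ ρ : EuclideanSpace ℂ (Fin n) → EuclideanSpace ℂ (Fin n),
    ρ = fun z => T (gradient f (S z)) - z := ⟨_, rfl⟩
  have hρd : HasStrictFDerivAt ρ
      (0 : EuclideanSpace ℂ (Fin n) →L[ℝ] EuclideanSpace ℂ (Fin n)) 0 := by
    have h1 : HasStrictFDerivAt (gradient f) (hessianMap f 0) (S 0) := by
      rw [map_zero]; exact hf.hasStrictFDerivAt_gradient 0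
    have h2 := (T.hasStrictFDerivAt.comp 0 (h1.comp 0 S.hasStrictFDerivAt)).sub
      (hasStrictFDerivAt_id (0 : EuclideanSpace ℂ (Fin n)))
    have h3 : T ∘L (hessianMap f 0 ∘L (S : EuclideanSpace ℂ (Fin n) →L[ℝ] _)) -
        ContinuousLinearMap.id ℝ (EuclideanSpace ℂ (Fin n)) = 0 := by
      refine ContinuousLinearMap.ext fun x => ?_
      simp only [sub_apply, ContinuousLinearMap.comp_apply,
        ContinuousLinearEquiv.coe_coe, hT]
      simp
    rw [h3] at h2
    rw [hρ]
    exact h2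
  have hρ0 : ρ 0 = 0 := by simp [hρ, hgrad]
  have hc := lipschitzExtensionConstant_pos (EuclideanSpace ℂ (Fin n))
  obtain ⟨c, hcdef⟩ : ∃ c, c = lipschitzExtensionConstant (EuclideanSpace ℂ (Fin n)) := ⟨_, rfl⟩
  rw [← hcdef] at hc
  obtain ⟨s, hs, hLip⟩ := hρd.exists_lipschitzOnWith_of_nnnorm_lt (η / c)
    (by rw [nnnorm_zero]; positivity)
  obtain ⟨R, hR, hRs⟩ := Metric.mem_nhds_iff.1 hs
  refine ⟨R / 2, by positivity, fun δ hδ => ?_⟩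
  have hδ0 := hδ.1
  have hball : ∀ z ∈ Metric.closedBall (0 : EuclideanSpace ℂ (Fin n)) 2, δ • z ∈ s := fun z hz => by
    rw [mem_closedBall_zero_iff] at hz
    refine hRs (mem_ball_zero_iff.2 ?_)
    rw [norm_smul, Real.norm_of_nonneg hδ0.le]
    nlinarith [hδ.2]
  have hLip' : LipschitzOnWith (η / c) (fun z => δ⁻¹ • ρ (δ • z))
      (Metric.closedBall (0 : EuclideanSpace ℂ (Fin n)) 2) := by
    refine LipschitzOnWith.of_dist_le_mul fun x hx y hy => ?_
    have h := hLip.dist_le_mul _ (hball x hx) _ (hball y hy)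
    rw [dist_smul₀, Real.norm_of_nonneg hδ0.le] at h
    rw [dist_smul₀, norm_inv, Real.norm_of_nonneg hδ0.le, inv_mul_le_iff₀ hδ0]
    linarith
  obtain ⟨G, hG, hGe⟩ := hLip'.extend_finite_dimension
  rw [← hcdef, mul_div_cancel₀ _ hc.ne'] at hG
  have hGz : ∀ z, ‖z‖ ≤ 2 → δ • (z + G z) = T (gradient f (S (δ • z))) := fun z hz => by
    rw [← hGe (mem_closedBall_zero_iff.2 hz), smul_add, smul_inv_smul₀ hδ0.ne', hρ]
    simp
  refine ⟨G, ⟨?_, ?_, hG, ?_, fun z hz => ?_⟩, hGz⟩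
  · have := hf.continuous
    fun_prop
  · simp [hf0]
  · rw [← hGe (mem_closedBall_zero_iff.2 (by simp))]
    simp [hρ0]
  · have h1 : HasFDerivAt f (InnerProductSpace.toDual ℝ _ (gradient f (S (δ • z)))) (S (δ • z)) :=
      ((hf.differentiable (by simp)) _).hasGradientAt.hasFDerivAt
    have h2 : HasFDerivAt (fun z => S (δ • z))
        ((S : EuclideanSpace ℂ (Fin n) →L[ℝ] EuclideanSpace ℂ (Fin n)) ∘L
          (δ • ContinuousLinearMap.id ℝ (EuclideanSpace ℂ (Fin n)))) z :=
      (S : EuclideanSpace ℂ (Fin n) →L[ℝ] EuclideanSpace ℂ (Fin n)).hasFDerivAt.comp z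
        ((hasFDerivAt_id z).const_smul δ)
    have h3 := (h1.comp z h2).const_mul (δ ^ 2)⁻¹
    rw [hasGradientAt_iff_hasFDerivAt]
    refine h3.congr_fderiv (ContinuousLinearMap.ext fun v => ?_)
    have h4 : z + G z = δ⁻¹ • T (gradient f (S (δ • z))) := by
      rw [← hGz z hz, inv_smul_smul₀ hδ0.ne']
    simp only [InnerProductSpace.toDual_apply_apply, smul_apply,
      ContinuousLinearMap.comp_apply, ContinuousLinearEquiv.coe_coe, ContinuousLinearMap.id_apply,
      map_smul, smul_eq_mul]
    rw [h4, real_inner_smul_left, real_inner_comm v, ← hST, real_inner_comm _ (S v), map_smul]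
    field_simp

end Scaling

section Assembly

variable {n : ℕ} {f : EuclideanSpace ℂ (Fin n) → ℝ}

/-- Periodic orbits of `f` on small levels, near the coordinate subspace of a resonant set. -/
theorem exists_periodic_family_of_resonant (hf : ContDiff ℝ (⊤ : ℕ∞) f) (hf0 : f 0 = 0)
    (hgrad : gradient f 0 = 0) {w : Fin n → ℝ} (hw : ∀ j, 0 < w j)
    (S : EuclideanSpace ℂ (Fin n) ≃L[ℝ] EuclideanSpace ℂ (Fin n))
    (T : EuclideanSpace ℂ (Fin n) →L[ℝ] EuclideanSpace ℂ (Fin n))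
    (hST : ∀ x y, ⟪S x, y⟫ = ⟪x, T y⟫) (hSwT : ∀ x, S (diagI w (T x)) = Complex.I • x)
    (hT : ∀ x, T (hessianMap f 0 (S x)) = x) {C : Set (Fin n)} {β : ℝ} (hβ : 0 < β)
    (hC : IsResonant C fun j => w j / β) :
    ∃ δ₀ > (0 : ℝ), ∀ δ ∈ Set.Ioo 0 δ₀, ∃ γ : C → ℝ → EuclideanSpace ℂ (Fin n),
      (∀ j, (∀ t, HasDerivAt (γ j) (Complex.I • gradient f (γ j t)) t) ∧
        (∀ t, f (γ j t) = δ ^ 2 / 2) ∧ (∃ p > 0, ∀ t, γ j (t + p) = γ j t) ∧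
        (∃ t s, γ j t ≠ γ j s) ∧
        ∀ t, ∃ v ∈ coordSphere C, ‖δ⁻¹ • S.symm (γ j t) - v‖ ≤ 1 / 4) ∧
      ∀ j k, j ≠ k → Set.range (γ j) ≠ Set.range (γ k) := by
  obtain ⟨η, hη, hfam⟩ := exists_periodic_family hC fun j => div_pos (hw j) hβ
  obtain ⟨δ₀, hδ₀, hscale⟩ := exists_isPerturbation_scaling hf hf0 hgrad S T hST hT hη
  refine ⟨δ₀, hδ₀, fun δ hδ => ?_⟩
  obtain ⟨G, hG, hGz⟩ := hscale δ hδ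
  obtain ⟨x, hx, hxr⟩ := hfam _ G hG
  have hδ0 := hδ.1
  have hinj : Function.Injective fun z : EuclideanSpace ℂ (Fin n) => S (δ • z) :=
    S.injective.comp (smul_right_injective _ hδ0.ne')
  have hdiag : ∀ y : EuclideanSpace ℂ (Fin n),
      β • diagI (fun j => w j / β) y = diagI w y := fun y => by
    ext j
    have hβ' : (β : ℂ) ≠ 0 := by exact_mod_cast hβ.ne'
    simp only [PiLp.smul_apply, diagI_apply, Complex.real_smul, Complex.ofReal_div]
    field_simp
  refine ⟨fun j t => S (δ • x j (β * t)), fun j => ?_, fun j k hjk hr => hxr j k hjk ?_⟩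
  · obtain ⟨hd, hH, hb, ⟨p, hp, hper⟩, ⟨t, s, hts⟩, hv⟩ := hx j
    refine ⟨fun t => ?_, fun t => ?_, ⟨p / β, by positivity, fun t => ?_⟩,
      ⟨t / β, s / β, fun h => hts ?_⟩, fun t => ?_⟩
    · have h1 := (hd (β * t)).scomp t ((hasDerivAt_id t).const_mul β)
      have h2 := (S : EuclideanSpace ℂ (Fin n) →L[ℝ]
        EuclideanSpace ℂ (Fin n)).hasFDerivAt.comp_hasDerivAt t (h1.const_smul δ)
      refine h2.congr_deriv ?_
      rw [mul_one, hdiag, ← hSwT, ← hGz _ (hb _), map_smul (diagI w)]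
      rfl
    · have h := hH (β * t)
      field_simp at h ⊢
      linarith
    · simp only
      rw [mul_add, mul_div_cancel₀ _ hβ.ne', hper]
    · have h' := hinj h
      rwa [mul_div_cancel₀ _ hβ.ne', mul_div_cancel₀ _ hβ.ne'] at h'
    · obtain ⟨v, hv, hvx⟩ := hv (β * t)
      refine ⟨v, hv, ?_⟩
      rwa [S.symm_apply_apply, inv_smul_smul₀ hδ0.ne']
  · have hrange : ∀ j, Set.range (fun t => S (δ • x j (β * t))) =
        (fun z : EuclideanSpace ℂ (Fin n) => S (δ • z)) '' Set.range (x j) := fun j => by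
      have hs : Function.Surjective fun t : ℝ => β * t := fun t =>
        ⟨t / β, mul_div_cancel₀ _ hβ.ne'⟩
      rw [← Set.range_comp]
      exact hs.range_comp ((fun z : EuclideanSpace ℂ (Fin n) => S (δ • z)) ∘ x j)
    rw [hrange, hrange] at hr
    exact hinj.image_injective hr

/-- Frequencies commensurable with `w j₀` become integral in a suitable unit. -/
theorem exists_isResonant_commensurable {w : Fin n → ℝ} (hw : ∀ j, 0 < w j) (j₀ : Fin n) :
    ∃ β > (0 : ℝ), IsResonant {k | ∃ q : ℚ, w k = q * w j₀} fun j => w j / β := by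
  classical
  let q : Fin n → ℚ := fun k => if h : ∃ q : ℚ, w k = q * w j₀ then h.choose else 1
  have hq : ∀ k, (∃ q : ℚ, w k = q * w j₀) → w k = q k * w j₀ := fun k h => by
    simp only [q, dif_pos h]
    exact h.choose_spec
  let N : ℕ := ∏ k, (q k).den
  have hN : 0 < N := Finset.prod_pos fun k _ => (q k).den_pos
  have hN' : (0 : ℝ) < N := by exact_mod_cast hN
  have hj := hw j₀
  refine ⟨w j₀ / (2 * Real.pi * N), by positivity, fun k => ?_⟩
  rw [Complex.exp_eq_one_iff]
  have key : ∀ m : ℤ, ((w k / (w j₀ / (2 * Real.pi * N)) : ℝ) : ℂ) * Complex.I =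
      m * (2 * Real.pi * Complex.I) ↔ w k * N = m * w j₀ := fun m => by
    have h1 : (m : ℂ) * (2 * Real.pi * Complex.I) = ((m * (2 * Real.pi) : ℝ) : ℂ) * Complex.I := by
      push_cast; ring
    rw [h1, mul_left_inj' Complex.I_ne_zero, Complex.ofReal_inj, div_div_eq_mul_div,
      div_eq_iff hj.ne']
    constructor
    · intro h
      have := Real.pi_pos
      have h2 : 2 * Real.pi * (w k * N) = 2 * Real.pi * (m * w j₀) := by linarith
      exact mul_left_cancel₀ (by positivity) h2
    · intro h
      linear_combination 2 * Real.pi * h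
  simp only [key, Set.mem_ofPred_eq]
  constructor
  · rintro ⟨m, hm⟩
    refine ⟨m / N, ?_⟩
    push_cast
    field_simp
    exact hm
  · intro h
    obtain ⟨d, hd⟩ : (q k).den ∣ N := Finset.dvd_prod_of_mem _ (Finset.mem_univ k)
    refine ⟨(q k).num * d, ?_⟩
    have h1 : (q k : ℝ) * (q k).den = (q k).num := by exact_mod_cast Rat.mul_den_eq_num (q k)
    rw [hq k h, hd]
    push_cast
    linear_combination (w j₀ * d) * h1

/-- Points of the unit spheres of two orthogonal coordinate subspaces are far apart. -/
theorem norm_sub_of_mem_coordSphere {C D : Set (Fin n)} (hCD : Disjoint C D)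
    {u v : EuclideanSpace ℂ (Fin n)} (hu : u ∈ coordSphere C) (hv : v ∈ coordSphere D) :
    1 ≤ ‖u - v‖ := by
  have h : ⟪u, v⟫ = 0 := by
    rw [PiLp.inner_apply]
    refine Finset.sum_eq_zero fun j _ => ?_
    by_cases hj : j ∈ C
    · rw [hv.2 j (Set.disjoint_left.1 hCD hj), inner_zero_right]
    · rw [hu.2 j hj, inner_zero_left]
  have h1 := norm_sub_sq_real u v
  rw [h, hu.1, hv.1] at h1
  nlinarith [norm_nonneg (u - v)]

end Assembly

/-- **Weinstein–Moser theorem.** Near a non-degenerate local minimum of a smooth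
Hamiltonian `f : ℝ^{2n} = ℂ^n → ℝ` (with `f(0) = 0`, `∇f(0) = 0`, `d²f(0)` positive
definite), every sufficiently small level `{f = ε}` carries at least `n` geometrically
distinct periodic orbits of the Hamiltonian flow `γ' = i∇f(γ)`. -/
theorem weinstein_moser (n : ℕ) (hn : 1 ≤ n)
    (f : EuclideanSpace ℂ (Fin n) → ℝ) (hf : ContDiff ℝ (⊤ : ℕ∞) f)
    (hf0 : f 0 = 0) (hgrad : gradient f 0 = 0)
    (hHess : ∀ u : EuclideanSpace ℂ (Fin n), u ≠ 0 →
      0 < iteratedFDeriv ℝ 2 f 0 ![u, u]) :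
    ∃ ε₀ > (0 : ℝ), ∀ ε ∈ Set.Ioo (0 : ℝ) ε₀,
      ∃ γ : Fin n → ℝ → EuclideanSpace ℂ (Fin n),
        (∀ j, (∀ t, HasDerivAt (γ j)
            ((Complex.I • gradient f (γ j t) : EuclideanSpace ℂ (Fin n))) t) ∧
          (∀ t, f (γ j t) = ε) ∧
          (∃ T > 0, ∀ t, γ j (t + T) = γ j t) ∧
          (∃ t s, γ j t ≠ γ j s)) ∧
        (∀ j k, j ≠ k → Set.range (γ j) ≠ Set.range (γ k)) := by
  have hQ : ∀ u, u ≠ 0 → 0 < ⟪hessianMap f 0 u, u⟫ := fun u hu => by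
    have h := hHess u hu
    rw [iteratedFDeriv_two_apply] at h
    rw [inner_hessianMap]
    exact h
  obtain ⟨w, S, T, hw, hST, hSwT, hT⟩ :=
    exists_williamson n _ (hf.hessianMap_isSymmetric 0) hQ
  let r : Setoid (Fin n) :=
    { r := fun j k => ∃ q : ℚ, w k = q * w j
      iseqv :=
        { refl := fun j => ⟨1, by simp⟩
          symm := fun {j k} ⟨q, hq⟩ => by
            have hq0 : (q : ℝ) ≠ 0 := fun h => (hw k).ne' (by rw [hq, h, zero_mul])
            refine ⟨q⁻¹, ?_⟩
            rw [hq, Rat.cast_inv, inv_mul_cancel_left₀ hq0]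
          trans := fun {i j k} ⟨p, hp⟩ ⟨q, hq⟩ => by
            refine ⟨q * p, ?_⟩
            rw [hq, hp, Rat.cast_mul, mul_assoc] } }
  let C : Quotient r → Set (Fin n) := fun c => {k | ∃ q : ℚ, w k = q * w c.out}
  have hmem : ∀ c k, k ∈ C c ↔ Quotient.mk r k = c := fun c k => by
    conv_rhs => rw [← c.out_eq, eq_comm]
    exact (Quotient.eq (r := r)).symm
  have hex := fun c : Quotient r => exists_isResonant_commensurable hw c.out
  choose β hβ hres using hex
  choose δ₀ hδ₀ hfam using fun c : Quotient r =>
    exists_periodic_family_of_resonant hf hf0 hgrad hw S T hST hSwT hT (hβ c) (hres c)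
  have : Nonempty (Quotient r) := ⟨Quotient.mk r ⟨0, hn⟩⟩
  obtain ⟨c₀, hc₀⟩ := Finite.exists_min δ₀
  refine ⟨δ₀ c₀ ^ 2 / 2, by have := hδ₀ c₀; positivity, fun ε hε => ?_⟩
  have hε0 := hε.1
  obtain ⟨δ, hδ⟩ : ∃ δ, δ = √(2 * ε) := ⟨_, rfl⟩
  have hδ0 : 0 < δ := hδ ▸ Real.sqrt_pos.2 (by positivity)
  have hδsq : δ ^ 2 = 2 * ε := hδ ▸ Real.sq_sqrt (by positivity)
  have hδlt : δ < δ₀ c₀ := by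
    refine lt_of_pow_lt_pow_left₀ 2 (hδ₀ c₀).le ?_
    rw [hδsq]
    linarith [hε.2]
  choose γ hγ hγr using fun c => hfam c δ ⟨hδ0, hδlt.trans_le (hc₀ c)⟩
  have hcross : ∀ c d (j : C c) (k : C d), Set.range (γ c j) = Set.range (γ d k) → c = d := by
    intro c d j k h
    by_contra hcd
    have hdisj : Disjoint (C c) (C d) := Set.disjoint_left.2 fun i hi hi' =>
      hcd (((hmem c i).1 hi).symm.trans ((hmem d i).1 hi'))
    obtain ⟨t, ht⟩ : γ c j 0 ∈ Set.range (γ d k) := h ▸ ⟨0, rfl⟩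
    obtain ⟨u, hu, huc⟩ := (hγ c j).2.2.2.2 0
    obtain ⟨v, hv, hvd⟩ := (hγ d k).2.2.2.2 t
    rw [ht] at hvd
    have h1 := norm_sub_of_mem_coordSphere hdisj hu hv
    have h2 := norm_sub_le_norm_sub_add_norm_sub u (δ⁻¹ • S.symm (γ c j 0)) v
    rw [norm_sub_rev] at huc
    linarith
  have hsame : ∀ c d (j : C c) (k : C d), Set.range (γ c j) = Set.range (γ d k) →
      (j : Fin n) = k := by
    intro c d j k h
    obtain rfl := hcross c d j k h
    by_contra hjk
    exact hγr c j k (fun e => hjk (congrArg Subtype.val e)) h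
  refine ⟨fun j => γ (Quotient.mk r j) ⟨j, (hmem _ j).2 rfl⟩, fun j => ?_,
    fun j k hjk h => hjk (hsame _ _ _ _ h)⟩
  obtain ⟨h1, h2, h3, h4, -⟩ := hγ (Quotient.mk r j) ⟨j, (hmem _ j).2 rfl⟩
  exact ⟨h1, fun t => by rw [h2, hδsq]; ring, h3, h4⟩
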